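/- arXiv:1810.01779 — 6 statements merged into one kernel-verified Lean document; each statement's English description precedes it below -/
import Mathlib

section
/- Assume (H1) and (H2)*, let ψ_t[h] denote the unique time-locally bounded solution of the mild NTE with initial datum h, set β(r,υ) := σ_f(r,υ)·(∫_V π_f(r,υ,υ')dυ' − 1) and β̄ := sup_{(r,υ)∈D×V} β(r,υ). Suppose λ_c ∈ ℝ, η is a probability measure on D×V satisfying ∫_{D×V} e^{−β̄ t}·ψ_t[g] dη = e^{λ_c t}·∫_{D×V} g dη for all t ≥ 0 and all bounded measurable g : D×V → [0,∞), and φ : D×V → (0,∞) is a bounded measurable function satisfying e^{−β̄ t}·ψ_t[φ] = e^{λ_c t}·φ for all t ≥ 0. Then: (i) φ is bounded away from 0 on every compact subset of D×V; (ii) η is absolutely continuous with respect to Lebesgue measure on D×V, with a density that is essentially bounded and is almost everywhere bounded away from 0 on every compact subset of D×V. -/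
open MeasureTheory Set
open scoped ENNReal

noncomputable section

/-- Points/velocities live in `ℝ³`. -/
abbrev Pt : Type := EuclideanSpace ℝ (Fin 3)

/-- The velocity space `V = {υ ∈ ℝ³ : vmin ≤ ‖υ‖ ≤ vmax}`. -/
def Vel (vmin vmax : ℝ) : Set Pt := {υ : Pt | vmin ≤ ‖υ‖ ∧ ‖υ‖ ≤ vmax}

/-- The exit time `κ_{r,υ} = inf {t > 0 : r + tυ ∉ D}`. -/
def exitTime (D : Set Pt) (r υ : Pt) : ℝ := sInf {t : ℝ | 0 < t ∧ r + t • υ ∉ D}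

/-- The advection semigroup `U_t[g](r,υ) = g(r+υt, υ)·1_{t < κ_{r,υ}}`. -/
def advect (D : Set Pt) (g : Pt → Pt → ℝ) (t : ℝ) (r υ : Pt) : ℝ :=
  if t < exitTime D r υ then g (r + t • υ) υ else 0

/-- The combined backwards scatter-plus-fission operator `(S + F) f`,
extended by zero outside `D × V`. -/
def scatFis (D V : Set Pt) (σs σf : Pt → Pt → ℝ) (πs πf : Pt → Pt → Pt → ℝ)
    (f : Pt → Pt → ℝ) (r υ : Pt) : ℝ :=
  (D ×ˢ V).indicator
    (fun p : Pt × Pt =>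
      σs p.1 p.2 * ((∫ υ' in V, f p.1 υ' * πs p.1 p.2 υ') - f p.1 p.2) +
      σf p.1 p.2 * ((∫ υ' in V, f p.1 υ' * πf p.1 p.2 υ') - f p.1 p.2))
    (r, υ)

/-- `g` is a nonnegative, bounded, measurable function on `Pt × Pt` (in curried form). -/
def BddMeasNN (g : Pt → Pt → ℝ) : Prop :=
  Measurable (Function.uncurry g) ∧ (∀ r υ, 0 ≤ g r υ) ∧ ∃ M : ℝ, ∀ r υ, g r υ ≤ M

/-- `ψ` is a family of nonnegative bounded measurable functions, vanishing off `D × V`,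
solving the mild neutron transport equation
`ψ_t[g] = U_t[g] + ∫₀ᵗ U_s[(S+F) ψ_{t-s}[g]] ds` pointwise on `D × V` for all `t ≥ 0`. -/
def IsMildSolution (D V : Set Pt) (σs σf : Pt → Pt → ℝ) (πs πf : Pt → Pt → Pt → ℝ)
    (g : Pt → Pt → ℝ) (ψ : ℝ → Pt → Pt → ℝ) : Prop :=
  (∀ t : ℝ, Measurable (Function.uncurry (ψ t))) ∧
  (∀ t r υ, 0 ≤ ψ t r υ) ∧
  (∀ t : ℝ, ∃ M : ℝ, ∀ r υ, ψ t r υ ≤ M) ∧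
  (∀ t r υ, (r, υ) ∉ D ×ˢ V → ψ t r υ = 0) ∧
  (∀ t : ℝ, 0 ≤ t → ∀ r υ : Pt, (r, υ) ∈ D ×ˢ V →
    ψ t r υ = advect D g t r υ +
      ∫ s in (0:ℝ)..t, advect D (scatFis D V σs σf πs πf (ψ (t - s))) s r υ)

/-- Uniform boundedness on `D × V × [0,T]` for every `T > 0`. -/
def TimeLocBounded (ψ : ℝ → Pt → Pt → ℝ) : Prop :=
  ∀ T : ℝ, 0 < T → ∃ M : ℝ, ∀ t ∈ Icc (0:ℝ) T, ∀ r υ : Pt, ψ t r υ ≤ M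

/-- The standing context of the paper: `D ⊆ ℝ³` nonempty, open, bounded, convex with
Lebesgue-null boundary; `0 < vmin < vmax`; measurable nonnegative cross-sections and
kernels, with `π_s(r,υ,·)` a probability density on `V`; and (H1): all cross-sections
and kernels uniformly bounded. -/
structure NTEContext (D : Set Pt) (vmin vmax : ℝ)
    (σs σf : Pt → Pt → ℝ) (πs πf : Pt → Pt → Pt → ℝ) : Prop where
  D_nonempty : D.Nonempty
  D_open : IsOpen D
  D_bounded : Bornology.IsBounded D
  D_convex : Convex ℝ D
  D_frontier_null : volume (frontier D) = 0
  vmin_pos : 0 < vmin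
  vmin_lt_vmax : vmin < vmax
  σs_meas : Measurable (Function.uncurry σs)
  σf_meas : Measurable (Function.uncurry σf)
  πs_meas : Measurable fun p : Pt × Pt × Pt => πs p.1 p.2.1 p.2.2
  πf_meas : Measurable fun p : Pt × Pt × Pt => πf p.1 p.2.1 p.2.2
  σs_nonneg : ∀ r υ, 0 ≤ σs r υ
  σf_nonneg : ∀ r υ, 0 ≤ σf r υ
  πs_nonneg : ∀ r υ υ', 0 ≤ πs r υ υ'
  πf_nonneg : ∀ r υ υ', 0 ≤ πf r υ υ'
  πs_prob : ∀ r ∈ D, ∀ υ ∈ Vel vmin vmax, (∫ υ' in Vel vmin vmax, πs r υ υ') = 1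
  H1 : ∃ M : ℝ, (∀ r υ, σs r υ ≤ M) ∧ (∀ r υ, σf r υ ≤ M) ∧
        (∀ r υ υ', πs r υ υ' ≤ M) ∧ (∀ r υ υ', πf r υ υ' ≤ M)

lemma isCompact_Vel (a b : ℝ) : IsCompact (Vel a b) := by
  have hc : IsClosed (Vel a b) :=
    (isClosed_le continuous_const continuous_norm).inter
      (isClosed_le continuous_norm continuous_const)
  refine (isCompact_closedBall (0 : Pt) b).of_isClosed_subset hc ?_
  intro x hx
  simpa using hx.2

lemma measurableSet_Vel (a b : ℝ) : MeasurableSet (Vel a b) :=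
  (isCompact_Vel a b).measurableSet

lemma volume_Vel_pos {a b : ℝ} (ha : 0 < a) (hab : a < b) : 0 < volume (Vel a b) := by
  have ho : IsOpen {x : Pt | a < ‖x‖ ∧ ‖x‖ < b} :=
    (isOpen_lt continuous_const continuous_norm).inter
      (isOpen_lt continuous_norm continuous_const)
  obtain ⟨x, hx⟩ := exists_norm_eq Pt (c := (a + b) / 2) (by linarith)
  have hne : {x : Pt | a < ‖x‖ ∧ ‖x‖ < b}.Nonempty :=
    ⟨x, by constructor <;> rw [hx] <;> linarith⟩
  exact (ho.measure_pos volume hne).trans_le (measure_mono fun y hy => ⟨hy.1.le, hy.2.le⟩)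

lemma exists_norm_sub_le {D : Set Pt} (hD : Bornology.IsBounded D) :
    ∃ d : ℝ, 0 < d ∧ ∀ x ∈ D, ∀ y ∈ D, ‖x - y‖ ≤ d := by
  obtain ⟨d, hd⟩ := (Metric.isBounded_iff.1 hD)
  refine ⟨max d 1, by positivity, fun x hx y hy => ?_⟩
  rw [← dist_eq_norm]
  exact (hd hx hy).trans (le_max_left _ _)

lemma not_mem_of_large {D : Set Pt} {d vmin vmax S : ℝ}
    (hd : ∀ x ∈ D, ∀ y ∈ D, ‖x - y‖ ≤ d) (hS : d < S * vmin) (hv : 0 < vmin) (hS0 : 0 < S)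
    {r υ : Pt} (hr : r ∈ D) (hυ : υ ∈ Vel vmin vmax) {s : ℝ} (hs : S ≤ s) : r + s • υ ∉ D := by
  intro h
  have h1 := hd _ h _ hr
  rw [add_sub_cancel_left, norm_smul, Real.norm_eq_abs, abs_of_nonneg (by linarith)] at h1
  have h2 : S * vmin ≤ s * ‖υ‖ := by
    have := hυ.1
    have hs0 : 0 ≤ s := by linarith
    gcongr
  linarith

lemma mem_of_convex {D : Set Pt} (hc : Convex ℝ D) {r υ : Pt} (hr : r ∈ D) {s u : ℝ}
    (hs : r + s • υ ∈ D) (hu0 : 0 ≤ u) (hus : u ≤ s) : r + u • υ ∈ D := by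
  rcases hu0.eq_or_lt with h | h
  · simpa [← h] using hr
  have hs0 : 0 < s := h.trans_le hus
  have := hc.add_smul_mem hr hs (t := u / s) ⟨by positivity, (div_le_one hs0).2 hus⟩
  rwa [smul_smul, div_mul_cancel₀ _ hs0.ne'] at this

lemma lt_exitTime_iff {D : Set Pt} {vmin vmax : ℝ} (ho : IsOpen D)
    (hb : Bornology.IsBounded D) (hc : Convex ℝ D) (hv : 0 < vmin) {r υ : Pt} (hr : r ∈ D)
    (hυ : υ ∈ Vel vmin vmax) {s : ℝ} (hs : 0 ≤ s) :
    s < exitTime D r υ ↔ r + s • υ ∈ D := by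
  constructor
  · intro h
    rcases hs.eq_or_lt with h0 | h0
    · simpa [← h0] using hr
    by_contra hn
    exact notMem_of_lt_csInf h ⟨0, fun t ht => ht.1.le⟩ ⟨h0, hn⟩
  · intro h
    have hcont : Continuous fun t : ℝ => r + t • υ := by fun_prop
    have hnhds : (fun t : ℝ => r + t • υ) ⁻¹' D ∈ nhds s := (ho.preimage hcont).mem_nhds h
    obtain ⟨ε, hε, hball⟩ := Metric.mem_nhds_iff.1 hnhds
    have h2 : r + (s + ε / 2) • υ ∈ D := hball (by
      rw [Metric.mem_ball, Real.dist_eq, add_sub_cancel_left, abs_of_pos (by positivity)]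
      linarith)
    obtain ⟨d, hd0, hd⟩ := exists_norm_sub_le hb
    have hne : {t : ℝ | 0 < t ∧ r + t • υ ∉ D}.Nonempty :=
      ⟨(d + 1) / vmin, by positivity, not_mem_of_large hd (S := (d + 1) / vmin)
        (by field_simp; linarith) hv (by positivity) hr hυ le_rfl⟩
    refine lt_of_lt_of_le (by linarith : s < s + ε / 2) (le_csInf hne ?_)
    intro t ht
    by_contra hlt
    exact ht.2 (mem_of_convex hc hr h2 ht.1.le (not_le.1 hlt).le)

lemma lintegral_comp_add_smul (F : Pt → ℝ≥0∞) (r : Pt) {s : ℝ} (hs : 0 < s)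
    (hF : Measurable F) :
    ∫⁻ υ, F (r + s • υ) = ENNReal.ofReal ((s ^ 3)⁻¹) * ∫⁻ y, F y := by
  have h1 : ∫⁻ υ, F (r + s • υ) = ∫⁻ y, F (r + y) ∂(Measure.map (s • ·) volume) := by
    rw [lintegral_map (by fun_prop) (measurable_const_smul s)]
  rw [h1, Measure.map_addHaar_smul _ hs.ne', lintegral_smul_measure, lintegral_add_left_eq_self]
  simp [abs_of_pos hs]

/-- Averaging over directions and flight times dominates the volume of a bounded set. -/
lemma exists_volume_le_lintegral_flight {D : Set Pt} {d vmin vmax S : ℝ} (hDm : MeasurableSet D)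
    (hd0 : 0 < d) (hd : ∀ x ∈ D, ∀ y ∈ D, ‖x - y‖ ≤ d) (hS : d ≤ S * vmin) (hv : 0 < vmin)
    (hvv : vmin < vmax) :
    ∃ c : ℝ, 0 < c ∧ ∀ r ∈ D, ∀ f : Pt → ℝ≥0∞, Measurable f →
      ENNReal.ofReal c * ∫⁻ y in D, f y ≤
        ∫⁻ υ in Vel vmin vmax, ∫⁻ s in Ioc (0 : ℝ) S, D.indicator f (r + s • υ) := by
  have hvmax : 0 < vmax := hv.trans hvv
  set w : ℝ := 1 / vmin - 1 / vmax with hw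
  have hw0 : 0 < w := by
    rw [hw, sub_pos]; exact one_div_lt_one_div_of_lt hv hvv
  refine ⟨vmin ^ 3 * w / d ^ 2, by positivity, fun r hr f hf => ?_⟩
  set F := D.indicator f with hF
  have hFm : Measurable F := hf.indicator hDm
  have hVm := measurableSet_Vel vmin vmax
  have e1 : ∫⁻ υ in Vel vmin vmax, ∫⁻ s in Ioc (0 : ℝ) S, F (r + s • υ) =
      ∫⁻ s in Ioc (0 : ℝ) S, ∫⁻ υ in Vel vmin vmax, F (r + s • υ) := by
    refine lintegral_lintegral_swap ?_
    exact (hFm.comp (by fun_prop : Measurable fun p : Pt × ℝ => r + p.2 • p.1)).aemeasurable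
  have e2 : ∀ s ∈ Ioc (0 : ℝ) S, ∫⁻ υ in Vel vmin vmax, F (r + s • υ) =
      ∫⁻ y, ENNReal.ofReal ((s ^ 3)⁻¹) *
        ((Vel vmin vmax).indicator 1 (s⁻¹ • (y - r)) * F y) := by
    intro s hs
    have hm : Measurable fun y : Pt => (Vel vmin vmax).indicator (1 : Pt → ℝ≥0∞) (s⁻¹ • (y - r)) * F y :=
      (((measurable_const (a := (1:ℝ≥0∞))).indicator hVm).comp (by fun_prop : Measurable fun y : Pt => s⁻¹ • (y - r))).mul hFm
    rw [lintegral_const_mul _ hm, ← lintegral_comp_add_smul _ r hs.1 hm, ← lintegral_indicator hVm]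
    refine lintegral_congr fun υ => ?_
    rw [add_sub_cancel_left, smul_smul, inv_mul_cancel₀ hs.1.ne', one_smul]
    by_cases h : υ ∈ Vel vmin vmax <;> simp [h]
  rw [e1, setLIntegral_congr_fun measurableSet_Ioc e2, lintegral_lintegral_swap]
  swap
  · have hi : Measurable ((Vel vmin vmax).indicator (1 : Pt → ℝ≥0∞)) :=
      (measurable_const (a := (1:ℝ≥0∞))).indicator hVm
    refine Measurable.aemeasurable ?_
    refine Measurable.mul (by fun_prop) (Measurable.mul (hi.comp ?_) (hFm.comp measurable_snd))
    fun_prop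
  rw [← lintegral_indicator hDm, ← lintegral_const_mul _ hFm]
  have hae : ∀ᵐ y : Pt, y ≠ r := by simp [ae_iff]
  refine lintegral_mono_ae ?_
  filter_upwards [hae] with y hy
  by_cases hyD : y ∈ D
  swap
  · simp [hF, hyD]
  set ρ := ‖y - r‖ with hρ
  have hρ0 : 0 < ρ := norm_pos_iff.2 (sub_ne_zero.2 hy)
  have hρd : ρ ≤ d := hd y hyD r hr
  have hsub : Icc (ρ / vmax) (ρ / vmin) ⊆ Ioc 0 S := by
    intro s hs
    refine ⟨lt_of_lt_of_le (by positivity) hs.1, hs.2.trans ?_⟩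
    rw [div_le_iff₀ hv]; linarith
  calc ENNReal.ofReal (vmin ^ 3 * w / d ^ 2) * F y
      ≤ ENNReal.ofReal (((ρ / vmin) ^ 3)⁻¹ * (ρ / vmin - ρ / vmax)) * F y := by
        gcongr
        have : ((ρ / vmin) ^ 3)⁻¹ * (ρ / vmin - ρ / vmax) = vmin ^ 3 * w / ρ ^ 2 := by
          rw [hw]; field_simp
        rw [this]
        gcongr
    _ = ∫⁻ s in Icc (ρ / vmax) (ρ / vmin), ENNReal.ofReal (((ρ / vmin) ^ 3)⁻¹) * F y := by
        rw [setLIntegral_const, Real.volume_Icc, ENNReal.ofReal_mul (by positivity)]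
        ring
    _ ≤ ∫⁻ s in Icc (ρ / vmax) (ρ / vmin), ENNReal.ofReal ((s ^ 3)⁻¹) *
        ((Vel vmin vmax).indicator 1 (s⁻¹ • (y - r)) * F y) := by
        refine setLIntegral_mono' measurableSet_Icc fun s hs => ?_
        have hs0 : 0 < s := lt_of_lt_of_le (by positivity) hs.1
        have hmem : s⁻¹ • (y - r) ∈ Vel vmin vmax := by
          have : ‖s⁻¹ • (y - r)‖ = ρ / s := by
            rw [norm_smul, Real.norm_eq_abs, abs_of_pos (by positivity)]; ring
          constructor <;> rw [this]
          · rw [le_div_iff₀ hs0, mul_comm]; exact (le_div_iff₀ hv).1 hs.2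
          · rw [div_le_iff₀ hs0, mul_comm]; exact (div_le_iff₀ hvmax).1 hs.1
        rw [indicator_of_mem hmem]
        simp only [Pi.one_apply, one_mul]
        gcongr
        exact hs.2
    _ ≤ _ := lintegral_mono_set hsub

lemma advect_eq_indicator {D : Set Pt} {vmin vmax : ℝ} (ho : IsOpen D)
    (hb : Bornology.IsBounded D) (hc : Convex ℝ D) (hv : 0 < vmin) (f : Pt → Pt → ℝ) {r υ : Pt}
    (hr : r ∈ D) (hυ : υ ∈ Vel vmin vmax) {s : ℝ} (hs : 0 ≤ s) :
    advect D f s r υ = D.indicator (fun x => f x υ) (r + s • υ) := by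
  unfold advect
  by_cases h : r + s • υ ∈ D
  · rw [if_pos ((lt_exitTime_iff ho hb hc hv hr hυ hs).2 h), indicator_of_mem h]
  · rw [if_neg (fun h' => h ((lt_exitTime_iff ho hb hc hv hr hυ hs).1 h')),
      indicator_of_notMem h]

lemma scatFis_of_mem {D V : Set Pt} (σs σf : Pt → Pt → ℝ) (πs πf : Pt → Pt → Pt → ℝ)
    (f : Pt → Pt → ℝ) {r υ : Pt} (hr : r ∈ D) (hυ : υ ∈ V) :
    scatFis D V σs σf πs πf f r υ =
      σs r υ * ((∫ υ' in V, f r υ' * πs r υ υ') - f r υ) +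
      σf r υ * ((∫ υ' in V, f r υ' * πf r υ υ') - f r υ) := by
  unfold scatFis
  rw [indicator_of_mem (by exact ⟨hr, hυ⟩)]

lemma scatFis_of_notMem {D V : Set Pt} (σs σf : Pt → Pt → ℝ) (πs πf : Pt → Pt → Pt → ℝ)
    (f : Pt → Pt → ℝ) {r υ : Pt} (h : (r, υ) ∉ D ×ˢ V) :
    scatFis D V σs σf πs πf f r υ = 0 := by
  unfold scatFis
  rw [indicator_of_notMem h]

lemma scatFis_congr {D V : Set Pt} (hV : MeasurableSet V) (σs σf : Pt → Pt → ℝ)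
    (πs πf : Pt → Pt → Pt → ℝ) {f g : Pt → Pt → ℝ} {r : Pt} (h : r ∈ D → ∀ υ ∈ V, f r υ = g r υ)
    (υ : Pt) :
    scatFis D V σs σf πs πf f r υ = scatFis D V σs σf πs πf g r υ := by
  by_cases hm : (r, υ) ∈ D ×ˢ V
  · have h' := h hm.1
    rw [scatFis_of_mem _ _ _ _ _ hm.1 hm.2, scatFis_of_mem _ _ _ _ _ hm.1 hm.2, h' υ hm.2,
      setIntegral_congr_fun hV (fun υ' hυ' => by simp only [h' υ' hυ'] :
        EqOn (fun υ' => f r υ' * πs r υ υ') (fun υ' => g r υ' * πs r υ υ') V),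
      setIntegral_congr_fun hV (fun υ' hυ' => by simp only [h' υ' hυ'] :
        EqOn (fun υ' => f r υ' * πf r υ υ') (fun υ' => g r υ' * πf r υ υ') V)]
  · rw [scatFis_of_notMem _ _ _ _ _ hm, scatFis_of_notMem _ _ _ _ _ hm]

lemma scatFis_const_mul {D V : Set Pt} (σs σf : Pt → Pt → ℝ)
    (πs πf : Pt → Pt → Pt → ℝ) (f : Pt → Pt → ℝ) (c : ℝ) (r υ : Pt) :
    scatFis D V σs σf πs πf (fun x y => c * f x y) r υ =
      c * scatFis D V σs σf πs πf f r υ := by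
  by_cases hm : (r, υ) ∈ D ×ˢ V
  · rw [scatFis_of_mem _ _ _ _ _ hm.1 hm.2, scatFis_of_mem _ _ _ _ _ hm.1 hm.2]
    simp only [mul_assoc, integral_const_mul]
    ring
  · rw [scatFis_of_notMem _ _ _ _ _ hm, scatFis_of_notMem _ _ _ _ _ hm, mul_zero]

namespace NTEContext

variable {D : Set Pt} {vmin vmax : ℝ} {σs σf : Pt → Pt → ℝ} {πs πf : Pt → Pt → Pt → ℝ}

lemma exists_bound (ctx : NTEContext D vmin vmax σs σf πs πf) :
    ∃ M : ℝ, 0 ≤ M ∧ (∀ r υ, σs r υ ≤ M) ∧ (∀ r υ, σf r υ ≤ M) ∧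
        (∀ r υ υ', πs r υ υ' ≤ M) ∧ (∀ r υ υ', πf r υ υ' ≤ M) := by
  obtain ⟨M, h⟩ := ctx.H1
  exact ⟨M, (ctx.σs_nonneg 0 0).trans (h.1 0 0), h⟩

lemma measurable_πs_section (ctx : NTEContext D vmin vmax σs σf πs πf) (r υ : Pt) :
    Measurable (πs r υ) :=
  ctx.πs_meas.comp (by fun_prop : Measurable fun υ' : Pt => (r, υ, υ'))

lemma measurable_πf_section (ctx : NTEContext D vmin vmax σs σf πs πf) (r υ : Pt) :
    Measurable (πf r υ) :=
  ctx.πf_meas.comp (by fun_prop : Measurable fun υ' : Pt => (r, υ, υ'))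

end NTEContext

lemma integrableOn_Vel_of_bounded {vmin vmax B : ℝ} {f : Pt → ℝ} (hf : Measurable f)
    (hB : ∀ υ ∈ Vel vmin vmax, |f υ| ≤ B) : IntegrableOn f (Vel vmin vmax) := by
  refine Measure.integrableOn_of_bounded (isCompact_Vel vmin vmax).measure_lt_top.ne
    hf.aestronglyMeasurable (M := B) ?_
  exact (ae_restrict_iff' (measurableSet_Vel _ _)).2 (ae_of_all _ hB)

namespace NTEContext

variable {D : Set Pt} {vmin vmax : ℝ} {σs σf : Pt → Pt → ℝ} {πs πf : Pt → Pt → Pt → ℝ}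

lemma integrableOn_mul_πs (ctx : NTEContext D vmin vmax σs σf πs πf) {f : Pt → ℝ} {B : ℝ}
    (hf : Measurable f) (hB : ∀ υ ∈ Vel vmin vmax, |f υ| ≤ B) (r υ : Pt) :
    IntegrableOn (fun υ' => f υ' * πs r υ υ') (Vel vmin vmax) := by
  obtain ⟨M, hM0, -, -, h3, -⟩ := ctx.exists_bound
  refine integrableOn_Vel_of_bounded (hf.mul (ctx.measurable_πs_section r υ)) (B := B * M)
    fun υ' hυ' => ?_
  rw [abs_mul, abs_of_nonneg (ctx.πs_nonneg _ _ _)]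
  exact mul_le_mul (hB υ' hυ') (h3 _ _ _) (ctx.πs_nonneg _ _ _)
    ((abs_nonneg _).trans (hB υ' hυ'))

lemma integrableOn_mul_πf (ctx : NTEContext D vmin vmax σs σf πs πf) {f : Pt → ℝ} {B : ℝ}
    (hf : Measurable f) (hB : ∀ υ ∈ Vel vmin vmax, |f υ| ≤ B) (r υ : Pt) :
    IntegrableOn (fun υ' => f υ' * πf r υ υ') (Vel vmin vmax) := by
  obtain ⟨M, hM0, -, -, -, h3⟩ := ctx.exists_bound
  refine integrableOn_Vel_of_bounded (hf.mul (ctx.measurable_πf_section r υ)) (B := B * M)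
    fun υ' hυ' => ?_
  rw [abs_mul, abs_of_nonneg (ctx.πf_nonneg _ _ _)]
  exact mul_le_mul (hB υ' hυ') (h3 _ _ _) (ctx.πf_nonneg _ _ _)
    ((abs_nonneg _).trans (hB υ' hυ'))

lemma scatFis_sub (ctx : NTEContext D vmin vmax σs σf πs πf) {f g : Pt → Pt → ℝ} {r : Pt} {B : ℝ}
    (hf : Measurable (f r)) (hg : Measurable (g r)) (hfB : ∀ υ ∈ Vel vmin vmax, |f r υ| ≤ B)
    (hgB : ∀ υ ∈ Vel vmin vmax, |g r υ| ≤ B) (υ : Pt) :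
    scatFis D (Vel vmin vmax) σs σf πs πf (fun x y => f x y - g x y) r υ =
      scatFis D (Vel vmin vmax) σs σf πs πf f r υ -
        scatFis D (Vel vmin vmax) σs σf πs πf g r υ := by
  by_cases hm : (r, υ) ∈ D ×ˢ (Vel vmin vmax)
  · rw [scatFis_of_mem _ _ _ _ _ hm.1 hm.2, scatFis_of_mem _ _ _ _ _ hm.1 hm.2,
      scatFis_of_mem _ _ _ _ _ hm.1 hm.2]
    simp only [sub_mul]
    rw [integral_sub (ctx.integrableOn_mul_πs hf hfB r υ) (ctx.integrableOn_mul_πs hg hgB r υ),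
      integral_sub (ctx.integrableOn_mul_πf hf hfB r υ) (ctx.integrableOn_mul_πf hg hgB r υ)]
    ring
  · rw [scatFis_of_notMem _ _ _ _ _ hm, scatFis_of_notMem _ _ _ _ _ hm,
      scatFis_of_notMem _ _ _ _ _ hm, sub_zero]

/-- The scatter-fission operator is bounded in the supremum norm, fibrewise in space. -/
lemma exists_abs_scatFis_le (ctx : NTEContext D vmin vmax σs σf πs πf) :
    ∃ C : ℝ, 0 ≤ C ∧ ∀ (f : Pt → Pt → ℝ) (r : Pt) (B : ℝ), 0 ≤ B →
      (r ∈ D → ∀ υ ∈ Vel vmin vmax, |f r υ| ≤ B) →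
      ∀ υ, |scatFis D (Vel vmin vmax) σs σf πs πf f r υ| ≤ C * B := by
  obtain ⟨M, hM0, h1, h2, h3, h4⟩ := ctx.exists_bound
  set v := (volume : Measure Pt).real (Vel vmin vmax) with hv
  have hv0 : 0 ≤ v := measureReal_nonneg
  refine ⟨M * (M * v + 1) + M * (M * v + 1), by positivity, fun f r B hB0 hB υ => ?_⟩
  by_cases hm : (r, υ) ∈ D ×ˢ (Vel vmin vmax)
  · have hB := hB hm.1
    have key : ∀ π : Pt → ℝ, (∀ y, 0 ≤ π y) → (∀ y, π y ≤ M) → ∀ σ : ℝ, 0 ≤ σ → σ ≤ M →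
        |σ * ((∫ υ' in Vel vmin vmax, f r υ' * π υ') - f r υ)| ≤ M * ((M * v + 1) * B) := by
      intro π hπ0 hπ σ hσ0 hσ
      rw [abs_mul, abs_of_nonneg hσ0]
      have hI : ‖∫ υ' in Vel vmin vmax, f r υ' * π υ'‖ ≤ (B * M) * v := by
        refine norm_setIntegral_le_of_norm_le_const (isCompact_Vel _ _).measure_lt_top
          fun y hy => ?_
        rw [Real.norm_eq_abs, abs_mul, abs_of_nonneg (hπ0 y)]
        exact mul_le_mul (hB y hy) (hπ y) (hπ0 y) hB0
      refine mul_le_mul hσ ?_ (abs_nonneg _) hM0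
      refine (abs_sub _ _).trans ?_
      rw [Real.norm_eq_abs] at hI
      have := hB υ hm.2
      linarith
    rw [scatFis_of_mem _ _ _ _ _ hm.1 hm.2]
    refine (abs_add_le _ _).trans ?_
    have a1 := key (πs r υ) (ctx.πs_nonneg r υ) (h3 r υ) _ (ctx.σs_nonneg r υ) (h1 r υ)
    have a2 := key (πf r υ) (ctx.πf_nonneg r υ) (h4 r υ) _ (ctx.σf_nonneg r υ) (h2 r υ)
    linarith
  · rw [scatFis_of_notMem _ _ _ _ _ hm, abs_zero]
    positivity

lemma measurable_scatFis (ctx : NTEContext D vmin vmax σs σf πs πf) {Φ : ℝ → Pt → Pt → ℝ}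
    (hΦ : Measurable fun p : ℝ × Pt × Pt => Φ p.1 p.2.1 p.2.2) :
    Measurable fun p : ℝ × Pt × Pt =>
      scatFis D (Vel vmin vmax) σs σf πs πf (Φ p.1) p.2.1 p.2.2 := by
  have hS : MeasurableSet (D ×ˢ Vel vmin vmax) :=
    ctx.D_open.measurableSet.prod (measurableSet_Vel _ _)
  have hintg : ∀ π : Pt → Pt → Pt → ℝ, (Measurable fun p : Pt × Pt × Pt => π p.1 p.2.1 p.2.2) →
      Measurable fun p : ℝ × Pt × Pt =>
        ∫ υ' in Vel vmin vmax, Φ p.1 p.2.1 υ' * π p.2.1 p.2.2 υ' := by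
    intro π hπ
    refine (StronglyMeasurable.integral_prod_right' (f := fun q : (ℝ × Pt × Pt) × Pt =>
      Φ q.1.1 q.1.2.1 q.2 * π q.1.2.1 q.1.2.2 q.2) ?_).measurable
    refine Measurable.stronglyMeasurable ?_
    exact (hΦ.comp (by fun_prop : Measurable fun q : (ℝ × Pt × Pt) × Pt =>
      (q.1.1, q.1.2.1, q.2))).mul (hπ.comp (by fun_prop : Measurable
        fun q : (ℝ × Pt × Pt) × Pt => (q.1.2.1, q.1.2.2, q.2)))
  have hσs : Measurable fun p : ℝ × Pt × Pt => σs p.2.1 p.2.2 :=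
    ctx.σs_meas.comp measurable_snd
  have hσf : Measurable fun p : ℝ × Pt × Pt => σf p.2.1 p.2.2 :=
    ctx.σf_meas.comp measurable_snd
  have := ((hσs.mul ((hintg πs ctx.πs_meas).sub hΦ)).add
    (hσf.mul ((hintg πf ctx.πf_meas).sub hΦ))).indicator (measurable_snd hS)
  convert this using 1
  funext p
  by_cases hm : p.2 ∈ D ×ˢ Vel vmin vmax
  · rw [indicator_of_mem (by exact hm), scatFis_of_mem _ _ _ _ _ hm.1 hm.2]
    rfl
  · rw [indicator_of_notMem (by exact hm), scatFis_of_notMem _ _ _ _ _ hm]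

lemma scatFis_le (ctx : NTEContext D vmin vmax σs σf πs πf) :
    ∃ C : ℝ, 0 < C ∧ ∀ (f : Pt → Pt → ℝ) (r : Pt) (B : ℝ), Measurable (f r) →
      (∀ υ, 0 ≤ f r υ) → (∀ υ ∈ Vel vmin vmax, |f r υ| ≤ B) →
      ∀ υ, scatFis D (Vel vmin vmax) σs σf πs πf f r υ ≤ C * ∫ υ' in Vel vmin vmax, f r υ' := by
  obtain ⟨M, hM0, h1, h2, h3, h4⟩ := ctx.exists_bound
  refine ⟨M * M + M * M + 1, by positivity, fun f r B hf hf0 hB υ => ?_⟩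
  have hi0 : 0 ≤ ∫ υ' in Vel vmin vmax, f r υ' :=
    setIntegral_nonneg (measurableSet_Vel _ _) fun υ' _ => hf0 υ'
  by_cases hm : (r, υ) ∈ D ×ˢ (Vel vmin vmax)
  · rw [scatFis_of_mem _ _ _ _ _ hm.1 hm.2]
    have key : ∀ π : Pt → ℝ, (∀ y, 0 ≤ π y) → (∀ y, π y ≤ M) →
        IntegrableOn (fun υ' => f r υ' * π υ') (Vel vmin vmax) → ∀ σ : ℝ, 0 ≤ σ → σ ≤ M →
        σ * ((∫ υ' in Vel vmin vmax, f r υ' * π υ') - f r υ) ≤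
          M * (M * ∫ υ' in Vel vmin vmax, f r υ') := by
      intro π hπ0 hπ hintg σ hσ0 hσ
      have h5 : ∫ υ' in Vel vmin vmax, f r υ' * π υ' ≤ M * ∫ υ' in Vel vmin vmax, f r υ' := by
        rw [← integral_const_mul]
        refine setIntegral_mono hintg ((integrableOn_Vel_of_bounded hf hB).const_mul M) ?_
        intro y
        simp only
        rw [mul_comm M]
        exact mul_le_mul_of_nonneg_left (hπ y) (hf0 y)
      calc _ ≤ σ * (M * ∫ υ' in Vel vmin vmax, f r υ') := by
            have := hf0 υ
            gcongr
            linarith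
        _ ≤ _ := by gcongr
    have a1 := key (πs r υ) (ctx.πs_nonneg r υ) (h3 r υ) (ctx.integrableOn_mul_πs hf hB r υ) _
      (ctx.σs_nonneg r υ) (h1 r υ)
    have a2 := key (πf r υ) (ctx.πf_nonneg r υ) (h4 r υ) (ctx.integrableOn_mul_πf hf hB r υ) _
      (ctx.σf_nonneg r υ) (h2 r υ)
    linarith
  · rw [scatFis_of_notMem _ _ _ _ _ hm]
    positivity

lemma le_scatFis (ctx : NTEContext D vmin vmax σs σf πs πf) {c : ℝ}
    (hc : ∀ r ∈ D, ∀ υ ∈ Vel vmin vmax, ∀ υ' ∈ Vel vmin vmax,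
      c ≤ σs r υ * πs r υ υ' + σf r υ * πf r υ υ') :
    ∃ K : ℝ, 0 ≤ K ∧ ∀ (f : Pt → Pt → ℝ) (r : Pt) (B : ℝ), Measurable (f r) →
      (∀ υ, 0 ≤ f r υ) → (∀ υ ∈ Vel vmin vmax, |f r υ| ≤ B) → r ∈ D → ∀ υ ∈ Vel vmin vmax,
      c * (∫ υ' in Vel vmin vmax, f r υ') - K * f r υ ≤
        scatFis D (Vel vmin vmax) σs σf πs πf f r υ := by
  obtain ⟨M, hM0, h1, h2, -, -⟩ := ctx.exists_bound
  refine ⟨M + M, by positivity, fun f r B hf hf0 hB hr υ hυ => ?_⟩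
  rw [scatFis_of_mem _ _ _ _ _ hr hυ]
  have i1 := ctx.integrableOn_mul_πs hf hB r υ
  have i2 := ctx.integrableOn_mul_πf hf hB r υ
  have h5 : c * (∫ υ' in Vel vmin vmax, f r υ') ≤
      σs r υ * (∫ υ' in Vel vmin vmax, f r υ' * πs r υ υ') +
      σf r υ * (∫ υ' in Vel vmin vmax, f r υ' * πf r υ υ') := by
    rw [← integral_const_mul, ← integral_const_mul, ← integral_const_mul,
      ← integral_add (i1.const_mul _) (i2.const_mul _)]
    refine setIntegral_mono_on ((integrableOn_Vel_of_bounded hf hB).const_mul c)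
      ((i1.const_mul _).add (i2.const_mul _)) (measurableSet_Vel _ _) fun y hy => ?_
    have := mul_le_mul_of_nonneg_right (hc r hr υ hυ y hy) (hf0 y)
    linarith
  have b1 := mul_le_mul_of_nonneg_right (h1 r υ) (hf0 υ)
  have b2 := mul_le_mul_of_nonneg_right (h2 r υ) (hf0 υ)
  linarith

end NTEContext

/-- The left endpoint of an interval integral of a bounded function can be moved continuously,
even if the function is not measurable. -/
lemma tendsto_intervalIntegral_left_of_bounded {F : ℝ → ℝ} {τ C : ℝ} (hτ : 0 < τ)
    (hF : ∀ s ∈ Ioc 0 τ, |F s| ≤ C) :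
    Filter.Tendsto (fun ε => ∫ s in ε..τ, F s) (nhdsWithin 0 (Ioi 0))
      (nhds (∫ s in (0 : ℝ)..τ, F s)) := by
  have hC : 0 ≤ C := (abs_nonneg _).trans (hF τ ⟨hτ, le_rfl⟩)
  have hev : ∀ᶠ ε : ℝ in nhdsWithin 0 (Ioi 0), ε ∈ Ioo 0 τ := Ioo_mem_nhdsGT hτ
  by_cases hi : IntervalIntegrable F volume 0 τ
  · rw [tendsto_iff_norm_sub_tendsto_zero]
    refine squeeze_zero' (g := fun ε => C * ε) (Filter.Eventually.of_forall fun _ => norm_nonneg _)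
      ?_ ?_
    · filter_upwards [hev] with ε hε
      have hi' : IntervalIntegrable F volume 0 ε :=
        hi.mono_set (uIcc_subset_uIcc_left (by rw [uIcc_of_le hτ.le]; exact ⟨hε.1.le, hε.2.le⟩))
      rw [← intervalIntegral.integral_interval_sub_left hi hi', sub_sub_cancel_left, norm_neg]
      refine (intervalIntegral.norm_integral_le_of_norm_le_const (C := C) ?_).trans ?_
      · intro s hs
        rw [uIoc_of_le hε.1.le] at hs
        exact hF s ⟨hs.1, hs.2.trans hε.2.le⟩
      · rw [sub_zero, abs_of_pos hε.1]
    · have : Filter.Tendsto (fun ε : ℝ => C * ε) (nhds 0) (nhds (C * 0)) :=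
        (continuous_const.mul continuous_id).tendsto 0
      rw [mul_zero] at this
      exact this.mono_left nhdsWithin_le_nhds
  · have hnot : ∃ δ > 0, ∀ ε ∈ Ioo 0 δ, ¬ IntervalIntegrable F volume ε τ := by
      by_contra! hcon
      apply hi
      rw [intervalIntegrable_iff_integrableOn_Ioc_of_le hτ.le]
      have hm : AEStronglyMeasurable F (volume.restrict (Ioc 0 τ)) := by
        have hU : Ioc 0 τ = ⋃ n : ℕ, Ioc (1 / ((n : ℝ) + 1)) τ := by
          ext s
          simp only [mem_iUnion, mem_Ioc]
          constructor
          · rintro ⟨h1, h2⟩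
            obtain ⟨n, hn⟩ := exists_nat_one_div_lt h1
            exact ⟨n, hn, h2⟩
          · rintro ⟨n, h1, h2⟩
            exact ⟨lt_trans (by positivity) h1, h2⟩
        rw [hU, aestronglyMeasurable_iUnion_iff]
        intro n
        obtain ⟨ε, hε, hintg⟩ := hcon (min τ (1 / ((n : ℝ) + 1))) (lt_min hτ (by positivity))
        have hετ : ε ≤ τ := (hε.2.trans_le (min_le_left _ _)).le
        rw [intervalIntegrable_iff_integrableOn_Ioc_of_le hετ] at hintg
        exact hintg.aestronglyMeasurable.mono_set
          (Ioc_subset_Ioc_left (hε.2.trans_le (min_le_right _ _)).le)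
      refine ⟨hm, ?_⟩
      refine HasFiniteIntegral.restrict_of_bounded C measure_Ioc_lt_top ?_
      exact (ae_restrict_iff' measurableSet_Ioc).2 (ae_of_all _ hF)
    obtain ⟨δ, hδ, h⟩ := hnot
    have hev2 : ∀ᶠ ε : ℝ in nhdsWithin 0 (Ioi 0), ε ∈ Ioo 0 δ := Ioo_mem_nhdsGT hδ
    refine Filter.Tendsto.congr' (f₁ := fun _ => 0) ?_ ?_
    · filter_upwards [hev2] with ε hε
      rw [intervalIntegral.integral_undef (h ε hε)]
    · rw [intervalIntegral.integral_undef hi]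
      exact tendsto_const_nhds

/-- A function with measurable time slices which is continuous along characteristics from the
past is jointly measurable. -/
lemma measurable_of_tendsto_characteristic {D V : Set Pt} (hD : MeasurableSet D)
    (hV : MeasurableSet V) {ψ : ℝ → Pt → Pt → ℝ}
    (hm : ∀ t, Measurable (Function.uncurry (ψ t)))
    (hz : ∀ t r υ, (r, υ) ∉ D ×ˢ V → ψ t r υ = 0)
    (hlim : ∀ τ, 0 < τ → ∀ r ∈ D, ∀ υ ∈ V, Filter.Tendsto (fun ε => ψ (τ - ε) (r + ε • υ) υ)
      (nhdsWithin 0 (Ioi 0)) (nhds (ψ τ r υ))) :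
    Measurable fun p : ℝ × Pt × Pt => if 0 < p.1 then ψ p.1 p.2.1 p.2.2 else 0 := by
  set e : ℕ → ℝ → ℝ := fun n τ => τ - (((⌈((n : ℝ) + 1) * τ⌉ : ℤ) : ℝ) - 1) / ((n : ℝ) + 1) with he
  have he0 : ∀ n τ, 0 < e n τ := by
    intro n τ
    have h := Int.ceil_lt_add_one (((n : ℝ) + 1) * τ)
    rw [he, sub_pos, div_lt_iff₀ (by positivity)]
    linarith
  have he1 : ∀ n τ, e n τ ≤ 1 / ((n : ℝ) + 1) := by
    intro n τ
    have h := Int.le_ceil (((n : ℝ) + 1) * τ)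
    rw [he, sub_le_iff_le_add, ← add_div, le_div_iff₀ (by positivity)]
    linarith
  have happ : ∀ n, Measurable fun p : ℝ × Pt × Pt =>
      ψ (p.1 - e n p.1) (p.2.1 + e n p.1 • p.2.2) p.2.2 := by
    intro n
    have h1 : Measurable fun q : ℤ × (ℝ × Pt × Pt) =>
        ψ (((q.1 : ℝ) - 1) / ((n : ℝ) + 1))
          (q.2.2.1 + (q.2.1 - ((q.1 : ℝ) - 1) / ((n : ℝ) + 1)) • q.2.2.2) q.2.2.2 := by
      refine measurable_from_prod_countable_right fun k => ?_
      exact (hm (((k : ℝ) - 1) / ((n : ℝ) + 1))).comp (by fun_prop : Measurable fun p : ℝ × Pt × Pt =>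
        (p.2.1 + (p.1 - ((k : ℝ) - 1) / ((n : ℝ) + 1)) • p.2.2, p.2.2))
    have h2 : Measurable fun p : ℝ × Pt × Pt => ((⌈((n : ℝ) + 1) * p.1⌉ : ℤ), p) :=
      (Int.measurable_ceil.comp (by fun_prop)).prodMk measurable_id
    have := h1.comp h2
    convert this using 2 with p
    simp [he]
  have hset : MeasurableSet {p : ℝ × Pt × Pt | 0 < p.1 ∧ p.2 ∈ D ×ˢ V} :=
    (measurableSet_lt measurable_const measurable_fst).inter (measurable_snd (hD.prod hV))
  refine measurable_of_tendsto_metrizable (fun n => (happ n).indicator hset) ?_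
  rw [tendsto_pi_nhds]
  intro p
  by_cases hp : 0 < p.1 ∧ p.2 ∈ D ×ˢ V
  · simp only [indicator_of_mem (show p ∈ {p : ℝ × Pt × Pt | 0 < p.1 ∧ p.2 ∈ D ×ˢ V} from hp)]
    rw [if_pos hp.1]
    refine (hlim p.1 hp.1 p.2.1 hp.2.1 p.2.2 hp.2.2).comp (f := fun n => e n p.1) ?_
    refine tendsto_nhdsWithin_iff.2 ⟨?_, Filter.Eventually.of_forall fun n => he0 n p.1⟩
    exact squeeze_zero (fun n => (he0 n p.1).le) (fun n => he1 n p.1)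
      tendsto_one_div_add_atTop_nhds_zero_nat
  · simp only [indicator_of_notMem (show p ∉ {p : ℝ × Pt × Pt | 0 < p.1 ∧ p.2 ∈ D ×ˢ V} from hp)]
    have : (if 0 < p.1 then ψ p.1 p.2.1 p.2.2 else 0) = 0 := by
      split_ifs with h0
      · exact hz _ _ _ fun h => hp ⟨h0, h⟩
      · rfl
    rw [this]
    exact tendsto_const_nhds

namespace NTEContext

variable {D : Set Pt} {vmin vmax : ℝ} {σs σf : Pt → Pt → ℝ} {πs πf : Pt → Pt → Pt → ℝ}

/-- The mild equation with the advection semigroup written as transport inside the domain. -/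
lemma mild_eq (ctx : NTEContext D vmin vmax σs σf πs πf) {g : Pt → Pt → ℝ}
    {ψ : ℝ → Pt → Pt → ℝ} (hψ : IsMildSolution D (Vel vmin vmax) σs σf πs πf g ψ)
    {t : ℝ} (ht : 0 ≤ t) {r υ : Pt} (hr : r ∈ D) (hυ : υ ∈ Vel vmin vmax) :
    ψ t r υ = D.indicator (fun x => g x υ) (r + t • υ) + ∫ s in (0 : ℝ)..t,
      D.indicator (fun x => scatFis D (Vel vmin vmax) σs σf πs πf (ψ (t - s)) x υ)
        (r + s • υ) := by
  rw [hψ.2.2.2.2 t ht r υ ⟨hr, hυ⟩,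
    advect_eq_indicator ctx.D_open ctx.D_bounded ctx.D_convex ctx.vmin_pos g hr hυ ht]
  congr 1
  refine intervalIntegral.integral_congr fun s hs => ?_
  rw [uIcc_of_le ht] at hs
  exact advect_eq_indicator ctx.D_open ctx.D_bounded ctx.D_convex ctx.vmin_pos _ hr hυ hs.1

lemma exists_abs_integrand_le (ctx : NTEContext D vmin vmax σs σf πs πf) {g : Pt → Pt → ℝ}
    {ψ : ℝ → Pt → Pt → ℝ} (hψ : IsMildSolution D (Vel vmin vmax) σs σf πs πf g ψ)
    (hb : TimeLocBounded ψ) {T : ℝ} (hT : 0 < T) :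
    ∃ C : ℝ, 0 ≤ C ∧ ∀ t ∈ Icc 0 T, ∀ y υ : Pt,
      |D.indicator (fun x => scatFis D (Vel vmin vmax) σs σf πs πf (ψ t) x υ) y| ≤ C := by
  obtain ⟨B, hB⟩ := hb T hT
  have hB0 : 0 ≤ B := (hψ.2.1 0 0 0).trans (hB 0 ⟨le_rfl, hT.le⟩ 0 0)
  obtain ⟨C, hC0, hC⟩ := ctx.exists_abs_scatFis_le
  refine ⟨C * B, by positivity, fun t ht y υ => ?_⟩
  by_cases hy : y ∈ D
  · rw [indicator_of_mem hy]
    refine hC _ _ _ hB0 (fun _ υ' _ => ?_) υ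
    rw [abs_of_nonneg (hψ.2.1 _ _ _)]
    exact hB t ht _ _
  · rw [indicator_of_notMem hy, abs_zero]
    positivity

lemma tendsto_characteristic (ctx : NTEContext D vmin vmax σs σf πs πf) {g : Pt → Pt → ℝ}
    {ψ : ℝ → Pt → Pt → ℝ} (hψ : IsMildSolution D (Vel vmin vmax) σs σf πs πf g ψ)
    (hb : TimeLocBounded ψ) {τ : ℝ} (hτ : 0 < τ) {r υ : Pt} (hr : r ∈ D)
    (hυ : υ ∈ Vel vmin vmax) :
    Filter.Tendsto (fun ε => ψ (τ - ε) (r + ε • υ) υ)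
      (nhdsWithin 0 (Ioi 0)) (nhds (ψ τ r υ)) := by
  obtain ⟨C, hC0, hC⟩ := ctx.exists_abs_integrand_le hψ hb hτ
  set F : ℝ → ℝ := fun s =>
    D.indicator (fun x => scatFis D (Vel vmin vmax) σs σf πs πf (ψ (τ - s)) x υ) (r + s • υ)
    with hF
  have hlim := tendsto_intervalIntegral_left_of_bounded (F := F) (C := C) hτ
    (fun s hs => hC _ ⟨by linarith [hs.2], by linarith [hs.1]⟩ _ _)
  have hlim2 := hlim.const_add (D.indicator (fun x => g x υ) (r + τ • υ))
  rw [← ctx.mild_eq hψ hτ.le hr hυ] at hlim2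
  refine hlim2.congr' ?_
  have hcont : Continuous fun t : ℝ => r + t • υ := by fun_prop
  have hD : ∀ᶠ ε : ℝ in nhds 0, r + ε • υ ∈ D :=
    (ctx.D_open.preimage hcont).mem_nhds (by simpa using hr)
  have hev : ∀ᶠ ε : ℝ in nhdsWithin 0 (Ioi 0), ε ∈ Ioo 0 τ := Ioo_mem_nhdsGT hτ
  filter_upwards [hev, hD.filter_mono nhdsWithin_le_nhds] with ε hε hεD
  rw [ctx.mild_eq hψ (by linarith [hε.2]) hεD hυ]
  have e1 : ∀ s : ℝ, r + ε • υ + s • υ = r + (ε + s) • υ := fun s => by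
    rw [add_smul, add_assoc]
  congr 1
  · rw [e1, add_sub_cancel]
  · have := intervalIntegral.integral_comp_add_left (a := 0) (b := τ - ε) F ε
    rw [add_zero, add_sub_cancel] at this
    rw [← this]
    simp only [hF, e1, sub_sub]

lemma measurable_mildSolution (ctx : NTEContext D vmin vmax σs σf πs πf) {g : Pt → Pt → ℝ}
    {ψ : ℝ → Pt → Pt → ℝ} (hψ : IsMildSolution D (Vel vmin vmax) σs σf πs πf g ψ)
    (hb : TimeLocBounded ψ) :
    Measurable fun p : ℝ × Pt × Pt => if 0 < p.1 then ψ p.1 p.2.1 p.2.2 else 0 :=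
  measurable_of_tendsto_characteristic ctx.D_open.measurableSet (measurableSet_Vel _ _)
    hψ.1 hψ.2.2.2.1 fun _ hτ _ hr _ hυ => ctx.tendsto_characteristic hψ hb hτ hr hυ

/-- Bounded integrands of the form `1_D(r + sυ) (S + F)Φ_s(r + sυ, υ)` are integrable. -/
lemma intervalIntegrable_integrand (ctx : NTEContext D vmin vmax σs σf πs πf)
    {Φ : ℝ → Pt → Pt → ℝ} (hΦ : Measurable fun p : ℝ × Pt × Pt => Φ p.1 p.2.1 p.2.2)
    {t B : ℝ} (ht : 0 ≤ t) (hB : ∀ s ∈ Ioo 0 t, ∀ x υ, |Φ s x υ| ≤ B) (r υ : Pt) :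
    IntervalIntegrable (fun s => D.indicator
      (fun x => scatFis D (Vel vmin vmax) σs σf πs πf (Φ s) x υ) (r + s • υ)) volume 0 t := by
  rcases ht.eq_or_lt with h0 | h0
  · rw [← h0]
  obtain ⟨C, hC0, hC⟩ := ctx.exists_abs_scatFis_le
  have hB0 : 0 ≤ B := (abs_nonneg _).trans (hB (t / 2) ⟨by linarith, by linarith⟩ 0 0)
  have hm : Measurable fun s : ℝ => D.indicator
      (fun x => scatFis D (Vel vmin vmax) σs σf πs πf (Φ s) x υ) (r + s • υ) := by
    have h1 : Measurable fun s : ℝ =>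
        scatFis D (Vel vmin vmax) σs σf πs πf (Φ s) (r + s • υ) υ :=
      (ctx.measurable_scatFis hΦ).comp
        (by fun_prop : Measurable fun s : ℝ => (s, r + s • υ, υ))
    have hset : MeasurableSet ((fun s : ℝ => r + s • υ) ⁻¹' D) :=
      (by fun_prop : Measurable fun s : ℝ => r + s • υ) ctx.D_open.measurableSet
    exact h1.indicator hset
  rw [intervalIntegrable_iff_integrableOn_Ioo_of_le ht]
  refine Measure.integrableOn_of_bounded measure_Ioo_lt_top.ne hm.aestronglyMeasurable
    (M := C * B) ?_
  refine (ae_restrict_iff' measurableSet_Ioo).2 (ae_of_all _ fun s hs => ?_)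
  by_cases hy : r + s • υ ∈ D
  · rw [indicator_of_mem hy]
    exact hC _ _ _ hB0 (fun _ υ' _ => hB s hs _ _) υ
  · rw [indicator_of_notMem hy, norm_zero]
    positivity

lemma intervalIntegrable_mildSolution (ctx : NTEContext D vmin vmax σs σf πs πf)
    {g : Pt → Pt → ℝ} {ψ : ℝ → Pt → Pt → ℝ}
    (hψ : IsMildSolution D (Vel vmin vmax) σs σf πs πf g ψ)
    (hb : TimeLocBounded ψ) {t : ℝ} (ht : 0 ≤ t) (r υ : Pt) :
    IntervalIntegrable (fun s => D.indicator
      (fun x => scatFis D (Vel vmin vmax) σs σf πs πf (ψ (t - s)) x υ) (r + s • υ))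
      volume 0 t := by
  rcases ht.eq_or_lt with h0 | h0
  · rw [← h0]
  obtain ⟨B, hB⟩ := hb t h0
  have hm := (ctx.measurable_mildSolution hψ hb).comp
    (by fun_prop : Measurable fun p : ℝ × Pt × Pt => (t - p.1, p.2))
  have hB0 : 0 ≤ B := (hψ.2.1 0 0 0).trans (hB 0 ⟨le_rfl, ht⟩ 0 0)
  have := ctx.intervalIntegrable_integrand
    (Φ := fun s x υ => if 0 < t - s then ψ (t - s) x υ else 0) hm ht (B := B) (by
      intro s hs x υ
      split_ifs with h
      · rw [abs_of_nonneg (hψ.2.1 _ _ _)]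
        exact hB _ ⟨h.le, by linarith [hs.1]⟩ _ _
      · simpa using hB0) r υ
  rw [intervalIntegrable_iff_integrableOn_Ioo_of_le ht] at this ⊢
  refine this.congr_fun (fun s hs => ?_) measurableSet_Ioo
  have : 0 < t - s := by linarith [hs.2]
  simp only [this, if_true]

end NTEContext

/-- A Grönwall-type inequality for nonnegative functions driven by a measurable field. -/
lemma integral_le_exp_mul_of_eq_sub_integral {z k f : ℝ → ℝ} {z₀ K T : ℝ} (hK : 0 ≤ K)
    (hT : 0 ≤ T) (hf : IntervalIntegrable f volume 0 T) (hk : IntervalIntegrable k volume 0 T)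
    (hz : ∀ t ∈ Icc 0 T, z t = z₀ - ∫ s in (0 : ℝ)..t, f s) (hz0 : ∀ t ∈ Icc 0 T, 0 ≤ z t)
    (hk0 : ∀ t ∈ Icc 0 T, 0 ≤ k t) (hkf : ∀ t ∈ Icc 0 T, k t - K * z t ≤ f t) :
    ∫ s in (0 : ℝ)..T, k s ≤ Real.exp (K * T) * z₀ := by
  set f' := (Ioc 0 T).indicator f with hf'
  have hf'i : Integrable f' :=
    (integrable_indicator_iff measurableSet_Ioc).2
      ((intervalIntegrable_iff_integrableOn_Ioc_of_le hT).1 hf)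
  set w : ℝ → ℝ := fun t => z₀ - ∫ s in (0 : ℝ)..t, f' s with hw
  have hwc : Continuous w := continuous_const.sub
    (intervalIntegral.continuous_primitive (fun a b => hf'i.intervalIntegrable) 0)
  have hwz : ∀ t ∈ Icc 0 T, w t = z t := by
    intro t ht
    rw [hz t ht, hw]
    simp only
    congr 1
    rw [intervalIntegral.integral_of_le ht.1, intervalIntegral.integral_of_le ht.1]
    refine setIntegral_congr_fun measurableSet_Ioc fun s hs => ?_
    have hs' : s ∈ Ioc 0 T := ⟨hs.1, hs.2.trans ht.2⟩
    rw [hf', indicator_of_mem hs']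
  have hwi : ∀ a b, IntervalIntegrable w volume a b := fun a b => hwc.intervalIntegrable a b
  set Y : ℝ → ℝ := fun t => z₀ + K * ∫ s in (0 : ℝ)..t, w s with hY
  have hYd : ∀ t, HasDerivAt Y (K * w t) t := fun t =>
    ((intervalIntegral.integral_hasDerivAt_right (hwi 0 t)
      hwc.stronglyMeasurable.stronglyMeasurableAtFilter hwc.continuousAt).const_mul K).const_add z₀
  have hintg : ∀ t ∈ Icc 0 T, IntervalIntegrable f volume 0 t := fun t ht =>
    hf.mono_set (uIcc_subset_uIcc_left (by rw [uIcc_of_le hT]; exact ht))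
  have hwY : ∀ t ∈ Icc 0 T, w t ≤ Y t := by
    intro t ht
    have h1 : ∫ s in (0 : ℝ)..t, -(K * w s) ≤ ∫ s in (0 : ℝ)..t, f s := by
      refine intervalIntegral.integral_mono_on ht.1 ((hwi 0 t).const_mul K).neg (hintg t ht) ?_
      intro s hs
      have hs' : s ∈ Icc 0 T := ⟨hs.1, hs.2.trans ht.2⟩
      rw [hwz s hs']
      linarith [hkf s hs', hk0 s hs']
    rw [intervalIntegral.integral_neg, intervalIntegral.integral_const_mul] at h1
    rw [hwz t ht, hz t ht, hY]
    simp only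
    linarith
  have hanti : AntitoneOn (fun t => Real.exp (-(K * t)) * Y t) (Icc 0 T) := by
    have hd : ∀ t, HasDerivAt (fun t => Real.exp (-(K * t)) * Y t)
        (Real.exp (-(K * t)) * (-(K * 1)) * Y t + Real.exp (-(K * t)) * (K * w t)) t := fun t =>
      (((hasDerivAt_id t).const_mul K).neg.exp).mul (hYd t)
    refine antitoneOn_of_deriv_nonpos (convex_Icc 0 T)
      (fun t _ => (hd t).continuousAt.continuousWithinAt)
      (fun t _ => (hd t).differentiableAt.differentiableWithinAt) ?_
    intro t ht
    rw [interior_Icc] at ht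
    rw [(hd t).deriv]
    have h1 := hwY t ⟨ht.1.le, ht.2.le⟩
    have h2 : 0 ≤ Real.exp (-(K * t)) * K * (Y t - w t) :=
      mul_nonneg (mul_nonneg (Real.exp_pos _).le hK) (by linarith)
    linarith
  have h3 := hanti (left_mem_Icc.2 hT) (right_mem_Icc.2 hT) hT
  have hY0 : Y 0 = z₀ := by simp [hY]
  simp only [mul_zero, neg_zero, Real.exp_zero, one_mul, hY0] at h3
  have h4 : Y T ≤ Real.exp (K * T) * z₀ := by
    have := mul_le_mul_of_nonneg_left h3 (Real.exp_pos (K * T)).le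
    rwa [← mul_assoc, ← Real.exp_add, add_neg_cancel, Real.exp_zero, one_mul] at this
  refine le_trans ?_ h4
  have h5 : ∫ s in (0 : ℝ)..T, k s ≤ ∫ s in (0 : ℝ)..T, (f s + K * w s) := by
    refine intervalIntegral.integral_mono_on hT hk (hf.add ((hwi 0 T).const_mul K)) ?_
    intro s hs
    rw [hwz s hs]
    linarith [hkf s hs]
  rw [intervalIntegral.integral_add hf ((hwi 0 T).const_mul K),
    intervalIntegral.integral_const_mul] at h5
  have h6 := hz0 T ⟨hT, le_rfl⟩
  rw [hz T ⟨hT, le_rfl⟩] at h6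
  rw [hY]
  simp only
  linarith

lemma ofReal_setIntegral_Vel {vmin vmax B : ℝ} {f : Pt → ℝ} (hf : Measurable f)
    (hf0 : ∀ υ, 0 ≤ f υ) (hB : ∀ υ ∈ Vel vmin vmax, |f υ| ≤ B) :
    ENNReal.ofReal (∫ υ in Vel vmin vmax, f υ) =
      ∫⁻ υ in Vel vmin vmax, ENNReal.ofReal (f υ) :=
  ofReal_integral_eq_lintegral_ofReal (integrableOn_Vel_of_bounded hf hB) (ae_of_all _ hf0)

namespace NTEContext

variable {D : Set Pt} {vmin vmax : ℝ} {σs σf : Pt → Pt → ℝ} {πs πf : Pt → Pt → Pt → ℝ}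

/-- A right eigenfunction dominates the flight-time average of its velocity marginal. -/
lemma exists_lintegral_le_eigenfunction (ctx : NTEContext D vmin vmax σs σf πs πf) {c : ℝ}
    (hc0 : 0 < c) (hc : ∀ r ∈ D, ∀ υ ∈ Vel vmin vmax, ∀ υ' ∈ Vel vmin vmax,
      c ≤ σs r υ * πs r υ υ' + σf r υ * πf r υ υ')
    {φ : Pt → Pt → ℝ} (hφ : BddMeasNN φ) {ψ : ℝ → Pt → Pt → ℝ}
    (hψ : IsMildSolution D (Vel vmin vmax) σs σf πs πf φ ψ) {a : ℝ}
    (heig : ∀ t, 0 ≤ t → ∀ r ∈ D, ∀ υ ∈ Vel vmin vmax, ψ t r υ = Real.exp (a * t) * φ r υ)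
    {S : ℝ} (hS : 0 < S) :
    ∃ c' : ℝ, 0 < c' ∧ ∀ r ∈ D, ∀ υ ∈ Vel vmin vmax,
      ENNReal.ofReal c' * ∫⁻ s in Ioc (0 : ℝ) S, D.indicator
        (fun x => ∫⁻ υ' in Vel vmin vmax, ENNReal.ofReal (φ x υ')) (r + s • υ) ≤
      ENNReal.ofReal (φ r υ) := by
  obtain ⟨hφm, hφ0, B, hB⟩ := hφ
  obtain ⟨K, hK0, hK⟩ := ctx.le_scatFis hc
  have hB0 : 0 ≤ B := (hφ0 0 0).trans (hB 0 0)
  have habs : ∀ r υ, |φ r υ| ≤ B := fun r υ => by rw [abs_of_nonneg (hφ0 r υ)]; exact hB r υ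
  have hsec : ∀ x, Measurable (φ x) := fun x => hφm.comp measurable_prodMk_left
  have hVm := measurableSet_Vel vmin vmax
  set h : Pt → ℝ := fun x => ∫ υ' in Vel vmin vmax, φ x υ' with hh
  have hhm : Measurable h := (StronglyMeasurable.integral_prod_right'
    (f := fun q : Pt × Pt => φ q.1 q.2) hφm.stronglyMeasurable).measurable
  have hh0 : ∀ x, 0 ≤ h x := fun x => setIntegral_nonneg hVm fun υ' _ => hφ0 x υ'
  set v := (volume : Measure Pt).real (Vel vmin vmax) with hv
  have hhB : ∀ x, h x ≤ B * v := fun x => by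
    have h1 := norm_setIntegral_le_of_norm_le_const (s := Vel vmin vmax) (f := φ x) (C := B)
      (μ := volume) (isCompact_Vel _ _).measure_lt_top (fun y _ => habs x y)
    rw [Real.norm_eq_abs] at h1
    exact (le_abs_self _).trans h1
  set E := Real.exp (-(|a| * S)) with hE
  refine ⟨Real.exp (-(K * S)) * (c * E), by positivity, fun r hr υ hυ => ?_⟩
  have hline : Measurable fun s : ℝ => r + s • υ := by fun_prop
  have hlset : MeasurableSet ((fun s : ℝ => r + s • υ) ⁻¹' D) := hline ctx.D_open.measurableSet
  have hmi : Measurable fun s : ℝ => D.indicator h (r + s • υ) :=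
    (hhm.indicator ctx.D_open.measurableSet).comp hline
  have hi0 : ∀ x, 0 ≤ D.indicator h x := fun x => indicator_nonneg (fun _ _ => hh0 _) _
  have hii : IntervalIntegrable (fun s : ℝ => D.indicator h (r + s • υ)) volume 0 S := by
    rw [intervalIntegrable_iff_integrableOn_Ioc_of_le hS.le]
    refine Measure.integrableOn_of_bounded measure_Ioc_lt_top.ne hmi.aestronglyMeasurable
      (M := B * v) (ae_of_all _ fun s => ?_)
    rw [Real.norm_eq_abs, abs_of_nonneg (hi0 _)]
    exact indicator_le' (fun _ _ => hhB _) (fun _ _ => (hh0 0).trans (hhB 0)) _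
  have key : ∫ s in (0 : ℝ)..S, c * E * D.indicator h (r + s • υ) ≤
      Real.exp (K * S) * φ r υ := by
    have hΦm : Measurable fun p : ℝ × Pt × Pt => Real.exp (-(a * p.1)) * φ p.2.1 p.2.2 :=
      (by fun_prop : Measurable fun p : ℝ × Pt × Pt => Real.exp (-(a * p.1))).mul
        (hφm.comp measurable_snd)
    have hexp : ∀ s ∈ Icc 0 S, E ≤ Real.exp (-(a * s)) ∧
        Real.exp (-(a * s)) ≤ Real.exp (|a| * S) := by
      intro s hs
      have h1 : |a * s| ≤ |a| * S := by
        rw [abs_mul, abs_of_nonneg hs.1]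
        exact mul_le_mul_of_nonneg_left hs.2 (abs_nonneg a)
      have h2 := abs_le.1 h1
      constructor <;> apply Real.exp_le_exp.2 <;> linarith
    refine integral_le_exp_mul_of_eq_sub_integral
      (z := fun t => D.indicator (fun x => Real.exp (-(a * t)) * φ x υ) (r + t • υ))
      (f := fun s => D.indicator (fun x => scatFis D (Vel vmin vmax) σs σf πs πf
        (fun x y => Real.exp (-(a * s)) * φ x y) x υ) (r + s • υ)) hK0 hS.le
      (ctx.intervalIntegrable_integrand (B := Real.exp (|a| * S) * B) hΦm hS.le ?_ r υ)
      (hii.const_mul _) ?_ ?_ ?_ ?_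
    · intro s hs x y
      rw [abs_mul, abs_of_pos (Real.exp_pos _)]
      exact mul_le_mul (hexp s ⟨hs.1.le, hs.2.le⟩).2 (habs _ _) (abs_nonneg _) (Real.exp_pos _).le
    · intro t ht
      have h1 := ctx.mild_eq hψ ht.1 hr hυ
      rw [heig t ht.1 r hr υ hυ] at h1
      have h2 : ∫ s in (0 : ℝ)..t,
          D.indicator (fun x => scatFis D (Vel vmin vmax) σs σf πs πf (ψ (t - s)) x υ)
            (r + s • υ) = Real.exp (a * t) * ∫ s in (0 : ℝ)..t,
          D.indicator (fun x => scatFis D (Vel vmin vmax) σs σf πs πf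
            (fun x y => Real.exp (-(a * s)) * φ x y) x υ) (r + s • υ) := by
        rw [← intervalIntegral.integral_const_mul]
        refine intervalIntegral.integral_congr fun s hs => ?_
        rw [uIcc_of_le ht.1] at hs
        by_cases hy : r + s • υ ∈ D
        · simp only [indicator_of_mem hy]
          rw [← scatFis_const_mul]
          refine scatFis_congr hVm _ _ _ _ (fun hD υ' hυ' => ?_) υ
          rw [heig (t - s) (by linarith [hs.2]) _ hD _ hυ', ← mul_assoc, ← Real.exp_add]
          ring_nf
        · simp only [indicator_of_notMem hy, mul_zero]
      rw [h2] at h1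
      have h3 : D.indicator (fun x => Real.exp (-(a * t)) * φ x υ) (r + t • υ) =
          Real.exp (-(a * t)) * D.indicator (fun x => φ x υ) (r + t • υ) := by
        by_cases hy : r + t • υ ∈ D
        · simp only [indicator_of_mem hy]
        · simp only [indicator_of_notMem hy, mul_zero]
      rw [h3, eq_sub_iff_add_eq]
      have h4 := congrArg (fun u => Real.exp (-(a * t)) * u) h1
      simp only [mul_add, ← mul_assoc, ← Real.exp_add, neg_add_cancel, Real.exp_zero,
        one_mul] at h4
      exact h4.symm
    · intro t _
      exact indicator_nonneg (fun x _ => mul_nonneg (Real.exp_pos _).le (hφ0 _ _)) _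
    · intro t _
      exact mul_nonneg (by positivity) (hi0 _)
    · intro s hs
      by_cases hy : r + s • υ ∈ D
      · simp only [indicator_of_mem hy]
        refine le_trans ?_ (hK (fun x y => Real.exp (-(a * s)) * φ x y) (r + s • υ)
          (Real.exp (|a| * S) * B) ((hsec _).const_mul _)
          (fun _ => mul_nonneg (Real.exp_pos _).le (hφ0 _ _)) (fun y _ => ?_) hy υ hυ)
        · rw [integral_const_mul]
          have := mul_le_mul_of_nonneg_right (hexp s hs).1 (hh0 (r + s • υ))
          have := mul_le_mul_of_nonneg_left this hc0.le
          simp only [hh] at this ⊢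
          linarith
        · rw [abs_mul, abs_of_pos (Real.exp_pos _)]
          exact mul_le_mul (hexp s hs).2 (habs _ _) (abs_nonneg _) (Real.exp_pos _).le
      · simp only [indicator_of_notMem hy, mul_zero, sub_zero, le_refl]
  have hfin : Real.exp (-(K * S)) * (c * E) * ∫ s in Ioc (0 : ℝ) S, D.indicator h (r + s • υ) ≤
      φ r υ := by
    rw [intervalIntegral.integral_const_mul, intervalIntegral.integral_of_le hS.le] at key
    have := mul_le_mul_of_nonneg_left key (Real.exp_pos (-(K * S))).le
    have hee : Real.exp (-(K * S)) * Real.exp (K * S) = 1 := by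
      rw [← Real.exp_add, neg_add_cancel, Real.exp_zero]
    rw [← mul_assoc, ← mul_assoc, ← mul_assoc, hee, one_mul] at this
    rwa [← mul_assoc]
  refine le_trans (le_of_eq ?_) (ENNReal.ofReal_le_ofReal hfin)
  rw [ENNReal.ofReal_mul (by positivity : 0 ≤ Real.exp (-(K * S)) * (c * E))]
  congr 1
  rw [ofReal_integral_eq_lintegral_ofReal
    ((intervalIntegrable_iff_integrableOn_Ioc_of_le hS.le).1 hii) (ae_of_all _ fun s => hi0 _)]
  refine lintegral_congr fun s => ?_
  by_cases hy : r + s • υ ∈ D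
  · simp only [indicator_of_mem hy]
    exact (ofReal_setIntegral_Vel (hsec _) (hφ0 _) fun y _ => habs _ y).symm
  · simp only [indicator_of_notMem hy, ENNReal.ofReal_zero]

end NTEContext

/-- A compact subset of `D × V` stays in `D` along flights of a short, uniform duration. -/
lemma exists_flight_time {D : Set Pt} (ho : IsOpen D) {vmin vmax : ℝ} (hv : 0 < vmax)
    {K : Set (Pt × Pt)} (hK : IsCompact K) (hKD : K ⊆ D ×ˢ Vel vmin vmax) :
    ∃ s₀ : ℝ, 0 < s₀ ∧ ∀ p ∈ K, ∀ s : ℝ, |s| ≤ s₀ → p.1 + s • p.2 ∈ D := by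
  have hK1 : IsCompact (Prod.fst '' K) := hK.image continuous_fst
  have hsub : Prod.fst '' K ⊆ D := by
    rintro _ ⟨p, hp, rfl⟩
    exact (hKD hp).1
  obtain ⟨δ, hδ, hthick⟩ := hK1.exists_thickening_subset_open ho hsub
  refine ⟨δ / (2 * vmax), by positivity, fun p hp s hs => hthick ?_⟩
  rw [Metric.mem_thickening_iff]
  refine ⟨p.1, mem_image_of_mem _ hp, ?_⟩
  rw [dist_eq_norm, add_sub_cancel_left, norm_smul, Real.norm_eq_abs]
  calc |s| * ‖p.2‖ ≤ δ / (2 * vmax) * vmax := by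
        gcongr
        exact (hKD hp).2.2
    _ = δ / 2 := by field_simp
    _ < δ := by linarith

namespace NTEContext

variable {D : Set Pt} {vmin vmax : ℝ} {σs σf : Pt → Pt → ℝ} {πs πf : Pt → Pt → Pt → ℝ}

lemma exists_flight_horizon (ctx : NTEContext D vmin vmax σs σf πs πf) :
    ∃ S : ℝ, 0 < S ∧ (∀ r ∈ D, ∀ υ ∈ Vel vmin vmax, ∀ s, S ≤ s → r + s • υ ∉ D) ∧
      ∃ c : ℝ, 0 < c ∧ ∀ r ∈ D, ∀ f : Pt → ℝ≥0∞, Measurable f →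
      ENNReal.ofReal c * ∫⁻ y in D, f y ≤
        ∫⁻ υ in Vel vmin vmax, ∫⁻ s in Ioc (0 : ℝ) S, D.indicator f (r + s • υ) := by
  obtain ⟨d, hd0, hd⟩ := exists_norm_sub_le ctx.D_bounded
  have hv := ctx.vmin_pos
  have e : (d + 1) / vmin * vmin = d + 1 := by field_simp
  have hS0 : 0 < (d + 1) / vmin := by positivity
  refine ⟨(d + 1) / vmin, hS0, fun r hr υ hυ s hs =>
    not_mem_of_large hd (by rw [e]; linarith) hv hS0 hr hυ hs, ?_⟩
  exact exists_volume_le_lintegral_flight ctx.D_open.measurableSet hd0 hd (by rw [e]; linarith) hv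
    ctx.vmin_lt_vmax

/-- A positive right eigenfunction is bounded away from zero on compact sets. -/
lemma eigenfunction_bounded_below (ctx : NTEContext D vmin vmax σs σf πs πf) {c : ℝ}
    (hc0 : 0 < c) (hc : ∀ r ∈ D, ∀ υ ∈ Vel vmin vmax, ∀ υ' ∈ Vel vmin vmax,
      c ≤ σs r υ * πs r υ υ' + σf r υ * πf r υ υ')
    {φ : Pt → Pt → ℝ} (hφ : BddMeasNN φ) {ψ : ℝ → Pt → Pt → ℝ}
    (hψ : IsMildSolution D (Vel vmin vmax) σs σf πs πf φ ψ) {a : ℝ}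
    (heig : ∀ t, 0 ≤ t → ∀ r ∈ D, ∀ υ ∈ Vel vmin vmax, ψ t r υ = Real.exp (a * t) * φ r υ)
    (hpos : ∀ r ∈ D, ∀ υ ∈ Vel vmin vmax, 0 < φ r υ)
    {K : Set (Pt × Pt)} (hK : IsCompact K) (hKD : K ⊆ D ×ˢ Vel vmin vmax) :
    ∃ c : ℝ, 0 < c ∧ ∀ p ∈ K, c ≤ φ p.1 p.2 := by
  obtain ⟨S, hS0, -, c₁, hc₁, hgeo⟩ := ctx.exists_flight_horizon
  obtain ⟨c₂, hc₂, hlow⟩ := ctx.exists_lintegral_le_eigenfunction hc0 hc hφ hψ heig hS0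
  obtain ⟨s₀, hs₀, hfl⟩ := exists_flight_time ctx.D_open
    (ctx.vmin_pos.trans ctx.vmin_lt_vmax) hK hKD
  have hVm := measurableSet_Vel vmin vmax
  set h : Pt → ℝ≥0∞ := fun x => ∫⁻ υ' in Vel vmin vmax, ENNReal.ofReal (φ x υ') with hh
  have hhm : Measurable h :=
    Measurable.lintegral_prod_right' (f := fun q : Pt × Pt => ENNReal.ofReal (φ q.1 q.2))
      (ENNReal.measurable_ofReal.comp hφ.1)
  have hsec : ∀ x, Measurable fun υ => ENNReal.ofReal (φ x υ) := fun x =>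
    ENNReal.measurable_ofReal.comp (hφ.1.comp measurable_prodMk_left)
  set I := ∫⁻ y in D, h y with hI
  have hhpos : ∀ x ∈ D, 0 < h x := by
    intro x hx
    rw [hh, setLIntegral_pos_iff (hsec x)]
    refine (volume_Vel_pos ctx.vmin_pos ctx.vmin_lt_vmax).trans_le (measure_mono fun υ hυ => ?_)
    exact ⟨(ENNReal.ofReal_pos.2 (hpos x hx υ hυ)).ne', hυ⟩
  have hIpos : 0 < I := by
    rw [hI, setLIntegral_pos_iff hhm]
    refine (ctx.D_open.measure_pos volume ctx.D_nonempty).trans_le (measure_mono fun x hx => ?_)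
    exact ⟨(hhpos x hx).ne', hx⟩
  have hhlow : ∀ r ∈ D, ENNReal.ofReal c₂ * (ENNReal.ofReal c₁ * I) ≤ h r := by
    intro r hr
    calc ENNReal.ofReal c₂ * (ENNReal.ofReal c₁ * I)
        ≤ ENNReal.ofReal c₂ * ∫⁻ υ in Vel vmin vmax, ∫⁻ s in Ioc (0 : ℝ) S,
            D.indicator h (r + s • υ) := by
          gcongr
          exact hgeo r hr h hhm
      _ = ∫⁻ υ in Vel vmin vmax, ENNReal.ofReal c₂ * ∫⁻ s in Ioc (0 : ℝ) S,
            D.indicator h (r + s • υ) := by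
          rw [lintegral_const_mul' _ _ ENNReal.ofReal_ne_top]
      _ ≤ h r := setLIntegral_mono' hVm fun υ hυ => hlow r hr υ hυ
  have hm0 : 0 < min s₀ S := lt_min hs₀ hS0
  set L := ENNReal.ofReal c₂ * (ENNReal.ofReal c₂ * (ENNReal.ofReal c₁ * I) *
    ENNReal.ofReal (min s₀ S)) with hL
  have hLpos : L ≠ 0 := by
    simp only [hL, ne_eq, mul_eq_zero, ENNReal.ofReal_eq_zero, not_or, not_le]
    exact ⟨hc₂, ⟨hc₂, hc₁, hIpos.ne'⟩, hm0⟩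
  have hLle : ∀ p ∈ K, L ≤ ENNReal.ofReal (φ p.1 p.2) := by
    intro p hp
    have hpD := hKD hp
    refine le_trans ?_ (hlow p.1 hpD.1 p.2 hpD.2)
    rw [hL]
    gcongr
    calc ENNReal.ofReal c₂ * (ENNReal.ofReal c₁ * I) * ENNReal.ofReal (min s₀ S)
        = ∫⁻ s in Ioc (0 : ℝ) (min s₀ S), ENNReal.ofReal c₂ * (ENNReal.ofReal c₁ * I) := by
          rw [setLIntegral_const, Real.volume_Ioc, sub_zero]
      _ ≤ ∫⁻ s in Ioc (0 : ℝ) (min s₀ S), D.indicator h (p.1 + s • p.2) := by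
          refine setLIntegral_mono' measurableSet_Ioc fun s hs => ?_
          have hsD := hfl p hp s (by
            rw [abs_of_pos hs.1]; exact hs.2.trans (min_le_left _ _))
          rw [indicator_of_mem hsD]
          exact hhlow _ hsD
      _ ≤ _ := lintegral_mono_set (Ioc_subset_Ioc_right (min_le_right _ _))
  rcases K.eq_empty_or_nonempty with rfl | ⟨p₀, hp₀⟩
  · exact ⟨1, one_pos, fun p hp => hp.elim⟩
  have hLtop : L ≠ ⊤ := ((hLle p₀ hp₀).trans_lt ENNReal.ofReal_lt_top).ne
  refine ⟨L.toReal, ENNReal.toReal_pos hLpos hLtop, fun p hp => ?_⟩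
  exact ENNReal.toReal_le_of_le_ofReal (hφ.2.1 _ _) (hLle p hp)

end NTEContext

/-- Time averages over short intervals converge to the initial value, in the mean. -/
lemma tendsto_integral_average {X : Type*} [MeasurableSpace X] (η : Measure X)
    [IsFiniteMeasure η] {q : ℝ × X → ℝ} (hq : Measurable q) {B S : ℝ} (hS : 0 < S)
    (hB : ∀ s ∈ Ioc 0 S, ∀ x, |q (s, x)| ≤ B)
    (hc : ∀ᵐ x ∂η, ContinuousAt (fun s => q (s, x)) 0) :
    (∀ t ∈ Ioc 0 S, Integrable (fun x => ∫ s in (0 : ℝ)..t, q (s, x)) η) ∧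
    Filter.Tendsto (fun t => t⁻¹ * ∫ x, (∫ s in (0 : ℝ)..t, q (s, x)) ∂η)
      (nhdsWithin 0 (Ioi 0)) (nhds (∫ x, q (0, x) ∂η)) := by
  have hbd : ∀ t ∈ Ioc 0 S, ∀ x, ‖∫ s in (0 : ℝ)..t, q (s, x)‖ ≤ B * t := by
    intro t ht x
    refine (intervalIntegral.norm_integral_le_of_norm_le_const (C := B) fun s hs => ?_).trans ?_
    · rw [uIoc_of_le ht.1.le] at hs
      exact hB s ⟨hs.1, hs.2.trans ht.2⟩ x
    · rw [sub_zero, abs_of_pos ht.1]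
  have hm : ∀ t, 0 ≤ t → Measurable fun x => ∫ s in (0 : ℝ)..t, q (s, x) := by
    intro t ht
    simp only [intervalIntegral.integral_of_le ht]
    exact (StronglyMeasurable.integral_prod_left' (f := q) hq.stronglyMeasurable).measurable
  refine ⟨fun t ht => Integrable.of_bound (hm t ht.1.le).aestronglyMeasurable (B * t)
    (ae_of_all _ (hbd t ht)), ?_⟩
  have hIoc : ∀ᶠ t in nhdsWithin (0 : ℝ) (Ioi 0), t ∈ Ioc 0 S :=
    Ioc_mem_nhdsGT hS
  have h1 : (fun t : ℝ => t⁻¹ * ∫ x, (∫ s in (0 : ℝ)..t, q (s, x)) ∂η) =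
      fun t => ∫ x, t⁻¹ * (∫ s in (0 : ℝ)..t, q (s, x)) ∂η := by
    funext t
    rw [integral_const_mul]
  rw [h1]
  refine tendsto_integral_filter_of_dominated_convergence (fun _ => B) ?_ ?_
    (integrable_const B) ?_
  · filter_upwards [hIoc] with t ht
    exact ((hm t ht.1.le).const_mul _).aestronglyMeasurable
  · filter_upwards [hIoc] with t ht
    refine ae_of_all _ fun x => ?_
    rw [norm_mul, norm_inv, Real.norm_eq_abs t, abs_of_pos ht.1, inv_mul_le_iff₀ ht.1, mul_comm t]
    exact hbd t ht x
  · filter_upwards [hc] with x hx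
    have hqx : Measurable fun s => q (s, x) := hq.comp measurable_prodMk_right
    have hd := intervalIntegral.integral_hasDerivAt_right (a := 0) (b := 0)
      (f := fun s => q (s, x)) (by simp)
      hqx.stronglyMeasurable.stronglyMeasurableAtFilter hx
    have := (hasDerivAt_iff_tendsto_slope_zero.1 hd).mono_left
      (nhdsWithin_mono (s := Ioi (0 : ℝ)) 0 (fun t ht => ne_of_gt (mem_Ioi.1 ht)))
    simpa using this

/-- The discounted integral of `g` along a flight of duration `S`. -/
def flightPot (α S : ℝ) (g : Pt → Pt → ℝ) (r υ : Pt) : ℝ :=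
  ∫ s in (0 : ℝ)..S, Real.exp (-(α * s)) * g (r + s • υ) υ

lemma continuous_flight_integrand (α : ℝ) {g : Pt → Pt → ℝ}
    (hg : Continuous (Function.uncurry g)) :
    Continuous fun p : ℝ × Pt × Pt => Real.exp (-(α * p.1)) * g (p.2.1 + p.1 • p.2.2) p.2.2 :=
  (by fun_prop : Continuous fun p : ℝ × Pt × Pt => Real.exp (-(α * p.1))).mul
    (hg.comp (by fun_prop : Continuous fun p : ℝ × Pt × Pt => (p.2.1 + p.1 • p.2.2, p.2.2)))

lemma continuous_flightPot (α S : ℝ) {g : Pt → Pt → ℝ} (hg : Continuous (Function.uncurry g)) :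
    Continuous (Function.uncurry (flightPot α S g)) := by
  have h := continuous_flight_integrand α hg
  exact intervalIntegral.continuous_parametric_intervalIntegral_of_continuous'
    (f := fun (p : Pt × Pt) (s : ℝ) => Real.exp (-(α * s)) * g (p.1 + s • p.2) p.2)
    (h.comp (by fun_prop : Continuous fun q : (Pt × Pt) × ℝ => (q.2, q.1))) 0 S

lemma exp_neg_mul_mem {α S s : ℝ} (hs : s ∈ Icc 0 S) :
    Real.exp (-(|α| * S)) ≤ Real.exp (-(α * s)) ∧
      Real.exp (-(α * s)) ≤ Real.exp (|α| * S) := by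
  have h1 : |α * s| ≤ |α| * S := by
    rw [abs_mul, abs_of_nonneg hs.1]
    exact mul_le_mul_of_nonneg_left hs.2 (abs_nonneg α)
  have h2 := abs_le.1 h1
  constructor <;> apply Real.exp_le_exp.2 <;> linarith

lemma abs_exp_sub_one_le_mul_exp (x : ℝ) : |Real.exp x - 1| ≤ |x| * Real.exp |x| := by
  rcases le_total 0 x with h | h
  · rw [abs_of_nonneg h, abs_of_nonneg (by linarith [Real.one_le_exp h])]
    have h1 := Real.add_one_le_exp (-x)
    have h2 := mul_le_mul_of_nonneg_right h1 (Real.exp_pos x).le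
    rw [← Real.exp_add, neg_add_cancel, Real.exp_zero] at h2
    linarith
  · rw [abs_of_nonpos h, abs_of_nonpos (by linarith [Real.exp_le_one_iff.2 h])]
    have h1 := Real.add_one_le_exp x
    have h2 : 1 ≤ Real.exp (-x) := Real.one_le_exp (by linarith)
    nlinarith

section
variable {α S : ℝ} {g : Pt → Pt → ℝ}

lemma continuous_flight_path (α : ℝ) (hg : Continuous (Function.uncurry g)) (r υ : Pt) :
    Continuous fun s : ℝ => Real.exp (-(α * s)) * g (r + s • υ) υ :=
  (continuous_flight_integrand α hg).comp
    (by fun_prop : Continuous fun s : ℝ => (s, r, υ))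

lemma flightPot_nonneg (hS : 0 ≤ S) (h0 : ∀ r υ, 0 ≤ g r υ) (r υ : Pt) :
    0 ≤ flightPot α S g r υ :=
  intervalIntegral.integral_nonneg hS fun _ _ => mul_nonneg (Real.exp_pos _).le (h0 _ _)

lemma flight_integral_le (h0 : ∀ r υ, 0 ≤ g r υ) (h1 : ∀ r υ, g r υ ≤ 1)
    {t : ℝ} (ht : t ∈ Icc 0 S) (r υ : Pt) :
    |∫ s in (0 : ℝ)..t, Real.exp (-(α * s)) * g (r + s • υ) υ| ≤ Real.exp (|α| * S) * t := by
  have := intervalIntegral.norm_integral_le_of_norm_le_const (a := 0) (b := t)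
    (C := Real.exp (|α| * S)) (f := fun s => Real.exp (-(α * s)) * g (r + s • υ) υ) fun s hs => ?_
  · rwa [sub_zero, abs_of_nonneg ht.1, Real.norm_eq_abs] at this
  · rw [uIoc_of_le ht.1] at hs
    rw [Real.norm_eq_abs, abs_of_nonneg (mul_nonneg (Real.exp_pos _).le (h0 _ _)),
      ← mul_one (Real.exp (|α| * S))]
    exact mul_le_mul (exp_neg_mul_mem ⟨hs.1.le, hs.2.trans ht.2⟩).2 (h1 _ _) (h0 _ _)
      (Real.exp_pos _).le

lemma flightPot_le (hS : 0 ≤ S) (h0 : ∀ r υ, 0 ≤ g r υ) (h1 : ∀ r υ, g r υ ≤ 1) (r υ : Pt) :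
    flightPot α S g r υ ≤ Real.exp (|α| * S) * S :=
  (le_abs_self _).trans (flight_integral_le h0 h1 ⟨hS, le_rfl⟩ r υ)

lemma bddMeasNN_flightPot (hS : 0 ≤ S) (hg : Continuous (Function.uncurry g))
    (h0 : ∀ r υ, 0 ≤ g r υ) (h1 : ∀ r υ, g r υ ≤ 1) : BddMeasNN (flightPot α S g) :=
  ⟨(continuous_flightPot α S hg).measurable, flightPot_nonneg hS h0, _, flightPot_le hS h0 h1⟩

/-- The discounted flight potential advances along characteristics by a Duhamel-type formula. -/
lemma indicator_flightPot {D : Set Pt} {r υ : Pt} (hc : Convex ℝ D) (hr : r ∈ D)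
    (hout : ∀ s, S ≤ s → r + s • υ ∉ D) (hg : Continuous (Function.uncurry g))
    (hgD : ∀ x y, x ∉ D → g x y = 0) {t : ℝ} (ht : t ∈ Icc 0 S) :
    D.indicator (fun x => flightPot α S g x υ) (r + t • υ) = Real.exp (α * t) *
      (flightPot α S g r υ - ∫ s in (0 : ℝ)..t, Real.exp (-(α * s)) * g (r + s • υ) υ) := by
  set q : ℝ → ℝ := fun s => Real.exp (-(α * s)) * g (r + s • υ) υ with hq
  have hqi : ∀ a b, IntervalIntegrable q volume a b := fun a b =>
    (continuous_flight_path α hg r υ).intervalIntegrable a b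
  have hsub : flightPot α S g r υ - ∫ s in (0 : ℝ)..t, q s = ∫ s in t..S, q s := by
    rw [sub_eq_iff_eq_add', intervalIntegral.integral_add_adjacent_intervals (hqi _ _) (hqi _ _)]
    rfl
  rw [hsub]
  by_cases hy : r + t • υ ∈ D
  · rw [indicator_of_mem hy]
    have h1 : flightPot α S g (r + t • υ) υ = ∫ s in (0 : ℝ)..S, Real.exp (α * t) * q (s + t) := by
      refine intervalIntegral.integral_congr fun s _ => ?_
      simp only [hq]
      rw [← mul_assoc, ← Real.exp_add, add_assoc, ← add_smul, add_comm t s]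
      ring_nf
    rw [h1, intervalIntegral.integral_const_mul, intervalIntegral.integral_comp_add_right q,
      zero_add, ← intervalIntegral.integral_add_adjacent_intervals (hqi t S) (hqi S (S + t))]
    have h2 : ∫ s in S..(S + t), q s = 0 := by
      refine intervalIntegral.integral_zero_ae (ae_of_all _ fun s hs => ?_)
      rw [uIoc_of_le (by linarith [ht.1])] at hs
      simp only [hq, hgD _ υ (hout s hs.1.le), mul_zero]
    rw [h2, add_zero]
  · rw [indicator_of_notMem hy]
    have h2 : ∫ s in t..S, q s = 0 := by
      refine intervalIntegral.integral_zero_ae (ae_of_all _ fun s hs => ?_)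
      rw [uIoc_of_le ht.2] at hs
      simp only [hq]
      rw [hgD _ υ (fun h => hy (mem_of_convex hc hr h ht.1 hs.1.le)), mul_zero]
    rw [h2, mul_zero]

end

namespace NTEContext

variable {D : Set Pt} {vmin vmax : ℝ} {σs σf : Pt → Pt → ℝ} {πs πf : Pt → Pt → Pt → ℝ}

/-- First-order expansion of the mild solution started from a discounted flight potential. -/
lemma exists_expansion_mildSolution (ctx : NTEContext D vmin vmax σs σf πs πf) {α S : ℝ}
    (hS : 0 < S) (hout : ∀ r ∈ D, ∀ υ ∈ Vel vmin vmax, ∀ s, S ≤ s → r + s • υ ∉ D)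
    {g : Pt → Pt → ℝ} (hg : Continuous (Function.uncurry g)) (h0 : ∀ r υ, 0 ≤ g r υ)
    (h1 : ∀ r υ, g r υ ≤ 1) (hgD : ∀ x y, x ∉ D → g x y = 0) {ψ : ℝ → Pt → Pt → ℝ}
    (hψ : IsMildSolution D (Vel vmin vmax) σs σf πs πf (flightPot α S g) ψ)
    (hb : TimeLocBounded ψ) :
    ∃ C : ℝ, ∀ t ∈ Icc 0 S, ∀ r ∈ D, ∀ υ ∈ Vel vmin vmax,
      IntervalIntegrable (fun s => D.indicator (fun x =>
        scatFis D (Vel vmin vmax) σs σf πs πf (flightPot α S g) x υ) (r + s • υ)) volume 0 t ∧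
      |ψ t r υ - (Real.exp (α * t) * (flightPot α S g r υ -
          ∫ s in (0 : ℝ)..t, Real.exp (-(α * s)) * g (r + s • υ) υ) +
        ∫ s in (0 : ℝ)..t, D.indicator (fun x =>
          scatFis D (Vel vmin vmax) σs σf πs πf (flightPot α S g) x υ) (r + s • υ))| ≤
        C * t ^ 2 := by
  set G := flightPot α S g with hG
  have hGm : Measurable (Function.uncurry G) := (continuous_flightPot α S hg).measurable
  have hGs : ∀ x, Measurable (G x) := fun x => hGm.comp measurable_prodMk_left
  set X := Real.exp (|α| * S) with hX
  have hX0 : 0 < X := Real.exp_pos _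
  have hG0 : ∀ r υ, 0 ≤ G r υ := flightPot_nonneg hS.le h0
  have hGB : ∀ r υ, |G r υ| ≤ X * S := fun r υ => by
    rw [abs_of_nonneg (hG0 r υ)]; exact flightPot_le hS.le h0 h1 r υ
  obtain ⟨C₁, hC₁0, hC₁⟩ := ctx.exists_abs_integrand_le hψ hb hS
  obtain ⟨C₂, hC₂0, hC₂⟩ := ctx.exists_abs_scatFis_le
  obtain ⟨M, hM⟩ := hb S hS
  set C₃ := |α| * X * (X * S) + X * X + C₁ with hC₃
  have hC₃0 : 0 ≤ C₃ := by positivity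
  have hclose : ∀ t ∈ Icc 0 S, ∀ r ∈ D, ∀ υ ∈ Vel vmin vmax, |ψ t r υ - G r υ| ≤ C₃ * t := by
    intro t ht r hr υ hυ
    rw [ctx.mild_eq hψ ht.1 hr hυ,
      indicator_flightPot ctx.D_convex hr (hout r hr υ hυ) hg hgD ht]
    set Q := ∫ s in (0 : ℝ)..t, Real.exp (-(α * s)) * g (r + s • υ) υ with hQ
    have hQb : |Q| ≤ X * t := flight_integral_le h0 h1 ht r υ
    have hI := intervalIntegral.norm_integral_le_of_norm_le_const (a := 0) (b := t)
      (C := C₁) (f := fun s => D.indicator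
        (fun x => scatFis D (Vel vmin vmax) σs σf πs πf (ψ (t - s)) x υ) (r + s • υ))
      fun s hs => by
        rw [uIoc_of_le ht.1] at hs
        exact hC₁ _ ⟨by linarith [hs.2], by linarith [hs.1, ht.2]⟩ _ _
    rw [sub_zero, abs_of_nonneg ht.1, Real.norm_eq_abs] at hI
    have hαt : |α * t| ≤ |α| * S := by
      rw [abs_mul, abs_of_nonneg ht.1]
      exact mul_le_mul_of_nonneg_left ht.2 (abs_nonneg α)
    have he : Real.exp (α * t) ≤ X :=
      Real.exp_le_exp.2 ((le_abs_self _).trans hαt)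
    have he1 : |Real.exp (α * t) - 1| ≤ |α| * t * X := by
      refine (abs_exp_sub_one_le_mul_exp _).trans ?_
      have : |α * t| = |α| * t := by rw [abs_mul, abs_of_nonneg ht.1]
      rw [← this]
      exact mul_le_mul_of_nonneg_left (Real.exp_le_exp.2 hαt) (abs_nonneg _)
    have e1 : |(Real.exp (α * t) - 1) * G r υ| ≤ |α| * t * X * (X * S) := by
      rw [abs_mul]
      exact mul_le_mul he1 (hGB r υ) (abs_nonneg _)
        (mul_nonneg (mul_nonneg (abs_nonneg _) ht.1) hX0.le)
    have e2 : |Real.exp (α * t) * Q| ≤ X * (X * t) := by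
      rw [abs_mul, abs_of_pos (Real.exp_pos _)]
      exact mul_le_mul he hQb (abs_nonneg _) hX0.le
    have := abs_le.1 e1
    have := abs_le.1 e2
    have := abs_le.1 hI
    rw [hC₃, abs_le]
    constructor <;> nlinarith
  have hdiff : ∀ t ∈ Icc 0 S, ∀ x υ, |scatFis D (Vel vmin vmax) σs σf πs πf (ψ t) x υ -
      scatFis D (Vel vmin vmax) σs σf πs πf G x υ| ≤ C₂ * (C₃ * t) := by
    intro t ht x υ
    rw [← ctx.scatFis_sub (B := max M (X * S)) ((hψ.1 t).comp measurable_prodMk_left) (hGs x)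
      (fun υ' _ => by
        rw [abs_of_nonneg (hψ.2.1 _ _ _)]; exact (hM t ht _ _).trans (le_max_left _ _))
      (fun υ' _ => (hGB _ _).trans (le_max_right _ _))]
    exact hC₂ _ _ _ (mul_nonneg hC₃0 ht.1) (fun hx υ' hυ' => hclose t ht x hx υ' hυ') υ
  refine ⟨C₂ * C₃, fun t ht r hr υ hυ => ?_⟩
  have hintg := ctx.intervalIntegrable_integrand (Φ := fun _ => G) (t := t) (B := X * S)
    (hGm.comp measurable_snd) ht.1 (fun _ _ x υ => hGB x υ) r υ
  refine ⟨hintg, ?_⟩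
  rw [ctx.mild_eq hψ ht.1 hr hυ,
    indicator_flightPot ctx.D_convex hr (hout r hr υ hυ) hg hgD ht, add_sub_add_left_eq_sub,
    ← intervalIntegral.integral_sub (ctx.intervalIntegrable_mildSolution hψ hb ht.1 r υ) hintg]
  have hI := intervalIntegral.norm_integral_le_of_norm_le_const (a := 0) (b := t)
    (C := C₂ * (C₃ * t)) (f := fun s => D.indicator
      (fun x => scatFis D (Vel vmin vmax) σs σf πs πf (ψ (t - s)) x υ) (r + s • υ) -
      D.indicator (fun x => scatFis D (Vel vmin vmax) σs σf πs πf G x υ) (r + s • υ))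
    fun s hs => by
      rw [uIoc_of_le ht.1] at hs
      by_cases hy : r + s • υ ∈ D
      · simp only [indicator_of_mem hy, Real.norm_eq_abs]
        refine (hdiff (t - s) ⟨by linarith [hs.2], by linarith [hs.1, ht.2]⟩ _ _).trans ?_
        have := hs.1
        gcongr
        linarith
      · simp only [indicator_of_notMem hy, sub_zero, norm_zero]
        exact mul_nonneg hC₂0 (mul_nonneg hC₃0 ht.1)
  rw [sub_zero, abs_of_nonneg ht.1, Real.norm_eq_abs] at hI
  refine hI.trans (le_of_eq ?_)
  ring

end NTEContext

lemma tendsto_inv_mul_exp_sub_exp (a b : ℝ) :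
    Filter.Tendsto (fun t : ℝ => t⁻¹ * (Real.exp (a * t) - Real.exp (b * t)))
      (nhdsWithin 0 (Ioi 0)) (nhds (a - b)) := by
  have hd : ∀ c : ℝ, HasDerivAt (fun t : ℝ => Real.exp (c * t)) c 0 := fun c => by
    simpa using ((hasDerivAt_id (0 : ℝ)).const_mul c).exp
  have := (hasDerivAt_iff_tendsto_slope_zero.1 ((hd a).sub (hd b))).mono_left
    (nhdsWithin_mono (s := Ioi (0 : ℝ)) 0 (fun t ht => ne_of_gt (mem_Ioi.1 ht)))
  simpa using this

namespace NTEContext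

variable {D : Set Pt} {vmin vmax : ℝ} {σs σf : Pt → Pt → ℝ} {πs πf : Pt → Pt → Pt → ℝ}

/-- Testing a left eigenmeasure against a discounted flight potential. -/
lemma eigenmeasure_flightPot (ctx : NTEContext D vmin vmax σs σf πs πf) {α S a : ℝ}
    (hS : 0 < S) (hout : ∀ r ∈ D, ∀ υ ∈ Vel vmin vmax, ∀ s, S ≤ s → r + s • υ ∉ D)
    {g : Pt → Pt → ℝ} (hg : Continuous (Function.uncurry g)) (h0 : ∀ r υ, 0 ≤ g r υ)
    (h1 : ∀ r υ, g r υ ≤ 1) (hgD : ∀ x y, x ∉ D → g x y = 0) {ψ : ℝ → Pt → Pt → ℝ}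
    (hψ : IsMildSolution D (Vel vmin vmax) σs σf πs πf (flightPot α S g) ψ)
    (hb : TimeLocBounded ψ) {η : Measure (Pt × Pt)} [IsProbabilityMeasure η]
    (hη : ∀ᵐ p ∂η, p ∈ D ×ˢ Vel vmin vmax)
    (heig : ∀ t, 0 ≤ t → ∫ p, ψ t p.1 p.2 ∂η =
      Real.exp (a * t) * ∫ p, flightPot α S g p.1 p.2 ∂η)
    {P : Pt → Pt → ℝ} (hP : Continuous (Function.uncurry P)) {B : ℝ} (hB : ∀ x υ, |P x υ| ≤ B) :
    ((∀ r ∈ D, ∀ υ ∈ Vel vmin vmax,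
        scatFis D (Vel vmin vmax) σs σf πs πf (flightPot α S g) r υ ≤ P r υ) →
      (a - α) * ∫ p, flightPot α S g p.1 p.2 ∂η + ∫ p, g p.1 p.2 ∂η ≤ ∫ p, P p.1 p.2 ∂η) ∧
    ((∀ r ∈ D, ∀ υ ∈ Vel vmin vmax,
        P r υ ≤ scatFis D (Vel vmin vmax) σs σf πs πf (flightPot α S g) r υ) →
      ∫ p, P p.1 p.2 ∂η ≤ (a - α) * ∫ p, flightPot α S g p.1 p.2 ∂η + ∫ p, g p.1 p.2 ∂η) := by
  obtain ⟨C, hC⟩ := ctx.exists_expansion_mildSolution hS hout hg h0 h1 hgD hψ hb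
  set G := flightPot α S g with hG
  have hGc : Continuous (Function.uncurry G) := continuous_flightPot α S hg
  have hGi : Integrable (fun p : Pt × Pt => G p.1 p.2) η :=
    Integrable.of_bound hGc.aestronglyMeasurable (Real.exp (|α| * S) * S) (ae_of_all _ fun p => by
      rw [Real.norm_eq_abs, abs_of_nonneg (flightPot_nonneg hS.le h0 _ _)]
      exact flightPot_le hS.le h0 h1 _ _)
  have hψi : ∀ t, Integrable (fun p : Pt × Pt => ψ t p.1 p.2) η := fun t => by
    obtain ⟨M, hM⟩ := hψ.2.2.1 t
    exact Integrable.of_bound (hψ.1 t).aestronglyMeasurable M (ae_of_all _ fun p => by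
      rw [Real.norm_eq_abs, abs_of_nonneg (hψ.2.1 _ _ _)]
      exact hM _ _)
  have hB0 : 0 ≤ B := (abs_nonneg _).trans (hB 0 0)
  set q : ℝ × Pt × Pt → ℝ := fun p => Real.exp (-(α * p.1)) * g (p.2.1 + p.1 • p.2.2) p.2.2
    with hq
  set w : ℝ × Pt × Pt → ℝ := fun p => D.indicator (fun x => P x p.2.2) (p.2.1 + p.1 • p.2.2)
    with hw
  have hwm : Measurable w := by
    have hl : Measurable fun p : ℝ × Pt × Pt => p.2.1 + p.1 • p.2.2 := by fun_prop
    have : w = ((fun p : ℝ × Pt × Pt => p.2.1 + p.1 • p.2.2) ⁻¹' D).indicator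
        (fun p => P (p.2.1 + p.1 • p.2.2) p.2.2) := by
      funext p
      by_cases hy : p.2.1 + p.1 • p.2.2 ∈ D
      · have hy' : p ∈ (fun p : ℝ × Pt × Pt => p.2.1 + p.1 • p.2.2) ⁻¹' D := hy
        rw [indicator_of_mem hy']
        exact indicator_of_mem hy _
      · have hy' : p ∉ (fun p : ℝ × Pt × Pt => p.2.1 + p.1 • p.2.2) ⁻¹' D := hy
        rw [indicator_of_notMem hy']
        exact indicator_of_notMem hy _
    rw [this]
    refine Measurable.indicator ?_ (hl ctx.D_open.measurableSet)
    exact hP.measurable.comp (hl.prodMk (by fun_prop))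
  have hwB : ∀ p, |w p| ≤ B := fun p => by
    by_cases hy : p.2.1 + p.1 • p.2.2 ∈ D
    · simp only [hw, indicator_of_mem hy]
      exact hB _ _
    · simp only [hw, indicator_of_notMem hy, abs_zero, hB0]
  obtain ⟨hQi, hQt⟩ := tendsto_integral_average η (q := q)
    (continuous_flight_integrand α hg).measurable hS (B := Real.exp (|α| * S))
    (fun s hs p => by
      rw [hq, abs_of_nonneg (mul_nonneg (Real.exp_pos _).le (h0 _ _)),
        ← mul_one (Real.exp (|α| * S))]
      exact mul_le_mul (exp_neg_mul_mem ⟨hs.1.le, hs.2⟩).2 (h1 _ _) (h0 _ _) (Real.exp_pos _).le)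
    (ae_of_all _ fun p => (continuous_flight_path α hg p.1 p.2).continuousAt)
  obtain ⟨hWi, hWt⟩ := tendsto_integral_average η hwm hS (B := B)
    (fun s _ p => hwB _)
    (by
      filter_upwards [hη] with p hp
      have hl : Continuous fun s : ℝ => p.1 + s • p.2 := by fun_prop
      have hPl : ContinuousAt (fun s : ℝ => P (p.1 + s • p.2) p.2) 0 :=
        (hP.comp (by fun_prop : Continuous fun s : ℝ => (p.1 + s • p.2, p.2))).continuousAt
      refine hPl.congr ?_
      have : (fun s : ℝ => p.1 + s • p.2) ⁻¹' D ∈ nhds (0 : ℝ) :=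
        (ctx.D_open.preimage hl).mem_nhds (by simpa using hp.1)
      filter_upwards [this] with s hs
      exact (indicator_of_mem (mem_preimage.1 hs) (fun x => P x p.2)).symm)
  have hq0 : ∫ p, q (0, p) ∂η = ∫ p, g p.1 p.2 ∂η := by simp [hq]
  have hw0 : ∫ p, w (0, p) ∂η = ∫ p, P p.1 p.2 ∂η := by
    refine integral_congr_ae ?_
    filter_upwards [hη] with p hp
    simp only [hw, zero_smul, add_zero]
    exact indicator_of_mem hp.1 _
  rw [hq0] at hQt
  rw [hw0] at hWt
  set I := ∫ p, G p.1 p.2 ∂η with hI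
  have hIoc : ∀ᶠ t in nhdsWithin (0 : ℝ) (Ioi 0), t ∈ Ioc 0 S := Ioc_mem_nhdsGT hS
  have hid : Filter.Tendsto (fun t : ℝ => t) (nhdsWithin 0 (Ioi 0)) (nhds 0) :=
    Filter.tendsto_id.mono_left nhdsWithin_le_nhds
  have hexp : Filter.Tendsto (fun t : ℝ => Real.exp (α * t)) (nhdsWithin 0 (Ioi 0)) (nhds 1) := by
    have : Continuous fun t : ℝ => Real.exp (α * t) := by fun_prop
    simpa using (this.tendsto 0).mono_left nhdsWithin_le_nhds
  have hL := ((tendsto_inv_mul_exp_sub_exp a α).mul_const I).add (hexp.mul hQt)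
  rw [one_mul] at hL
  have hwint : ∀ t, 0 ≤ t → ∀ p : Pt × Pt,
      IntervalIntegrable (fun s => w (s, p)) volume 0 t := by
    intro t ht p
    rw [intervalIntegrable_iff_integrableOn_Ioc_of_le ht]
    refine Measure.integrableOn_of_bounded measure_Ioc_lt_top.ne
      (hwm.comp measurable_prodMk_right).aestronglyMeasurable (M := B)
      (ae_of_all _ fun s => hwB _)
  have hsplit : ∀ t ∈ Ioc 0 S, ∀ e : ℝ, ∫ p, (Real.exp (α * t) *
      (G p.1 p.2 - ∫ s in (0 : ℝ)..t, q (s, p)) + (∫ s in (0 : ℝ)..t, w (s, p)) + e) ∂η =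
      Real.exp (α * t) * (I - ∫ p, (∫ s in (0 : ℝ)..t, q (s, p)) ∂η) +
        (∫ p, (∫ s in (0 : ℝ)..t, w (s, p)) ∂η) + e := by
    intro t ht e
    have i1 : Integrable (fun p : Pt × Pt => Real.exp (α * t) *
        (G p.1 p.2 - ∫ s in (0 : ℝ)..t, q (s, p))) η :=
      (hGi.sub (hQi t ht)).const_mul (Real.exp (α * t))
    have i2 : Integrable (fun p : Pt × Pt => Real.exp (α * t) *
        (G p.1 p.2 - ∫ s in (0 : ℝ)..t, q (s, p)) + ∫ s in (0 : ℝ)..t, w (s, p)) η :=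
      i1.add (hWi t ht)
    rw [integral_add i2 (integrable_const _), integral_add i1 (hWi t ht),
      integral_const_mul, integral_sub hGi (hQi t ht)]
    simp [hI]
  have hsi : ∀ t ∈ Ioc 0 S, ∀ e : ℝ, Integrable (fun p => Real.exp (α * t) *
      (G p.1 p.2 - ∫ s in (0 : ℝ)..t, q (s, p)) + (∫ s in (0 : ℝ)..t, w (s, p)) + e) η :=
    fun t ht e => (((hGi.sub (hQi t ht)).const_mul (Real.exp (α * t))).add (hWi t ht)).add
      (integrable_const _)
  have hmono : ∀ t ∈ Ioc 0 S, ∀ p ∈ D ×ˢ Vel vmin vmax, ∀ F₁ F₂ : ℝ → ℝ,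
      IntervalIntegrable F₁ volume 0 t → IntervalIntegrable F₂ volume 0 t → (∀ s, F₁ s ≤ F₂ s) →
      ∫ s in (0 : ℝ)..t, F₁ s ≤ ∫ s in (0 : ℝ)..t, F₂ s := fun t ht p _ F₁ F₂ i₁ i₂ h =>
    intervalIntegral.integral_mono_on ht.1.le i₁ i₂ fun s _ => h s
  constructor
  · intro hle
    have hR := hWt.add (hid.const_mul C)
    rw [mul_zero, add_zero] at hR
    refine le_of_tendsto_of_tendsto hL hR ?_
    filter_upwards [hIoc] with t ht
    have hintg : ∫ p, ψ t p.1 p.2 ∂η ≤ ∫ p, (Real.exp (α * t) *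
        (G p.1 p.2 - ∫ s in (0 : ℝ)..t, q (s, p)) + (∫ s in (0 : ℝ)..t, w (s, p)) + C * t ^ 2) ∂η := by
      refine integral_mono_ae (hψi t) (hsi t ht _) ?_
      filter_upwards [hη] with p hp
      obtain ⟨hi, he⟩ := hC t ⟨ht.1.le, ht.2⟩ p.1 hp.1 p.2 hp.2
      have h2 := hmono t ht p hp _ _ hi (hwint t ht.1.le p) fun s => by
        by_cases hy : p.1 + s • p.2 ∈ D
        · simp only [hw, indicator_of_mem hy]
          exact hle _ hy _ hp.2
        · simp only [hw, indicator_of_notMem hy, le_refl]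
      have h3 := (abs_le.1 he).2
      linarith
    rw [hsplit t ht, heig t ht.1.le] at hintg
    have ht0 := ht.1
    have key := mul_le_mul_of_nonneg_left hintg (inv_pos.2 ht0).le
    have e : t⁻¹ * t ^ 2 = t := by field_simp
    have e' : t⁻¹ * (C * t ^ 2) = C * t := by rw [mul_left_comm, e]
    simp only [mul_add, e'] at key
    linear_combination key
  · intro hle
    have hR := hWt.sub (hid.const_mul C)
    rw [mul_zero, sub_zero] at hR
    refine le_of_tendsto_of_tendsto hR hL ?_
    filter_upwards [hIoc] with t ht
    have hintg : ∫ p, (Real.exp (α * t) * (G p.1 p.2 - ∫ s in (0 : ℝ)..t, q (s, p)) +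
        (∫ s in (0 : ℝ)..t, w (s, p)) + -(C * t ^ 2)) ∂η ≤ ∫ p, ψ t p.1 p.2 ∂η := by
      refine integral_mono_ae (hsi t ht _) (hψi t) ?_
      filter_upwards [hη] with p hp
      obtain ⟨hi, he⟩ := hC t ⟨ht.1.le, ht.2⟩ p.1 hp.1 p.2 hp.2
      have h2 := hmono t ht p hp _ _ (hwint t ht.1.le p) hi fun s => by
        by_cases hy : p.1 + s • p.2 ∈ D
        · simp only [hw, indicator_of_mem hy]
          exact hle _ hy _ hp.2
        · simp only [hw, indicator_of_notMem hy, le_refl]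
      have h3 := (abs_le.1 he).1
      linarith
    rw [hsplit t ht, heig t ht.1.le] at hintg
    have ht0 := ht.1
    have key := mul_le_mul_of_nonneg_left hintg (inv_pos.2 ht0).le
    have e : t⁻¹ * t ^ 2 = t := by field_simp
    have e' : t⁻¹ * -(C * t ^ 2) = -(C * t) := by rw [mul_neg, mul_left_comm, e]
    simp only [mul_add, e'] at key
    linear_combination key

end NTEContext

lemma flightPot_comparison {α S : ℝ} (hS : 0 ≤ S) {g : Pt → Pt → ℝ}
    (hg : Continuous (Function.uncurry g)) (h0 : ∀ r υ, 0 ≤ g r υ) (r υ : Pt) :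
    Real.exp (-(|α| * S)) * flightPot 0 S g r υ ≤ flightPot α S g r υ ∧
      flightPot α S g r υ ≤ Real.exp (|α| * S) * flightPot 0 S g r υ := by
  have hi : ∀ β : ℝ, IntervalIntegrable (fun s => Real.exp (-(β * s)) * g (r + s • υ) υ)
      volume 0 S := fun β => (continuous_flight_path β hg r υ).intervalIntegrable _ _
  unfold flightPot
  rw [← intervalIntegral.integral_const_mul, ← intervalIntegral.integral_const_mul]
  constructor
  · refine intervalIntegral.integral_mono_on hS ((hi 0).const_mul _) (hi α) fun s hs => ?_
    have := mul_le_mul_of_nonneg_right (exp_neg_mul_mem (α := α) hs).1 (h0 (r + s • υ) υ)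
    simpa using this
  · refine intervalIntegral.integral_mono_on hS (hi α) ((hi 0).const_mul _) fun s hs => ?_
    have := mul_le_mul_of_nonneg_right (exp_neg_mul_mem (α := α) hs).2 (h0 (r + s • υ) υ)
    simpa using this

/-- The velocity average of the discounted flight potential. -/
def flightAvg (vmin vmax α S : ℝ) (g : Pt → Pt → ℝ) (x : Pt) : ℝ :=
  ∫ υ in Vel vmin vmax, flightPot α S g x υ

section
variable {vmin vmax α S : ℝ} {g : Pt → Pt → ℝ}

lemma continuous_flightAvg (vmin vmax α S : ℝ) (hg : Continuous (Function.uncurry g)) :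
    Continuous (flightAvg vmin vmax α S g) :=
  continuous_parametric_integral_of_continuous (continuous_flightPot α S hg) (isCompact_Vel _ _)

lemma integrableOn_flightPot (hg : Continuous (Function.uncurry g)) (x : Pt) :
    IntegrableOn (flightPot α S g x) (Vel vmin vmax) :=
  ((continuous_flightPot α S hg).comp
    (by fun_prop : Continuous fun υ : Pt => (x, υ))).continuousOn.integrableOn_compact
      (isCompact_Vel _ _)

lemma flightAvg_nonneg (hS : 0 ≤ S) (h0 : ∀ r υ, 0 ≤ g r υ) (x : Pt) :
    0 ≤ flightAvg vmin vmax α S g x :=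
  setIntegral_nonneg (measurableSet_Vel _ _) fun _ _ => flightPot_nonneg hS h0 _ _

lemma flightAvg_le (hS : 0 ≤ S) (h0 : ∀ r υ, 0 ≤ g r υ) (h1 : ∀ r υ, g r υ ≤ 1) (x : Pt) :
    flightAvg vmin vmax α S g x ≤
      Real.exp (|α| * S) * S * (volume : Measure Pt).real (Vel vmin vmax) := by
  have h := norm_setIntegral_le_of_norm_le_const (s := Vel vmin vmax) (f := flightPot α S g x)
    (C := Real.exp (|α| * S) * S) (μ := volume) (isCompact_Vel _ _).measure_lt_top
    (fun y _ => by
      rw [Real.norm_eq_abs, abs_of_nonneg (flightPot_nonneg hS h0 _ _)]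
      exact flightPot_le hS h0 h1 _ _)
  rw [Real.norm_eq_abs] at h
  exact (le_abs_self _).trans h

lemma flightAvg_comparison (hS : 0 ≤ S) (hg : Continuous (Function.uncurry g))
    (h0 : ∀ r υ, 0 ≤ g r υ) (x : Pt) :
    Real.exp (-(|α| * S)) * flightAvg vmin vmax 0 S g x ≤ flightAvg vmin vmax α S g x ∧
      flightAvg vmin vmax α S g x ≤ Real.exp (|α| * S) * flightAvg vmin vmax 0 S g x := by
  unfold flightAvg
  rw [← integral_const_mul, ← integral_const_mul]
  have hi : ∀ β, IntegrableOn (flightPot β S g x) (Vel vmin vmax) :=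
    fun β => integrableOn_flightPot hg x
  exact ⟨setIntegral_mono ((hi 0).const_mul _) (hi α)
      fun υ => (flightPot_comparison hS hg h0 x υ).1,
    setIntegral_mono (hi α) ((hi 0).const_mul _)
      fun υ => (flightPot_comparison hS hg h0 x υ).2⟩

end

namespace NTEContext

variable {D : Set Pt} {vmin vmax : ℝ} {σs σf : Pt → Pt → ℝ} {πs πf : Pt → Pt → Pt → ℝ}

/-- On continuous test functions a left eigenmeasure is comparable to its own flight average. -/
lemma eigenmeasure_test_bounds (ctx : NTEContext D vmin vmax σs σf πs πf) {c : ℝ}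
    (hc0 : 0 < c) (hc : ∀ r ∈ D, ∀ υ ∈ Vel vmin vmax, ∀ υ' ∈ Vel vmin vmax,
      c ≤ σs r υ * πs r υ υ' + σf r υ * πf r υ υ') {S a : ℝ}
    (hS : 0 < S) (hout : ∀ r ∈ D, ∀ υ ∈ Vel vmin vmax, ∀ s, S ≤ s → r + s • υ ∉ D)
    {Ψ : (Pt → Pt → ℝ) → ℝ → Pt → Pt → ℝ}
    (hΨ : ∀ h : Pt → Pt → ℝ, BddMeasNN h →
      IsMildSolution D (Vel vmin vmax) σs σf πs πf h (Ψ h) ∧ TimeLocBounded (Ψ h))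
    {η : Measure (Pt × Pt)} [IsProbabilityMeasure η]
    (hη : ∀ᵐ p ∂η, p ∈ D ×ˢ Vel vmin vmax)
    (heig : ∀ t, 0 ≤ t → ∀ g, BddMeasNN g → ∫ p, Ψ g t p.1 p.2 ∂η =
      Real.exp (a * t) * ∫ p, g p.1 p.2 ∂η) :
    ∃ C₁ C₂ : ℝ, 0 < C₁ ∧ 0 < C₂ ∧ ∀ g : Pt → Pt → ℝ, Continuous (Function.uncurry g) →
      (∀ r υ, 0 ≤ g r υ) → (∀ r υ, g r υ ≤ 1) → (∀ x y, x ∉ D → g x y = 0) →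
      ∫ p, g p.1 p.2 ∂η ≤ C₁ * ∫ p, flightAvg vmin vmax 0 S g p.1 ∂η ∧
      C₂ * ∫ p, flightAvg vmin vmax 0 S g p.1 ∂η ≤ ∫ p, g p.1 p.2 ∂η := by
  obtain ⟨C, hC0, hC⟩ := ctx.scatFis_le
  obtain ⟨K, hK0, hK⟩ := ctx.le_scatFis hc
  refine ⟨C * Real.exp (|a| * S), c * Real.exp (-(|a + K| * S)), by positivity, by positivity,
    fun g hg h0 h1 hgD => ?_⟩
  have hAi : ∀ β, Integrable (fun p : Pt × Pt => flightAvg vmin vmax β S g p.1) η := fun β =>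
    Integrable.of_bound ((continuous_flightAvg vmin vmax β S hg).comp
      continuous_fst).aestronglyMeasurable
      (Real.exp (|β| * S) * S * (volume : Measure Pt).real (Vel vmin vmax)) (ae_of_all _ fun p => by
        rw [Real.norm_eq_abs, abs_of_nonneg (flightAvg_nonneg hS.le h0 _)]
        exact flightAvg_le hS.le h0 h1 _)
  have hGi : ∀ β, Integrable (fun p : Pt × Pt => flightPot β S g p.1 p.2) η := fun β =>
    Integrable.of_bound (continuous_flightPot β S hg).aestronglyMeasurable
      (Real.exp (|β| * S) * S) (ae_of_all _ fun p => by
        rw [Real.norm_eq_abs, abs_of_nonneg (flightPot_nonneg hS.le h0 _ _)]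
        exact flightPot_le hS.le h0 h1 _ _)
  have hGs : ∀ β x, Measurable (flightPot β S g x) := fun β x =>
    (continuous_flightPot β S hg).measurable.comp measurable_prodMk_left
  have hGB : ∀ β x υ, |flightPot β S g x υ| ≤ Real.exp (|β| * S) * S := fun β x υ => by
    rw [abs_of_nonneg (flightPot_nonneg hS.le h0 _ _)]
    exact flightPot_le hS.le h0 h1 _ _
  have hAB : ∀ β x, |flightAvg vmin vmax β S g x| ≤
      Real.exp (|β| * S) * S * (volume : Measure Pt).real (Vel vmin vmax) := fun β x => by
    rw [abs_of_nonneg (flightAvg_nonneg hS.le h0 _)]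
    exact flightAvg_le hS.le h0 h1 _
  have hbdd : ∀ β, BddMeasNN (flightPot β S g) := fun β => bddMeasNN_flightPot hS.le hg h0 h1
  constructor
  · have h := (ctx.eigenmeasure_flightPot (α := a) (a := a) hS hout hg h0 h1 hgD
      (hΨ _ (hbdd a)).1 (hΨ _ (hbdd a)).2 hη (fun t ht => heig t ht _ (hbdd a))
      (P := fun x _ => C * flightAvg vmin vmax a S g x)
      (continuous_const.mul ((continuous_flightAvg vmin vmax a S hg).comp continuous_fst))
      (B := C * (Real.exp (|a| * S) * S * (volume : Measure Pt).real (Vel vmin vmax)))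
      (fun x _ => by
        rw [abs_mul, abs_of_pos hC0]
        exact mul_le_mul_of_nonneg_left (hAB a x) hC0.le)).1 (fun r hr υ hυ =>
      hC _ r _ (hGs a r) (flightPot_nonneg hS.le h0 r) (fun υ' _ => hGB a r υ') υ)
    rw [sub_self, zero_mul, zero_add, integral_const_mul] at h
    refine h.trans ?_
    rw [mul_assoc]
    refine mul_le_mul_of_nonneg_left ?_ hC0.le
    rw [← integral_const_mul]
    exact integral_mono (hAi a) ((hAi 0).const_mul _)
      fun p => (flightAvg_comparison hS.le hg h0 p.1).2
  · have h := (ctx.eigenmeasure_flightPot (α := a + K) (a := a) hS hout hg h0 h1 hgD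
      (hΨ _ (hbdd _)).1 (hΨ _ (hbdd _)).2 hη (fun t ht => heig t ht _ (hbdd _))
      (P := fun x υ => c * flightAvg vmin vmax (a + K) S g x - K * flightPot (a + K) S g x υ)
      ((continuous_const.mul ((continuous_flightAvg vmin vmax (a + K) S hg).comp
        continuous_fst)).sub (continuous_const.mul (continuous_flightPot (a + K) S hg)))
      (B := c * (Real.exp (|a + K| * S) * S * (volume : Measure Pt).real (Vel vmin vmax)) +
        K * (Real.exp (|a + K| * S) * S))
      (fun x υ => by
        refine (abs_sub _ _).trans (add_le_add ?_ ?_)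
        · rw [abs_mul, abs_of_pos hc0]
          exact mul_le_mul_of_nonneg_left (hAB _ x) hc0.le
        · rw [abs_mul, abs_of_nonneg hK0]
          exact mul_le_mul_of_nonneg_left (hGB _ x υ) hK0)).2 (fun r hr υ hυ =>
      hK _ r _ (hGs _ r) (flightPot_nonneg hS.le h0 r) (fun υ' _ => hGB _ r υ') hr υ hυ)
    rw [integral_sub ((hAi _).const_mul _) ((hGi _).const_mul _), integral_const_mul,
      integral_const_mul] at h
    have h2 : Real.exp (-(|a + K| * S)) * ∫ p, flightAvg vmin vmax 0 S g p.1 ∂η ≤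
        ∫ p, flightAvg vmin vmax (a + K) S g p.1 ∂η := by
      rw [← integral_const_mul]
      exact integral_mono ((hAi 0).const_mul _) (hAi _)
        fun p => (flightAvg_comparison hS.le hg h0 p.1).1
    have h3 := mul_le_mul_of_nonneg_left h2 hc0.le
    linarith

end NTEContext

lemma restrict_le_smul_of_forall_continuous_le {X : Type*} [PseudoMetricSpace X]
    [MeasurableSpace X] [BorelSpace X] {μ ν : Measure X} [IsFiniteMeasure μ] [IsFiniteMeasure ν]
    {U : Set X} (hU : IsOpen U) {C : ℝ≥0∞} (hC0 : C ≠ 0) (hC : C ≠ ∞)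
    (h : ∀ g : X → ℝ, Continuous g → (∀ x, 0 ≤ g x) → (∀ x, g x ≤ 1) → (∀ x, x ∉ U → g x = 0) →
      ∫⁻ x, ENNReal.ofReal (g x) ∂μ ≤ C * ∫⁻ x, ENNReal.ofReal (g x) ∂ν) :
    μ.restrict U ≤ C • ν.restrict U := by
  refine Measure.le_iff.2 fun A hA => ?_
  rw [Measure.smul_apply, smul_eq_mul, Measure.restrict_apply hA, Measure.restrict_apply hA]
  have hAU : MeasurableSet (A ∩ U) := hA.inter hU.measurableSet
  have key : ∀ F ⊆ A ∩ U, IsClosed F → ∀ O, A ∩ U ⊆ O → IsOpen O → μ F ≤ C * ν O := by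
    intro F hF hFc O hO hOo
    obtain ⟨g, hg0, hg1, hg⟩ := exists_continuous_zero_one_of_isClosed
      (hOo.inter hU).isClosed_compl hFc
      (disjoint_compl_left_iff_subset.2 fun x hx => ⟨hO (hF hx), (hF hx).2⟩)
    calc μ F = ∫⁻ x, F.indicator 1 x ∂μ := by rw [lintegral_indicator_one hFc.measurableSet]
      _ ≤ ∫⁻ x, ENNReal.ofReal (g x) ∂μ := by
        refine lintegral_mono (indicator_le fun y hy => ?_)
        rw [hg1 hy]
        simp
      _ ≤ C * ∫⁻ x, ENNReal.ofReal (g x) ∂ν :=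
        h g g.continuous (fun x => (hg x).1) (fun x => (hg x).2)
          fun x hx => hg0 fun hx' => hx hx'.2
      _ ≤ C * ∫⁻ x, O.indicator 1 x ∂ν := by
        refine mul_le_mul_right (lintegral_mono fun x => ?_) _
        by_cases hx : x ∈ O
        · rw [indicator_of_mem hx]
          exact ENNReal.ofReal_le_one.2 (hg x).2
        · rw [hg0 fun hx' => hx hx'.1]
          simp
      _ = C * ν O := by rw [lintegral_indicator_one hOo.measurableSet]
  rw [hAU.measure_eq_iSup_isClosed_of_ne_top (measure_ne_top _ _)]
  refine iSup₂_le fun F hF => iSup_le fun hFc => ?_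
  simp only [(A ∩ U).measure_eq_iInf_isOpen ν, ENNReal.mul_iInf_of_ne hC0 hC]
  exact le_iInf₂ fun O hO => le_iInf fun hOo => key F hF hFc O hO hOo

/-- The image of `m ⊗ vol_V ⊗ vol_{(0,S]}` under the flight map `(r, υ, s) ↦ (r + sυ, υ)`. -/
def flightMeasure (V : Set Pt) (S : ℝ) (m : Measure Pt) : Measure (Pt × Pt) :=
  ((m.prod (volume.restrict V)).prod (volume.restrict (Ioc 0 S))).map
    fun q => (q.1.1 + q.2 • q.1.2, q.1.2)

/-- The integral of `f` along the flights issued from `r` with velocities in `V`. -/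
def flightInt (V : Set Pt) (S : ℝ) (f : Pt × Pt → ℝ≥0∞) (r : Pt) : ℝ≥0∞ :=
  ∫⁻ υ in V, ∫⁻ s in Ioc (0 : ℝ) S, f (r + s • υ, υ)

lemma lintegral_flightMeasure (V : Set Pt) (S : ℝ) (m : Measure Pt) [SFinite m]
    {f : Pt × Pt → ℝ≥0∞} (hf : Measurable f) :
    ∫⁻ p, f p ∂(flightMeasure V S m) = ∫⁻ r, flightInt V S f r ∂m := by
  have hφ : Measurable fun q : (Pt × Pt) × ℝ => (q.1.1 + q.2 • q.1.2, q.1.2) := by fun_prop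
  have hfφ : Measurable fun q : (Pt × Pt) × ℝ => f (q.1.1 + q.2 • q.1.2, q.1.2) := hf.comp hφ
  rw [flightMeasure, lintegral_map hf hφ, lintegral_prod _ hfφ.aemeasurable, lintegral_prod]
  · rfl
  exact (Measurable.lintegral_prod_right' hfφ).aemeasurable

lemma isFiniteMeasure_flightMeasure (vmin vmax S : ℝ) (m : Measure Pt) [IsFiniteMeasure m] :
    IsFiniteMeasure (flightMeasure (Vel vmin vmax) S m) := by
  have : IsFiniteMeasure (volume.restrict (Vel vmin vmax)) :=
    isFiniteMeasure_restrict.2 (isCompact_Vel _ _).measure_lt_top.ne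
  unfold flightMeasure
  infer_instance

lemma ofReal_integral_flightAvg {vmin vmax S : ℝ} (hS : 0 ≤ S) {m : Measure Pt}
    [IsFiniteMeasure m] {g : Pt → Pt → ℝ} (hg : Continuous (Function.uncurry g))
    (h0 : ∀ r υ, 0 ≤ g r υ) (h1 : ∀ r υ, g r υ ≤ 1) :
    ENNReal.ofReal (∫ x, flightAvg vmin vmax 0 S g x ∂m) =
      ∫⁻ p, ENNReal.ofReal (g p.1 p.2) ∂(flightMeasure (Vel vmin vmax) S m) := by
  rw [lintegral_flightMeasure _ _ _ (f := fun p => ENNReal.ofReal (g p.1 p.2))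
      hg.measurable.ennreal_ofReal, ofReal_integral_eq_lintegral_ofReal]
  · refine lintegral_congr fun x => ?_
    rw [flightAvg, flightInt, ofReal_integral_eq_lintegral_ofReal (integrableOn_flightPot hg x)
      (ae_of_all _ fun υ => flightPot_nonneg hS h0 _ _)]
    refine lintegral_congr fun υ => ?_
    rw [flightPot, intervalIntegral.integral_of_le hS, ofReal_integral_eq_lintegral_ofReal]
    · simp
    · exact (intervalIntegrable_iff_integrableOn_Ioc_of_le hS).1
        ((continuous_flight_path 0 hg x υ).intervalIntegrable _ _)
    · exact ae_of_all _ fun s => mul_nonneg (Real.exp_pos _).le (h0 _ _)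
  · exact Integrable.of_bound (continuous_flightAvg vmin vmax 0 S hg).aestronglyMeasurable
      (Real.exp (|(0 : ℝ)| * S) * S * (volume : Measure Pt).real (Vel vmin vmax))
      (ae_of_all _ fun p => by
        rw [Real.norm_eq_abs, abs_of_nonneg (flightAvg_nonneg hS h0 _)]
        exact flightAvg_le hS h0 h1 _)
  · exact ae_of_all _ fun x => flightAvg_nonneg hS h0 x

namespace NTEContext

variable {D : Set Pt} {vmin vmax : ℝ} {σs σf : Pt → Pt → ℝ} {πs πf : Pt → Pt → Pt → ℝ}

/-- A left eigenmeasure is comparable to the measure generated by one flight from it. -/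
lemma eigenmeasure_flight_bounds (ctx : NTEContext D vmin vmax σs σf πs πf) {c : ℝ}
    (hc0 : 0 < c) (hc : ∀ r ∈ D, ∀ υ ∈ Vel vmin vmax, ∀ υ' ∈ Vel vmin vmax,
      c ≤ σs r υ * πs r υ υ' + σf r υ * πf r υ υ') {S a : ℝ} (hS : 0 < S)
    (hout : ∀ r ∈ D, ∀ υ ∈ Vel vmin vmax, ∀ s, S ≤ s → r + s • υ ∉ D)
    {Ψ : (Pt → Pt → ℝ) → ℝ → Pt → Pt → ℝ}
    (hΨ : ∀ h : Pt → Pt → ℝ, BddMeasNN h →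
      IsMildSolution D (Vel vmin vmax) σs σf πs πf h (Ψ h) ∧ TimeLocBounded (Ψ h))
    {η : Measure (Pt × Pt)} [IsProbabilityMeasure η] (hη : ∀ᵐ p ∂η, p ∈ D ×ˢ Vel vmin vmax)
    (heig : ∀ t : ℝ, 0 ≤ t → ∀ g : Pt → Pt → ℝ, BddMeasNN g →
      ∫ p, Ψ g t p.1 p.2 ∂η = Real.exp (a * t) * ∫ p, g p.1 p.2 ∂η) :
    ∃ C₁ C₂ : ℝ, 0 < C₁ ∧ 0 < C₂ ∧ ∀ f : Pt × Pt → ℝ≥0∞, Measurable f →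
      (∀ p, p.1 ∉ D → f p = 0) →
      ∫⁻ p, f p ∂η ≤ ENNReal.ofReal C₁ *
        ∫⁻ r, flightInt (Vel vmin vmax) S f r ∂(η.map Prod.fst) ∧
      ENNReal.ofReal C₂ *
        ∫⁻ r, flightInt (Vel vmin vmax) S f r ∂(η.map Prod.fst) ≤
        ∫⁻ p, f p ∂η := by
  obtain ⟨C₁, C₂, hC₁, hC₂, h⟩ := ctx.eigenmeasure_test_bounds hc0 hc hS hout hΨ hη heig
  have hU : IsOpen (D ×ˢ (univ : Set Pt)) := ctx.D_open.prod isOpen_univ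
  set ν := flightMeasure (Vel vmin vmax) S (η.map Prod.fst) with hν
  have : IsFiniteMeasure ν := isFiniteMeasure_flightMeasure _ _ _ _
  have hbd : ∀ g : Pt × Pt → ℝ, Continuous g → (∀ x, 0 ≤ g x) → (∀ x, g x ≤ 1) →
      (∀ x, x ∉ D ×ˢ (univ : Set Pt) → g x = 0) →
      ∫⁻ x, ENNReal.ofReal (g x) ∂η ≤ ENNReal.ofReal C₁ * ∫⁻ x, ENNReal.ofReal (g x) ∂ν ∧
      ENNReal.ofReal C₂ * ∫⁻ x, ENNReal.ofReal (g x) ∂ν ≤ ∫⁻ x, ENNReal.ofReal (g x) ∂η := by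
    intro g hg h0 h1 hgD
    have hg' : Continuous (Function.uncurry fun r υ => g (r, υ)) := hg
    have h' := h (fun r υ => g (r, υ)) hg' (fun _ _ => h0 _) (fun _ _ => h1 _)
      fun x y hx => hgD _ fun hx' => hx hx'.1
    have e1 := ofReal_integral_flightAvg (vmin := vmin) (vmax := vmax) hS.le
      (m := η.map Prod.fst) hg' (fun _ _ => h0 _) (fun _ _ => h1 _)
    rw [integral_map measurable_fst.aemeasurable
      (continuous_flightAvg vmin vmax 0 S hg').aestronglyMeasurable] at e1
    have e2 : ENNReal.ofReal (∫ p, g p ∂η) = ∫⁻ p, ENNReal.ofReal (g p) ∂η :=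
      ofReal_integral_eq_lintegral_ofReal
        (Integrable.of_bound hg.aestronglyMeasurable 1 (ae_of_all _ fun p => by
          rw [Real.norm_eq_abs, abs_of_nonneg (h0 _)]
          exact h1 _)) (ae_of_all _ h0)
    rw [← e2, hν, ← e1, ← ENNReal.ofReal_mul hC₁.le, ← ENNReal.ofReal_mul hC₂.le]
    exact ⟨ENNReal.ofReal_le_ofReal h'.1, ENNReal.ofReal_le_ofReal h'.2⟩
  have hup : η.restrict (D ×ˢ univ) ≤ ENNReal.ofReal C₁ • ν.restrict (D ×ˢ univ) :=
    restrict_le_smul_of_forall_continuous_le hU (by simpa using hC₁) ENNReal.ofReal_ne_top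
      fun g hg h0 h1 hgD => (hbd g hg h0 h1 hgD).1
  have hC₂' : ENNReal.ofReal C₂ ≠ 0 := by simpa using hC₂
  have hlow : ν.restrict (D ×ˢ univ) ≤ (ENNReal.ofReal C₂)⁻¹ • η.restrict (D ×ˢ univ) :=
    restrict_le_smul_of_forall_continuous_le hU (by simp) (ENNReal.inv_ne_top.2 hC₂')
      fun g hg h0 h1 hgD => (ENNReal.mul_le_iff_le_inv hC₂' ENNReal.ofReal_ne_top).1
        (hbd g hg h0 h1 hgD).2
  refine ⟨C₁, C₂, hC₁, hC₂, fun f hf hfD => ?_⟩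
  have hr : ∀ μ : Measure (Pt × Pt), ∫⁻ p, f p ∂μ = ∫⁻ p, f p ∂(μ.restrict (D ×ˢ univ)) := by
    intro μ
    rw [← lintegral_indicator hU.measurableSet]
    refine lintegral_congr fun p => ?_
    by_cases hp : p ∈ D ×ˢ (univ : Set Pt)
    · rw [indicator_of_mem hp]
    · rw [indicator_of_notMem hp, hfD p fun hp' => hp ⟨hp', mem_univ _⟩]
  rw [← lintegral_flightMeasure _ _ _ hf, ← hν, hr η, hr ν]
  constructor
  · refine (lintegral_mono' hup le_rfl).trans_eq ?_
    rw [lintegral_smul_measure, smul_eq_mul]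
  · rw [ENNReal.mul_le_iff_le_inv hC₂' ENNReal.ofReal_ne_top]
    refine (lintegral_mono' hlow le_rfl).trans_eq ?_
    rw [lintegral_smul_measure, smul_eq_mul]

end NTEContext

lemma lintegral_flightInt (V : Set Pt) (T : ℝ) {f : Pt × Pt → ℝ≥0∞}
    (hf : Measurable f) :
    ∫⁻ r, flightInt V T f r = ENNReal.ofReal T * ∫⁻ υ in V, ∫⁻ r, f (r, υ) := by
  have h1 : Measurable fun q : (Pt × Pt) × ℝ => f (q.1.1 + q.2 • q.1.2, q.1.2) :=
    hf.comp (by fun_prop)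
  unfold flightInt
  rw [lintegral_lintegral_swap]
  · have h2 : ∀ υ : Pt, ∫⁻ r : Pt, ∫⁻ s in Ioc (0 : ℝ) T, f (r + s • υ, υ) =
        ENNReal.ofReal T * ∫⁻ r, f (r, υ) := by
      intro υ
      rw [lintegral_lintegral_swap]
      · have h3 : ∀ s : ℝ, ∫⁻ r : Pt, f (r + s • υ, υ) = ∫⁻ r, f (r, υ) := fun s =>
          lintegral_add_right_eq_self (fun r => f (r, υ)) (s • υ)
        simp only [h3, lintegral_const, Measure.restrict_apply MeasurableSet.univ, univ_inter,
          Real.volume_Ioc, sub_zero]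
        rw [mul_comm]
      · exact (h1.comp (by fun_prop : Measurable fun q : Pt × ℝ => ((q.1, υ), q.2))).aemeasurable
    simp only [h2]
    rw [lintegral_const_mul]
    exact Measurable.lintegral_prod_right' (f := fun q : Pt × Pt => f (q.2, q.1))
      (hf.comp measurable_swap)
  · exact (Measurable.lintegral_prod_right' h1).aemeasurable

lemma measurable_flightInt (V : Set Pt) (T : ℝ) {f : Pt × Pt → ℝ≥0∞} (hf : Measurable f) :
    Measurable (flightInt V T f) := by
  have h1 : Measurable fun q : (Pt × Pt) × ℝ => f (q.1.1 + q.2 • q.1.2, q.1.2) :=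
    hf.comp (by fun_prop)
  exact Measurable.lintegral_prod_right' (Measurable.lintegral_prod_right' h1)

/-- Flights of duration at least `ε` average `f` against a bounded density. -/
lemma flightInt_le_add {V : Set Pt} {S ε : ℝ} (hε : 0 < ε) {f : Pt → ℝ≥0∞} (hf : Measurable f)
    (r : Pt) :
    flightInt V S (fun p => f p.1) r ≤ flightInt V ε (fun p => f p.1) r +
      ENNReal.ofReal S * ENNReal.ofReal ((ε ^ 3)⁻¹) * ∫⁻ y, f y := by
  have h1 : Measurable fun q : Pt × ℝ => f (r + q.2 • q.1) := hf.comp (by fun_prop)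
  have h2 : ∀ υ : Pt, ∫⁻ s in Ioc (0 : ℝ) S, f (r + s • υ) ≤
      (∫⁻ s in Ioc (0 : ℝ) ε, f (r + s • υ)) + ∫⁻ s in Ioc ε S, f (r + s • υ) := by
    intro υ
    refine (lintegral_mono_set ?_).trans (lintegral_union_le _ _ _)
    intro s hs
    rcases le_or_gt s ε with h | h
    · exact Or.inl ⟨hs.1, h⟩
    · exact Or.inr ⟨h, hs.2⟩
  unfold flightInt
  refine (lintegral_mono fun υ => h2 υ).trans ?_
  rw [lintegral_add_left (Measurable.lintegral_prod_right' h1)]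
  refine add_le_add_right ?_ _
  rw [lintegral_lintegral_swap h1.aemeasurable]
  calc ∫⁻ s in Ioc ε S, ∫⁻ υ in V, f (r + s • υ)
      ≤ ∫⁻ s in Ioc ε S, ENNReal.ofReal ((ε ^ 3)⁻¹) * ∫⁻ y, f y := by
        refine setLIntegral_mono measurable_const fun s hs => ?_
        have hs0 : 0 < s := hε.trans hs.1
        refine (setLIntegral_le_lintegral _ _).trans ?_
        rw [lintegral_comp_add_smul f r hs0 hf]
        gcongr
        exact hs.1.le
    _ ≤ _ := by
        rw [lintegral_const, Measure.restrict_apply MeasurableSet.univ, univ_inter,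
          Real.volume_Ioc, mul_comm, mul_assoc]
        gcongr
        linarith

/-- A probability measure dominated by its own flights has a bounded density. -/
lemma exists_le_smul_volume {V D : Set Pt} (hV : volume V ≠ ∞) (hD : MeasurableSet D) {S : ℝ}
    {m : Measure Pt} [IsProbabilityMeasure m] (hmD : ∀ᵐ x ∂m, x ∈ D) {C : ℝ}
    (h : ∀ f : Pt → ℝ≥0∞, Measurable f → (∀ x, x ∉ D → f x = 0) →
      ∫⁻ x, f x ∂m ≤ ENNReal.ofReal C * ∫⁻ x, flightInt V S (fun p => f p.1) x ∂m) :
    ∃ A : ℝ≥0∞, A ≠ ∞ ∧ m ≤ A • volume := by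
  set v := (volume : Measure Pt).real V with hv
  have hvV : volume V = ENNReal.ofReal v := by rw [hv, ofReal_measureReal hV]
  have hv0 : 0 ≤ v := measureReal_nonneg
  set ε : ℝ := (2 * (|C| * v + 1))⁻¹ with hεd
  have hε : 0 < ε := by positivity
  have hCε : ENNReal.ofReal C * (ENNReal.ofReal ε * volume V) ≤ 2⁻¹ := by
    rw [hvV, ← ENNReal.ofReal_mul hε.le, ← ENNReal.ofReal_mul' (by positivity)]
    have : C * (ε * v) ≤ 2⁻¹ := by
      have h1 : C * (ε * v) ≤ |C| * (ε * v) :=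
        mul_le_mul_of_nonneg_right (le_abs_self _) (by positivity)
      have h2 : ε * (|C| * v + 1) = 2⁻¹ := by
        rw [hεd]
        have : |C| * v + 1 ≠ 0 := by positivity
        field_simp
      nlinarith
    refine (ENNReal.ofReal_le_ofReal this).trans_eq ?_
    rw [ENNReal.ofReal_inv_of_pos two_pos]
    simp
  set A : ℝ≥0∞ := ENNReal.ofReal C * (ENNReal.ofReal S * ENNReal.ofReal ((ε ^ 3)⁻¹)) with hA
  have hAt : A ≠ ∞ := ENNReal.mul_ne_top ENNReal.ofReal_ne_top
    (ENNReal.mul_ne_top ENNReal.ofReal_ne_top ENNReal.ofReal_ne_top)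
  have key : ∀ n : ℕ, ∀ B : ℝ≥0∞, ∀ f : Pt → ℝ≥0∞, Measurable f → (∀ x, x ∉ D → f x = 0) →
      (∀ x, f x ≤ B) → ∫⁻ x, f x ∂m ≤ 2 * A * (∫⁻ x, f x) + 2⁻¹ ^ n * B := by
    intro n
    induction n with
    | zero =>
      intro B f hf hfD hB
      refine (lintegral_mono hB).trans ?_
      simp
    | succ n ih =>
      intro B f hf hfD hB
      have hPm : Measurable (flightInt V ε fun p => f p.1) :=
        measurable_flightInt V ε (hf.comp measurable_fst)
      set g : Pt → ℝ≥0∞ := D.indicator fun x => ENNReal.ofReal C * flightInt V ε (fun p => f p.1) x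
        with hg
      have hgm : Measurable g := (hPm.const_mul _).indicator hD
      have hgB : ∀ x, g x ≤ 2⁻¹ * B := by
        intro x
        refine (indicator_le_self D _ x).trans ?_
        have : flightInt V ε (fun p => f p.1) x ≤ ENNReal.ofReal ε * volume V * B := by
          unfold flightInt
          refine (lintegral_mono fun υ => lintegral_mono fun s => hB _).trans ?_
          simp only [lintegral_const, Measure.restrict_apply MeasurableSet.univ, univ_inter,
            Real.volume_Ioc, sub_zero]
          exact le_of_eq (by ring)
        calc _ ≤ ENNReal.ofReal C * (ENNReal.ofReal ε * volume V * B) := by gcongr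
          _ = ENNReal.ofReal C * (ENNReal.ofReal ε * volume V) * B := by ring
          _ ≤ _ := by gcongr
      have hgi : ∫⁻ x, g x ≤ 2⁻¹ * ∫⁻ x, f x := by
        refine (lintegral_mono (indicator_le_self D _)).trans ?_
        rw [lintegral_const_mul _ hPm,
          lintegral_flightInt V ε (f := fun p => f p.1)
            (hf.comp measurable_fst)]
        simp only [lintegral_const, Measure.restrict_apply MeasurableSet.univ,
          univ_inter]
        calc _ = ENNReal.ofReal C * (ENNReal.ofReal ε * volume V) * ∫⁻ x, f x := by ring
          _ ≤ _ := by gcongr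
      have hgint : ENNReal.ofReal C * ∫⁻ x, flightInt V ε (fun p => f p.1) x ∂m =
          ∫⁻ x, g x ∂m := by
        rw [← lintegral_const_mul _ hPm]
        refine lintegral_congr_ae ?_
        filter_upwards [hmD] with x hx
        rw [hg, indicator_of_mem hx]
      calc ∫⁻ x, f x ∂m
          ≤ ENNReal.ofReal C * ∫⁻ x, flightInt V S (fun p => f p.1) x ∂m := h f hf hfD
        _ ≤ ENNReal.ofReal C * ∫⁻ x, (flightInt V ε (fun p => f p.1) x +
              ENNReal.ofReal S * ENNReal.ofReal ((ε ^ 3)⁻¹) * ∫⁻ y, f y) ∂m := by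
            gcongr with x
            exact flightInt_le_add hε hf x
        _ = ∫⁻ x, g x ∂m + A * ∫⁻ y, f y := by
            rw [lintegral_add_left hPm, lintegral_const, measure_univ, mul_one, mul_add, hgint,
              hA]
            ring
        _ ≤ (2 * A * (2⁻¹ * ∫⁻ x, f x) + 2⁻¹ ^ n * (2⁻¹ * B)) + A * ∫⁻ y, f y := by
            gcongr
            refine (ih _ g hgm (fun x hx => indicator_of_notMem hx _) hgB).trans ?_
            gcongr
        _ = 2 * A * (∫⁻ x, f x) + 2⁻¹ ^ (n + 1) * B := by
            have h2 : (2 : ℝ≥0∞) * 2⁻¹ = 1 := ENNReal.mul_inv_cancel two_ne_zero ENNReal.ofNat_ne_top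
            calc _ = (2 * 2⁻¹) * (A * ∫⁻ x, f x) + 2⁻¹ ^ n * (2⁻¹ * B) + A * ∫⁻ y, f y := by ring
              _ = _ := by rw [h2]; ring
  refine ⟨2 * A, ENNReal.mul_ne_top ENNReal.ofNat_ne_top hAt, Measure.le_iff.2 fun E hE => ?_⟩
  have hED := hE.inter hD
  have h1 : m E = m (E ∩ D) := by
    refine measure_congr ?_
    filter_upwards [hmD] with x hx
    exact propext ⟨fun h => ⟨h, hx⟩, fun h => h.1⟩
  have h2 : ∀ n : ℕ, m (E ∩ D) ≤ 2 * A * volume (E ∩ D) + 2⁻¹ ^ n := by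
    intro n
    have := key n 1 ((E ∩ D).indicator 1) (measurable_one.indicator hED)
      (fun x hx => indicator_of_notMem (fun h => hx h.2) _)
      (fun x => indicator_le_self (E ∩ D) 1 x)
    rwa [lintegral_indicator_one hED, lintegral_indicator_one hED, mul_one] at this
  have h3 : Filter.Tendsto (fun n : ℕ => 2 * A * volume (E ∩ D) + (2⁻¹ : ℝ≥0∞) ^ n) Filter.atTop
      (nhds (2 * A * volume (E ∩ D) + 0)) :=
    (ENNReal.tendsto_pow_atTop_nhds_zero_of_lt_one (by simp)).const_add _
  rw [add_zero] at h3
  rw [h1]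
  refine (ge_of_tendsto' h3 h2).trans ?_
  rw [Measure.smul_apply, smul_eq_mul]
  gcongr
  exact inter_subset_left

/-- A finite measure dominated by a multiple of `μ` has a bounded density, which inherits local
lower bounds. -/
lemma exists_bounded_density {X : Type*} [MeasurableSpace X] {μ η : Measure X} [SigmaFinite μ]
    [IsFiniteMeasure η] {M : ℝ≥0∞} (hM : M ≠ ∞) (h : η ≤ M • μ) :
    ∃ ρ : X → ℝ, Measurable ρ ∧ (∀ x, 0 ≤ ρ x) ∧
      η = μ.withDensity (fun x => ENNReal.ofReal (ρ x)) ∧ (∃ B : ℝ, ∀ᵐ x ∂μ, ρ x ≤ B) ∧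
      ∀ K : Set X, MeasurableSet K → ∀ c : ℝ, 0 < c →
        (∀ s, MeasurableSet s → s ⊆ K → ENNReal.ofReal c * μ s ≤ η s) →
        ∀ᵐ x ∂μ, x ∈ K → c ≤ ρ x := by
  have hac : η ≪ μ := (Measure.absolutelyContinuous_of_le h).trans Measure.smul_absolutelyContinuous
  have htop : ∀ᵐ x ∂μ, η.rnDeriv μ x < ∞ := Measure.rnDeriv_lt_top η μ
  have hset : ∀ s, ∫⁻ x in s, η.rnDeriv μ x ∂μ = η s := fun s => Measure.setLIntegral_rnDeriv hac s
  refine ⟨fun x => (η.rnDeriv μ x).toReal, (Measure.measurable_rnDeriv η μ).ennreal_toReal,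
    fun x => ENNReal.toReal_nonneg, ?_, ⟨M.toReal, ?_⟩, fun K hK c hc hKc => ?_⟩
  · conv_lhs => rw [← Measure.withDensity_rnDeriv_eq η μ hac]
    refine withDensity_congr_ae ?_
    filter_upwards [htop] with x hx
    rw [ENNReal.ofReal_toReal hx.ne]
  · have : η.rnDeriv μ ≤ᵐ[μ] fun _ => M := by
      refine ae_le_of_forall_setLIntegral_le_of_sigmaFinite (Measure.measurable_rnDeriv η μ)
        fun s hs _ => ?_
      rw [hset, setLIntegral_const]
      exact h s
    filter_upwards [this] with x hx
    exact ENNReal.toReal_mono hM hx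
  · have : K.indicator (fun _ => ENNReal.ofReal c) ≤ᵐ[μ] η.rnDeriv μ := by
      refine ae_le_of_forall_setLIntegral_le_of_sigmaFinite (measurable_const.indicator hK)
        fun s hs _ => ?_
      rw [hset, setLIntegral_indicator hK, setLIntegral_const]
      exact (hKc _ (hK.inter hs) inter_subset_left).trans (measure_mono inter_subset_right)
    filter_upwards [this, htop] with x hx hxt hxK
    rw [indicator_of_mem hxK] at hx
    exact (ENNReal.ofReal_le_iff_le_toReal hxt.ne).1 hx

namespace NTEContext

variable {D : Set Pt} {vmin vmax : ℝ} {σs σf : Pt → Pt → ℝ} {πs πf : Pt → Pt → Pt → ℝ}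

/-- A probability measure dominated by its own flights from `D` has a bounded density. -/
lemma exists_eigenmeasure_le (ctx : NTEContext D vmin vmax σs σf πs πf) {S C : ℝ}
    {η : Measure (Pt × Pt)} [IsProbabilityMeasure η] (hη : ∀ᵐ p ∂η, p ∈ D ×ˢ Vel vmin vmax)
    (h : ∀ f : Pt × Pt → ℝ≥0∞, Measurable f → (∀ p, p.1 ∉ D → f p = 0) →
      ∫⁻ p, f p ∂η ≤ ENNReal.ofReal C *
        ∫⁻ r, flightInt (Vel vmin vmax) S f r ∂(η.map Prod.fst)) :
    ∃ M : ℝ≥0∞, M ≠ ∞ ∧ η ≤ M • volume := by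
  have hDm := ctx.D_open.measurableSet
  have : IsProbabilityMeasure (η.map Prod.fst) :=
    Measure.isProbabilityMeasure_map measurable_fst.aemeasurable
  have hmD : ∀ᵐ x ∂(η.map Prod.fst), x ∈ D :=
    (ae_map_iff measurable_fst.aemeasurable hDm).2 (hη.mono fun p hp => hp.1)
  obtain ⟨A, hA, hmA⟩ := exists_le_smul_volume (V := Vel vmin vmax) (D := D) (S := S) (C := C)
    (isCompact_Vel vmin vmax).measure_lt_top.ne hDm hmD (fun f hf hfD => by
      rw [lintegral_map hf measurable_fst]
      exact h (fun p => f p.1) (hf.comp measurable_fst) fun p hp => hfD _ hp)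
  refine ⟨ENNReal.ofReal C * (A * ENNReal.ofReal S), ENNReal.mul_ne_top ENNReal.ofReal_ne_top
    (ENNReal.mul_ne_top hA ENNReal.ofReal_ne_top), Measure.le_iff.2 fun E hE => ?_⟩
  have hED : MeasurableSet (E ∩ D ×ˢ univ) := hE.inter (hDm.prod MeasurableSet.univ)
  have h1 : η E = η (E ∩ D ×ˢ univ) := by
    refine measure_congr ?_
    filter_upwards [hη] with p hp
    exact propext ⟨fun h => ⟨h, hp.1, mem_univ _⟩, fun h => h.1⟩
  have hfm : Measurable ((E ∩ D ×ˢ univ).indicator (1 : Pt × Pt → ℝ≥0∞)) :=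
    measurable_one.indicator hED
  have h2 := h _ hfm fun p hp => indicator_of_notMem (fun hp' => hp hp'.2.1) _
  rw [lintegral_indicator_one hED, ← h1] at h2
  refine h2.trans ?_
  rw [Measure.smul_apply, smul_eq_mul, mul_assoc, mul_assoc]
  gcongr
  refine (lintegral_mono' hmA le_rfl).trans ?_
  rw [lintegral_smul_measure, smul_eq_mul, lintegral_flightInt _ _ hfm]
  gcongr
  refine (setLIntegral_le_lintegral _ _).trans ?_
  rw [← lintegral_prod_symm _ hfm.aemeasurable, ← Measure.volume_eq_prod,
    lintegral_indicator_one hED]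
  exact measure_mono inter_subset_left

/-- A probability measure dominating its own flights from `D` dominates Lebesgue measure on
compact subsets of `D × V`. -/
lemma exists_le_eigenmeasure (ctx : NTEContext D vmin vmax σs σf πs πf) {S C c : ℝ} (hS : 0 < S)
    (hC : 0 < C) (hc : 0 < c)
    (hgeo : ∀ r ∈ D, ∀ f : Pt → ℝ≥0∞, Measurable f → ENNReal.ofReal c * ∫⁻ y in D, f y ≤
      ∫⁻ υ in Vel vmin vmax, ∫⁻ s in Ioc (0 : ℝ) S, D.indicator f (r + s • υ))
    {η : Measure (Pt × Pt)} [IsProbabilityMeasure η] (hη : ∀ᵐ p ∂η, p ∈ D ×ˢ Vel vmin vmax)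
    (h : ∀ f : Pt × Pt → ℝ≥0∞, Measurable f → (∀ p, p.1 ∉ D → f p = 0) →
      ENNReal.ofReal C * ∫⁻ r, flightInt (Vel vmin vmax) S f r ∂(η.map Prod.fst) ≤
        ∫⁻ p, f p ∂η)
    {K : Set (Pt × Pt)} (hK : IsCompact K) (hKD : K ⊆ D ×ˢ Vel vmin vmax) :
    ∃ k : ℝ, 0 < k ∧ ∀ s, MeasurableSet s → s ⊆ K → ENNReal.ofReal k * volume s ≤ η s := by
  have hDm := ctx.D_open.measurableSet
  have hVm := measurableSet_Vel vmin vmax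
  obtain ⟨s₀, hs₀, hfl⟩ := exists_flight_time ctx.D_open
    (ctx.vmin_pos.trans ctx.vmin_lt_vmax) hK hKD
  have : IsProbabilityMeasure (η.map Prod.fst) :=
    Measure.isProbabilityMeasure_map measurable_fst.aemeasurable
  have hmD : ∀ᵐ x ∂(η.map Prod.fst), x ∈ D :=
    (ae_map_iff measurable_fst.aemeasurable hDm).2 (hη.mono fun p hp => hp.1)
  have hm : ∀ f : Pt → ℝ≥0∞, Measurable f →
      ENNReal.ofReal C * (ENNReal.ofReal c * ∫⁻ y in D, f y) ≤ ∫⁻ x, f x ∂(η.map Prod.fst) := by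
    intro f hf
    have hfD := hf.indicator hDm
    calc _ = ENNReal.ofReal C * ∫⁻ _, (ENNReal.ofReal c * ∫⁻ y in D, f y) ∂(η.map Prod.fst) := by
          rw [lintegral_const, measure_univ, mul_one]
      _ ≤ ENNReal.ofReal C * ∫⁻ r, flightInt (Vel vmin vmax) S (fun p => D.indicator f p.1) r
            ∂(η.map Prod.fst) := by
          refine mul_le_mul_right (lintegral_mono_ae ?_) _
          filter_upwards [hmD] with r hr
          exact hgeo r hr f hf
      _ ≤ ∫⁻ p, D.indicator f p.1 ∂η :=
          h _ (hfD.comp measurable_fst) fun p hp => indicator_of_notMem hp _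
      _ = ∫⁻ x, D.indicator f x ∂(η.map Prod.fst) := (lintegral_map hfD measurable_fst).symm
      _ ≤ _ := lintegral_mono (indicator_le_self D f)
  set T := min s₀ S with hT
  have hT0 : 0 < T := lt_min hs₀ hS
  refine ⟨C * (C * c) * T, by positivity, fun A hA hAK => ?_⟩
  set f : Pt × Pt → ℝ≥0∞ := A.indicator 1 with hf
  have hfm : Measurable f := measurable_one.indicator hA
  have hf0 : ∀ p, p ∉ A → f p = 0 := fun p hp => by rw [hf, indicator_of_notMem hp]
  have hflow : flightInt (Vel vmin vmax) T f ≤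
      D.indicator (flightInt (Vel vmin vmax) S f) := by
    intro r
    by_cases hr : r ∈ D
    · rw [indicator_of_mem hr]
      exact lintegral_mono fun υ => lintegral_mono_set (Ioc_subset_Ioc_right (min_le_right _ _))
    · rw [indicator_of_notMem hr]
      refine le_of_eq ?_
      unfold flightInt
      rw [setLIntegral_congr_fun hVm (g := fun _ => 0), lintegral_zero]
      intro υ _
      simp only
      rw [setLIntegral_congr_fun measurableSet_Ioc (g := fun _ => 0), lintegral_zero]
      intro s hs
      refine hf0 _ fun hmem => hr ?_
      have h1 := hfl _ (hAK hmem) (-s) (by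
        rw [abs_neg, abs_of_pos hs.1]
        exact hs.2.trans (min_le_left _ _))
      simpa using h1
  have hvol : ∫⁻ υ in Vel vmin vmax, ∫⁻ r, f (r, υ) = volume A := by
    have h1 : ∀ υ, υ ∉ Vel vmin vmax → ∫⁻ r, f (r, υ) = 0 := by
      intro υ hυ
      have : ∀ r, f (r, υ) = 0 := fun r => hf0 _ fun h => hυ (hKD (hAK h)).2
      simp only [this, lintegral_zero]
    rw [← lintegral_indicator hVm, ← lintegral_indicator_one hA, Measure.volume_eq_prod,
      lintegral_prod_symm _ hfm.aemeasurable]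
    refine lintegral_congr fun υ => ?_
    by_cases hυ : υ ∈ Vel vmin vmax
    · rw [indicator_of_mem hυ]
    · rw [indicator_of_notMem hυ, h1 υ hυ]
  calc ENNReal.ofReal (C * (C * c) * T) * volume A
      = ENNReal.ofReal C * (ENNReal.ofReal C * (ENNReal.ofReal c *
          ∫⁻ r, flightInt (Vel vmin vmax) T f r)) := by
        rw [lintegral_flightInt _ _ hfm, hvol, ENNReal.ofReal_mul (by positivity),
          ENNReal.ofReal_mul hC.le, ENNReal.ofReal_mul hC.le]
        ring
    _ ≤ ENNReal.ofReal C * (ENNReal.ofReal C * (ENNReal.ofReal c *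
          ∫⁻ r in D, flightInt (Vel vmin vmax) S f r)) := by
        rw [← lintegral_indicator hDm]
        gcongr
        exact hflow _
    _ ≤ ENNReal.ofReal C * ∫⁻ r, flightInt (Vel vmin vmax) S f r ∂(η.map Prod.fst) := by
        gcongr
        exact hm _ (measurable_flightInt _ _ hfm)
    _ ≤ ∫⁻ p, f p ∂η := h f hfm fun p hp => hf0 p fun h => hp (hKD (hAK h)).1
    _ = η A := lintegral_indicator_one hA

end NTEContext

/-- Lemma 7.4 of the paper. Under (H1) and (H2)*, if `η` is a probability
(quasi-stationary) left eigenmeasure and `φ` a positive bounded right eigenfunction of the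
killed semigroup `e^{-β̄ t} ψ_t` with eigenvalue `e^{λ_c t}`, then `φ` is bounded away from
zero on compact subsets of `D × V`, and `η` has a bounded Lebesgue density that is a.e.
bounded away from zero on compact subsets of `D × V`. -/
theorem NTE_eigenfunction_density_bounds
    (D : Set Pt) (vmin vmax : ℝ) (σs σf : Pt → Pt → ℝ) (πs πf : Pt → Pt → Pt → ℝ)
    (ctx : NTEContext D vmin vmax σs σf πs πf)
    (hH2 : ∃ c : ℝ, 0 < c ∧ ∀ r ∈ D, ∀ υ ∈ Vel vmin vmax, ∀ υ' ∈ Vel vmin vmax,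
      c ≤ σs r υ * πs r υ υ' + σf r υ * πf r υ υ')
    (Ψ : (Pt → Pt → ℝ) → ℝ → Pt → Pt → ℝ)
    (hΨ : ∀ h : Pt → Pt → ℝ, BddMeasNN h →
      IsMildSolution D (Vel vmin vmax) σs σf πs πf h (Ψ h) ∧ TimeLocBounded (Ψ h))
    -- `β(r,υ) = σ_f(r,υ)(∫_V π_f(r,υ,υ')dυ' − 1)` and `β̄ = sup_{D×V} β`
    (βbar : ℝ)
    (hβbar : βbar = sSup ((fun p : Pt × Pt =>
      σf p.1 p.2 * ((∫ υ' in Vel vmin vmax, πf p.1 p.2 υ') - 1)) '' (D ×ˢ Vel vmin vmax)))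
    (lamc : ℝ)
    (η : Measure (Pt × Pt)) (hηprob : IsProbabilityMeasure η)
    (hηsupp : η ((D ×ˢ Vel vmin vmax)ᶜ) = 0)
    (hηeig : ∀ t : ℝ, 0 ≤ t → ∀ g : Pt → Pt → ℝ, BddMeasNN g →
      (∫ p : Pt × Pt, Real.exp (-(βbar * t)) * Ψ g t p.1 p.2 ∂η) =
        Real.exp (lamc * t) * ∫ p : Pt × Pt, g p.1 p.2 ∂η)
    (φ : Pt → Pt → ℝ) (hφ : BddMeasNN φ)
    (hφpos : ∀ r υ : Pt, (r, υ) ∈ D ×ˢ Vel vmin vmax → 0 < φ r υ)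
    (hφeig : ∀ t : ℝ, 0 ≤ t → ∀ r υ : Pt, (r, υ) ∈ D ×ˢ Vel vmin vmax →
      Real.exp (-(βbar * t)) * Ψ φ t r υ = Real.exp (lamc * t) * φ r υ) :
    -- (i) `φ` is bounded away from zero on compact subsets of `D × V`
    (∀ K : Set (Pt × Pt), IsCompact K → K ⊆ D ×ˢ Vel vmin vmax →
      ∃ c : ℝ, 0 < c ∧ ∀ p ∈ K, c ≤ φ p.1 p.2) ∧
    -- (ii) `η` has an essentially bounded Lebesgue density that is a.e. bounded away
    -- from zero on compact subsets of `D × V`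
    (∃ ρd : Pt × Pt → ℝ, Measurable ρd ∧ (∀ p, 0 ≤ ρd p) ∧
      η = volume.withDensity (fun p => ENNReal.ofReal (ρd p)) ∧
      (∃ M : ℝ, ∀ᵐ p : Pt × Pt ∂volume, ρd p ≤ M) ∧
      (∀ K : Set (Pt × Pt), IsCompact K → K ⊆ D ×ˢ Vel vmin vmax →
        ∃ c : ℝ, 0 < c ∧ ∀ᵐ p : Pt × Pt ∂volume, p ∈ K → c ≤ ρd p)) := by
  obtain ⟨c, hc0, hc⟩ := hH2
  have hη : ∀ᵐ p ∂η, p ∈ D ×ˢ Vel vmin vmax := hηsupp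
  have hexp : ∀ t x y : ℝ, Real.exp (-(βbar * t)) * x = Real.exp (lamc * t) * y →
      x = Real.exp ((lamc + βbar) * t) * y := by
    intro t x y h
    have h1 : Real.exp (βbar * t) * Real.exp (-(βbar * t)) = 1 := by
      rw [← Real.exp_add, add_neg_cancel, Real.exp_zero]
    calc x = Real.exp (βbar * t) * (Real.exp (-(βbar * t)) * x) := by
          rw [← mul_assoc, h1, one_mul]
      _ = Real.exp ((lamc + βbar) * t) * y := by
          rw [h, ← mul_assoc, ← Real.exp_add]
          ring_nf
  have heig : ∀ t : ℝ, 0 ≤ t → ∀ g : Pt → Pt → ℝ, BddMeasNN g →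
      ∫ p, Ψ g t p.1 p.2 ∂η = Real.exp ((lamc + βbar) * t) * ∫ p, g p.1 p.2 ∂η := by
    intro t ht g hg
    refine hexp t _ _ ?_
    rw [← hηeig t ht g hg, integral_const_mul]
  refine ⟨fun K hK hKD => ctx.eigenfunction_bounded_below hc0 hc hφ (hΨ φ hφ).1
    (fun t ht r hr υ hυ => hexp t _ _ (hφeig t ht r υ ⟨hr, hυ⟩))
    (fun r hr υ hυ => hφpos r υ ⟨hr, hυ⟩) hK hKD, ?_⟩
  obtain ⟨S, hS, hout, k, hk, hgeo⟩ := ctx.exists_flight_horizon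
  obtain ⟨C₁, C₂, hC₁, hC₂, hflight⟩ :=
    ctx.eigenmeasure_flight_bounds hc0 hc hS hout hΨ hη heig
  obtain ⟨M, hM, hηM⟩ := ctx.exists_eigenmeasure_le hη fun f hf hfD => (hflight f hf hfD).1
  obtain ⟨ρd, hρm, hρ0, hρη, hρB, hρK⟩ := exists_bounded_density hM hηM
  refine ⟨ρd, hρm, hρ0, hρη, hρB, fun K hK hKD => ?_⟩
  obtain ⟨l, hl, hlK⟩ := ctx.exists_le_eigenmeasure hS hC₂ hk hgeo hη
    (fun f hf hfD => (hflight f hf hfD).2) hK hKD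
  exact ⟨l, hl, hρK K hK.measurableSet l hl hlK⟩
end
end

section
/- Let t > 0, ρ₀ > 0, ρ₁ > 0, let u₁ ∈ ℝ³ with ‖u₁‖ = 1, and let z ∈ ℝ³ with ‖z‖ ≤ ρ₀·t. Then there exist s ∈ [0, t] and u₀ ∈ ℝ³ with ‖u₀‖ = 1 such that z = s·ρ₀·u₀ + (t−s)·ρ₁·u₁. -/
/-- surjectivity onto the ball in the minorization lemma. For `t > 0`,
`ρ₀, ρ₁ > 0`, a unit vector `u₁` and any `z` with `‖z‖ ≤ ρ₀ t`, one can write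
`z = s ρ₀ u₀ + (t − s) ρ₁ u₁` for some `s ∈ [0, t]` and some unit vector `u₀`. -/
theorem ball_reachable_two_segments (t ρ₀ ρ₁ : ℝ) (ht : 0 < t) (h0 : 0 < ρ₀) (h1 : 0 < ρ₁)
    (u₁ : EuclideanSpace ℝ (Fin 3)) (hu₁ : ‖u₁‖ = 1)
    (z : EuclideanSpace ℝ (Fin 3)) (hz : ‖z‖ ≤ ρ₀ * t) :
    ∃ s ∈ Set.Icc (0:ℝ) t, ∃ u₀ : EuclideanSpace ℝ (Fin 3), ‖u₀‖ = 1 ∧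
      z = (s * ρ₀) • u₀ + ((t - s) * ρ₁) • u₁ := by
  obtain ⟨s, hs, hfs⟩ : ∃ s ∈ Set.Icc (0 : ℝ) t, ‖z - ((t - s) * ρ₁) • u₁‖ - s * ρ₀ = 0 := by
    refine intermediate_value_Icc' (f := fun s : ℝ => ‖z - ((t - s) * ρ₁) • u₁‖ - s * ρ₀)
      ht.le (by fun_prop) ⟨?_, ?_⟩
    · simpa [mul_comm t] using hz
    · simp
  refine ⟨s, hs, ?_⟩
  rcases hs.1.eq_or_lt with rfl | hs0
  · refine ⟨u₁, hu₁, ?_⟩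
    rw [zero_mul, sub_zero, norm_eq_zero, sub_eq_zero] at hfs
    simpa using hfs
  · have hpos : 0 < s * ρ₀ := mul_pos hs0 h0
    refine ⟨(s * ρ₀)⁻¹ • (z - ((t - s) * ρ₁) • u₁), ?_, ?_⟩
    · rw [norm_smul, sub_eq_zero.1 hfs, norm_inv, Real.norm_of_nonneg hpos.le,
        inv_mul_cancel₀ hpos.ne']
    · rw [smul_inv_smul₀ hpos.ne', sub_add_cancel]
end

section
/- For parameters ρ₀, ρ₁, θ₁, φ₁ ∈ ℝ with ρ₀, ρ₁ > 0, and for s ≥ 0, θ₀ ∈ ℝ, φ₀ ∈ [0, π], let M(s, θ₀, φ₀) be the 3×3 real matrix with rows (ρ₀cosθ₀sinφ₀ − ρ₁cosθ₁sinφ₁, −s·ρ₀sinθ₀sinφ₀, s·ρ₀cosφ₀cosθ₀), (ρ₀sinθ₀sinφ₀ − ρ₁sinθ₁sinφ₁, s·ρ₀cosθ₀sinφ₀, s·ρ₀cosφ₀sinθ₀), and (ρ₀cosφ₀ − ρ₁cosφ₁, 0, −s·ρ₀sinφ₀). Then |det M(s, θ₀, φ₀)| ≤ s²·ρ₀²·(ρ₀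 + ρ₁)·sinφ₀. -/
/-- The inner product of two unit vectors given in spherical coordinates is at most `1` in
absolute value. -/
lemma abs_spherical_inner_le_one (θ φ θ' φ' : ℝ) :
    |Real.cos θ * Real.sin φ * (Real.cos θ' * Real.sin φ') +
      Real.sin θ * Real.sin φ * (Real.sin θ' * Real.sin φ') +
      Real.cos φ * Real.cos φ'| ≤ 1 := by
  have unit (a b : ℝ) : (Real.cos a * Real.sin b) ^ 2 + (Real.sin a * Real.sin b) ^ 2 +
      Real.cos b ^ 2 = 1 := by
    linear_combination Real.sin b ^ 2 * Real.sin_sq_add_cos_sq a + Real.sin_sq_add_cos_sq b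
  have h := unit θ φ
  have h' := unit θ' φ'
  generalize Real.cos θ * Real.sin φ = x at *
  generalize Real.sin θ * Real.sin φ = y at *
  generalize Real.cos θ' * Real.sin φ' = x' at *
  generalize Real.sin θ' * Real.sin φ' = y' at *
  generalize Real.cos φ = z at *
  generalize Real.cos φ' = z' at *
  rw [abs_le]
  constructor
  · linarith [sq_nonneg (x + x'), sq_nonneg (y + y'), sq_nonneg (z + z')]
  · linarith [sq_nonneg (x - x'), sq_nonneg (y - y'), sq_nonneg (z - z')]

/-- Jacobian determinant bound in the minorization lemma. The Jacobian
matrix `M(s, θ₀, φ₀)` of the polar-coordinate change of variables satisfies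
`|det M| ≤ s² ρ₀² (ρ₀ + ρ₁) sin φ₀`. -/
theorem jacobian_det_bound (ρ₀ ρ₁ θ₁ φ₁ : ℝ) (hρ₀ : 0 < ρ₀) (hρ₁ : 0 < ρ₁)
    (s θ₀ φ₀ : ℝ) (hs : 0 ≤ s) (hφ₀ : φ₀ ∈ Set.Icc (0:ℝ) Real.pi) :
    |(Matrix.of
        ![![ρ₀ * Real.cos θ₀ * Real.sin φ₀ - ρ₁ * Real.cos θ₁ * Real.sin φ₁,
            -(s * ρ₀ * Real.sin θ₀ * Real.sin φ₀),
            s * ρ₀ * Real.cos φ₀ * Real.cos θ₀],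
          ![ρ₀ * Real.sin θ₀ * Real.sin φ₀ - ρ₁ * Real.sin θ₁ * Real.sin φ₁,
            s * ρ₀ * Real.cos θ₀ * Real.sin φ₀,
            s * ρ₀ * Real.cos φ₀ * Real.sin θ₀],
          ![ρ₀ * Real.cos φ₀ - ρ₁ * Real.cos φ₁,
            0,
            -(s * ρ₀ * Real.sin φ₀)]]).det| ≤
      s ^ 2 * ρ₀ ^ 2 * (ρ₀ + ρ₁) * Real.sin φ₀ := by
  have hsin : 0 ≤ Real.sin φ₀ := Real.sin_nonneg_of_mem_Icc hφ₀
  have hinner := abs_spherical_inner_le_one θ₀ φ₀ θ₁ φ₁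
  set d := Real.cos θ₀ * Real.sin φ₀ * (Real.cos θ₁ * Real.sin φ₁) +
    Real.sin θ₀ * Real.sin φ₀ * (Real.sin θ₁ * Real.sin φ₁) +
    Real.cos φ₀ * Real.cos φ₁ with hd
  have hbound : |ρ₁ * d - ρ₀| ≤ ρ₀ + ρ₁ := by
    rw [abs_le] at hinner ⊢
    constructor <;> nlinarith
  calc
    _ = |s ^ 2 * ρ₀ ^ 2 * Real.sin φ₀ * (ρ₁ * d - ρ₀)| := by
      congr 1
      rw [Matrix.det_fin_three, hd]
      simp only [Matrix.of_apply, Matrix.cons_val]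
      have hθ := Real.sin_sq_add_cos_sq θ₀
      have hφ := Real.sin_sq_add_cos_sq φ₀
      generalize Real.sin θ₀ = a at *
      generalize Real.cos θ₀ = b at *
      generalize Real.sin φ₀ = c at *
      generalize Real.cos φ₀ = e at *
      linear_combination (-(s ^ 2 * ρ₀ ^ 3 * c ^ 3) -
        s ^ 2 * ρ₀ ^ 2 * c * e * (ρ₀ * e - ρ₁ * Real.cos φ₁)) * hθ - s ^ 2 * ρ₀ ^ 3 * c * hφ
    _ = s ^ 2 * ρ₀ ^ 2 * Real.sin φ₀ * |ρ₁ * d - ρ₀| := by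
      rw [abs_mul, abs_of_nonneg (by positivity)]
    _ ≤ s ^ 2 * ρ₀ ^ 2 * Real.sin φ₀ * (ρ₀ + ρ₁) := by gcongr
    _ = s ^ 2 * ρ₀ ^ 2 * (ρ₀ + ρ₁) * Real.sin φ₀ := by ring
end

section
/- Let t > 0, ρ₀, ρ₁ > 0 and θ₁, φ₁ ∈ ℝ, and define Θ : ℝ³ → ℝ³ by Θ(s, θ₀, φ₀) = (s·ρ₀cosθ₀sinφ₀ + (t−s)·ρ₁cosθ₁sinφ₁, s·ρ₀sinθ₀sinφ₀ + (t−s)·ρ₁sinθ₁sinφ₁, s·ρ₀cosφ₀ + (t−s)·ρ₁cosφ₁). Then for every measurable F : ℝ³ → [0, ∞], ∫_{(0,t)×(0,2π)×(0,π)} F(Θ(s, θ₀, φ₀))·|det DΘ(s, θ₀, φ₀)| d(s, θ₀, φ₀) ≥ ∫_{{x ∈ ℝ³ : ‖x‖ ≤ ρ₀·t}} F(x) dx, where DΘ denotes the derivative (Jacobian matrix) of Θ and both integrals are with respect to Lebesgue measure. -/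
open MeasureTheory Set
open scoped ENNReal

noncomputable section

/-- The map `Θ(s, θ₀, φ₀) = s ρ₀ (cos θ₀ sin φ₀, sin θ₀ sin φ₀, cos φ₀)
  + (t − s) ρ₁ (cos θ₁ sin φ₁, sin θ₁ sin φ₁, cos φ₁)`, with `(s, θ₀, φ₀)` read off as the
three coordinates of a point of `ℝ³`. -/
def Theta (t ρ₀ ρ₁ θ₁ φ₁ : ℝ) (p : EuclideanSpace ℝ (Fin 3)) : EuclideanSpace ℝ (Fin 3) :=
  (EuclideanSpace.equiv (Fin 3) ℝ).symm
    ![p 0 * ρ₀ * Real.cos (p 1) * Real.sin (p 2) + (t - p 0) * ρ₁ * Real.cos θ₁ * Real.sin φ₁,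
      p 0 * ρ₀ * Real.sin (p 1) * Real.sin (p 2) + (t - p 0) * ρ₁ * Real.sin θ₁ * Real.sin φ₁,
      p 0 * ρ₀ * Real.cos (p 2) + (t - p 0) * ρ₁ * Real.cos φ₁]

/-- Every point of the unit sphere of `ℝ³` has spherical coordinates, lying in the open rectangle
`(0, 2π) × (0, π)` unless the longitude vanishes. -/
theorem exists_spherical_coordinates {a b c : ℝ} (h : a ^ 2 + b ^ 2 + c ^ 2 = 1) :
    ∃ θ φ : ℝ, a = Real.cos θ * Real.sin φ ∧ b = Real.sin θ * Real.sin φ ∧ c = Real.cos φ ∧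
      (θ = 0 ∨ θ ∈ Ioo (0 : ℝ) (2 * Real.pi) ∧ φ ∈ Ioo (0 : ℝ) Real.pi) := by
  have hc1 : -1 ≤ c := by nlinarith [sq_nonneg a, sq_nonneg b]
  have hc2 : c ≤ 1 := by nlinarith [sq_nonneg a, sq_nonneg b]
  have hcos : Real.cos (Real.arccos c) = c := Real.cos_arccos hc1 hc2
  obtain ⟨z, hz⟩ : ∃ z : ℂ, z = ⟨a, b⟩ := ⟨_, rfl⟩
  have hsin : Real.sin (Real.arccos c) = ‖z‖ := by
    rw [Real.sin_arccos, hz, Complex.norm_def, Complex.normSq_mk]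
    congr 1
    linarith
  have ha : a = Real.cos z.arg * ‖z‖ := by
    rw [mul_comm, Complex.norm_mul_cos_arg, hz]
  have hb : b = Real.sin z.arg * ‖z‖ := by
    rw [mul_comm, Complex.norm_mul_sin_arg, hz]
  by_cases harg : z.arg = 0
  · refine ⟨0, Real.arccos c, ?_, ?_, hcos.symm, Or.inl rfl⟩
    · rwa [hsin, ← harg]
    · rwa [hsin, ← harg]
  have hz0 : z ≠ 0 := by
    rintro rfl
    exact harg Complex.arg_zero
  have hpos : 0 < Real.sin (Real.arccos c) := by
    rw [hsin]
    exact norm_pos_iff.mpr hz0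
  have hφ : Real.arccos c ∈ Ioo (0 : ℝ) Real.pi := by
    constructor
    · refine lt_of_le_of_ne (Real.arccos_nonneg c) fun h => ?_
      rw [← h, Real.sin_zero] at hpos
      exact lt_irrefl _ hpos
    · refine lt_of_le_of_ne (Real.arccos_le_pi c) fun h => ?_
      rw [h, Real.sin_pi] at hpos
      exact lt_irrefl _ hpos
  have hlo := Complex.neg_pi_lt_arg z
  have hhi := Complex.arg_le_pi z
  have hpi := Real.pi_pos
  rcases lt_or_gt_of_ne harg with hneg | hpos'
  · refine ⟨z.arg + 2 * Real.pi, Real.arccos c, ?_, ?_, hcos.symm,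
      Or.inr ⟨⟨by linarith, by linarith⟩, hφ⟩⟩
    · rwa [Real.cos_add_two_pi, hsin]
    · rwa [Real.sin_add_two_pi, hsin]
  · refine ⟨z.arg, Real.arccos c, ?_, ?_, hcos.symm, Or.inr ⟨⟨hpos', by linarith⟩, hφ⟩⟩
    · rwa [hsin]
    · rwa [hsin]

/-- The inequality half of the area formula, for maps which need not be injective. -/
theorem lintegral_le_lintegral_comp_mul_abs_det_fderiv {E : Type*} [NormedAddCommGroup E]
    [NormedSpace ℝ E] [FiniteDimensional ℝ E] [MeasurableSpace E] [BorelSpace E]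
    (μ : Measure E) [μ.IsAddHaarMeasure] {f : E → E} (hf : Differentiable ℝ f)
    {s t : Set E} (hs : MeasurableSet s) (hst : t ≤ᵐ[μ] f '' s) {F : E → ℝ≥0∞}
    (hF : Measurable F) :
    ∫⁻ x in t, F x ∂μ ≤ ∫⁻ x in s, F (f x) * ENNReal.ofReal |(fderiv ℝ f x).det| ∂μ := by
  have hfm : Measurable f := hf.continuous.measurable
  have hdet : Measurable fun x => ENNReal.ofReal |(fderiv ℝ f x).det| :=
    (ContinuousLinearMap.continuous_det.measurable.comp (measurable_fderiv ℝ f)).abs.ennreal_ofReal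
  have hle : μ.restrict t ≤
      ((μ.restrict s).withDensity fun x => ENNReal.ofReal |(fderiv ℝ f x).det|).map f := by
    refine Measure.le_iff.mpr fun A hA => ?_
    rw [Measure.restrict_apply hA, Measure.map_apply hfm hA, withDensity_apply _ (hfm hA),
      Measure.restrict_restrict (hfm hA)]
    calc μ (A ∩ t) ≤ μ (f '' (f ⁻¹' A ∩ s)) := by
          refine measure_mono_ae ?_
          filter_upwards [hst] with x hx hxt
          obtain ⟨y, hy, rfl⟩ := hx hxt.2
          exact ⟨y, ⟨hxt.1, hy⟩, rfl⟩
      _ ≤ _ := addHaar_image_le_lintegral_abs_det_fderiv μ ((hfm hA).inter hs)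
          fun x _ => (hf x).hasFDerivAt.hasFDerivWithinAt
  calc ∫⁻ x in t, F x ∂μ ≤ _ := lintegral_mono' hle le_rfl
    _ = _ := by
      rw [lintegral_map hF hfm]
      refine (lintegral_withDensity_eq_lintegral_mul _ hdet (hF.comp hfm)).trans ?_
      simp only [Pi.mul_apply, Function.comp_apply, mul_comm]

theorem differentiable_Theta (t ρ₀ ρ₁ θ₁ φ₁ : ℝ) : Differentiable ℝ (Theta t ρ₀ ρ₁ θ₁ φ₁) := by
  refine (EuclideanSpace.equiv (Fin 3) ℝ).symm.differentiable.comp (differentiable_pi.mpr ?_)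
  intro i
  fin_cases i <;> simp <;> fun_prop

/-- The image of a coordinate hyperplane under a differentiable map is Lebesgue-null. -/
theorem volume_image_coord_eq_zero {n : ℕ} {f : EuclideanSpace ℝ (Fin n) → EuclideanSpace ℝ (Fin n)}
    (hf : Differentiable ℝ f) (i : Fin n) : volume (f '' {p | p i = 0}) = 0 := by
  refine addHaar_image_eq_zero_of_differentiableOn_of_addHaar_eq_zero volume hf.differentiableOn ?_
  let P : Submodule ℝ (EuclideanSpace ℝ (Fin n)) :=
    LinearMap.ker (EuclideanSpace.proj i : EuclideanSpace ℝ (Fin n) →L[ℝ] ℝ).toLinearMap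
  refine Measure.addHaar_submodule volume P fun h => ?_
  have hmem : EuclideanSpace.single i (1 : ℝ) ∈ P := h ▸ Submodule.mem_top
  simp [P] at hmem

/-- Each point of the open ball of radius `ρ₀ t` is attained by `Θ`, either on the open box or on
the plane of zero longitude. -/
theorem ball_subset_image_Theta {t ρ₀ ρ₁ θ₁ φ₁ : ℝ} (ht : 0 < t) (h0 : 0 < ρ₀) :
    Metric.ball (0 : EuclideanSpace ℝ (Fin 3)) (ρ₀ * t) ⊆
      Theta t ρ₀ ρ₁ θ₁ φ₁ '' {p | p 0 ∈ Ioo (0 : ℝ) t ∧ p 1 ∈ Ioo (0 : ℝ) (2 * Real.pi) ∧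
        p 2 ∈ Ioo (0 : ℝ) Real.pi} ∪ Theta t ρ₀ ρ₁ θ₁ φ₁ '' {p | p 1 = 0} := by
  intro x hx
  rw [mem_ball_zero_iff] at hx
  set c : EuclideanSpace ℝ (Fin 3) := !₂[ρ₁ * Real.cos θ₁ * Real.sin φ₁,
    ρ₁ * Real.sin θ₁ * Real.sin φ₁, ρ₁ * Real.cos φ₁] with hc
  have hcont : ContinuousOn (fun s : ℝ => s * ρ₀ - ‖x - (t - s) • c‖) (Icc 0 t) := by fun_prop
  obtain ⟨s, ⟨hs0, hst⟩, hs⟩ := intermediate_value_Icc ht.le hcont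
    (show (0 : ℝ) ∈ Icc _ _ from ⟨by simp, by simp; linarith⟩)
  have hs : ‖x - (t - s) • c‖ = s * ρ₀ := by
    simp only at hs
    linarith
  have hst : s < t := by
    refine lt_of_le_of_ne hst ?_
    rintro rfl
    simp at hs
    linarith
  rcases hs0.eq_or_lt with rfl | hs0
  · right
    refine ⟨0, rfl, ?_⟩
    have hxc : x = t • c := by simpa [sub_eq_zero] using hs
    ext i
    fin_cases i <;> simp [Theta, hxc, hc] <;> ring
  have hr : 0 < s * ρ₀ := mul_pos hs0 h0
  have hsq := EuclideanSpace.norm_sq_eq (x - (t - s) • c)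
  rw [hs, Fin.sum_univ_three] at hsq
  obtain ⟨v, hv⟩ : ∃ v, v = x - (t - s) • c := ⟨_, rfl⟩
  rw [← hv] at hsq
  simp only [Real.norm_eq_abs, sq_abs] at hsq
  have hxv : x = v + (t - s) • c := by rw [hv, sub_add_cancel]
  have hunit : (v 0 / (s * ρ₀)) ^ 2 + (v 1 / (s * ρ₀)) ^ 2 + (v 2 / (s * ρ₀)) ^ 2 = 1 := by
    rw [div_pow, div_pow, div_pow, ← add_div, ← add_div, ← hsq, div_self (pow_pos hr 2).ne']
  obtain ⟨θ, φ, e0, e1, e2, hθφ⟩ := exists_spherical_coordinates hunit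
  rw [div_eq_iff hr.ne'] at e0 e1 e2
  have himage : Theta t ρ₀ ρ₁ θ₁ φ₁ !₂[s, θ, φ] = x := by
    ext i
    fin_cases i <;> simp [Theta, hxv, hc, e0, e1, e2] <;> ring
  rcases hθφ with hθ | ⟨hθ, hφ⟩
  · exact Or.inr ⟨!₂[s, θ, φ], by simpa using hθ, himage⟩
  · exact Or.inl ⟨!₂[s, θ, φ], ⟨by simpa using ⟨hs0, hst⟩, by simpa using hθ, by simpa using hφ⟩,
      himage⟩

/-- change-of-variables step in the minorization lemma. Since the image
of `Θ` on `(0,t) × (0,2π) × (0,π)` covers the closed ball of radius `ρ₀ t`, the area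
formula yields the stated lower bound for every nonnegative measurable `F`. -/
theorem theta_area_formula_lower_bound (t ρ₀ ρ₁ θ₁ φ₁ : ℝ)
    (ht : 0 < t) (h0 : 0 < ρ₀) (h1 : 0 < ρ₁)
    (F : EuclideanSpace ℝ (Fin 3) → ℝ≥0∞) (hF : Measurable F) :
    (∫⁻ x in Metric.closedBall (0 : EuclideanSpace ℝ (Fin 3)) (ρ₀ * t), F x) ≤
      ∫⁻ p in {p : EuclideanSpace ℝ (Fin 3) |
          p 0 ∈ Ioo (0:ℝ) t ∧ p 1 ∈ Ioo (0:ℝ) (2 * Real.pi) ∧ p 2 ∈ Ioo (0:ℝ) Real.pi},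
        F (Theta t ρ₀ ρ₁ θ₁ φ₁ p) *
          ENNReal.ofReal |(fderiv ℝ (Theta t ρ₀ ρ₁ θ₁ φ₁) p).det| := by
  refine lintegral_le_lintegral_comp_mul_abs_det_fderiv volume
    (differentiable_Theta t ρ₀ ρ₁ θ₁ φ₁) ?_ ?_ hF
  · have hm (i : Fin 3) : Measurable fun p : EuclideanSpace ℝ (Fin 3) => p i := by fun_prop
    exact (hm 0 measurableSet_Ioo).inter ((hm 1 measurableSet_Ioo).inter (hm 2 measurableSet_Ioo))
  · have hnull := volume_image_coord_eq_zero (differentiable_Theta t ρ₀ ρ₁ θ₁ φ₁) 1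
    have hsphere := Measure.addHaar_sphere volume (0 : EuclideanSpace ℝ (Fin 3)) (ρ₀ * t)
    filter_upwards [measure_eq_zero_iff_ae_notMem.mp hnull,
      measure_eq_zero_iff_ae_notMem.mp hsphere] with x hx hxs hxb
    have hxball : x ∈ Metric.ball (0 : EuclideanSpace ℝ (Fin 3)) (ρ₀ * t) :=
      lt_of_le_of_ne hxb hxs
    exact (ball_subset_image_Theta ht h0 hxball).resolve_right hx
end
end

section
/- Let 0 < v_min < v_max and V = {υ ∈ ℝ³ : v_min ≤ ‖υ‖ ≤ v_max}. There exists a constant c > 0, depending only on v_min and v_max, such that for every r₀ ∈ ℝ³, every t > 0, every υ₁ ∈ V, and every measurable h : ℝ³ → [0, ∞]: ∫_V ∫₀ᵗ h(r₀ + s·υ₀ + (t−s)·υ₁) ds dυ₀ ≥ (c/t²)·∫_{v_min}^{v_max} ∫_{{z : ‖z − r₀‖ ≤ ρ·t}} h(z) dz dρ. -/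
open MeasureTheory Set
open scoped ENNReal

section

variable {E : Type*} [NormedAddCommGroup E] [InnerProductSpace ℝ E]

lemma volume_image_le_lintegral_abs_deriv {f f' : ℝ → ℝ} {s : Set ℝ} (hs : MeasurableSet s)
    (hf' : ∀ x ∈ s, HasDerivWithinAt f (f' x) s x) :
    volume (f '' s) ≤ ∫⁻ x in s, ENNReal.ofReal |f' x| := by
  simpa only [ContinuousLinearMap.det_toSpanSingleton] using
    addHaar_image_le_lintegral_abs_det_fderiv volume hs
      fun x hx => (hf' x hx).hasFDerivWithinAt

/-- The velocity that takes a particle from `0` to `a` in time `s`, given that it then moves for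
the time `t - s` with velocity `v`. -/
noncomputable def initialVelocity (t : ℝ) (v a : E) (s : ℝ) : E := s⁻¹ • (a - (t - s) • v)

lemma initialVelocity_eq (t : ℝ) (v a : E) {s : ℝ} (hs : s ≠ 0) :
    initialVelocity t v a s = v + s⁻¹ • (a - t • v) := by
  rw [initialVelocity, sub_smul, smul_sub, smul_sub, smul_sub, smul_smul s⁻¹ s, inv_mul_cancel₀ hs,
    one_smul]
  abel

lemma hasDerivAt_initialVelocity (t : ℝ) (v a : E) {s : ℝ} (hs : s ≠ 0) :
    HasDerivAt (initialVelocity t v a) (-(s ^ 2)⁻¹ • (a - t • v)) s := by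
  have h : HasDerivAt (fun x : ℝ => v + x⁻¹ • (a - t • v)) (-(s ^ 2)⁻¹ • (a - t • v)) s :=
    ((hasDerivAt_inv hs).smul_const _).const_add v
  refine h.congr_of_eventuallyEq ?_
  filter_upwards [isOpen_ne.mem_nhds hs] with x hx using initialVelocity_eq t v a hx

lemma exists_norm_initialVelocity_eq {t M y : ℝ} (ht : 0 < t) {v a : E} (hv : ‖v‖ ≤ M) (hM : 0 < M)
    (hav : a ≠ t • v) (hy : ‖a‖ / t ≤ y) (hyM : y ≤ M) :
    ∃ s ∈ Ioc 0 t, ‖initialVelocity t v a s‖ = y := by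
  have hb : 0 < ‖a - t • v‖ := norm_pos_iff.2 (sub_ne_zero.2 hav)
  obtain ⟨s₀, hs₀, hst, hsb⟩ : ∃ s₀ : ℝ, 0 < s₀ ∧ s₀ ≤ t ∧ s₀ ≤ ‖a - t • v‖ / (2 * M) :=
    ⟨min t (‖a - t • v‖ / (2 * M)), lt_min ht (by positivity), min_le_left _ _, min_le_right _ _⟩
  have hcont : ContinuousOn (fun s => ‖initialVelocity t v a s‖) (Icc s₀ t) := fun s hs =>
    (hasDerivAt_initialVelocity t v a
      (hs₀.trans_le hs.1).ne').continuousAt.norm.continuousWithinAt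
  have hend : ‖initialVelocity t v a t‖ = ‖a‖ / t := by
    rw [initialVelocity, sub_self, zero_smul, sub_zero, norm_smul, norm_inv, Real.norm_eq_abs,
      abs_of_pos ht, inv_mul_eq_div]
  have hstart : M ≤ ‖initialVelocity t v a s₀‖ := by
    have h1 : 2 * M ≤ ‖s₀⁻¹ • (a - t • v)‖ := by
      rw [norm_smul, norm_inv, Real.norm_eq_abs, abs_of_pos hs₀, inv_mul_eq_div,
        le_div_iff₀ hs₀, mul_comm]
      exact (le_div_iff₀ (by positivity)).1 hsb
    have h2 := norm_sub_le_norm_add (s₀⁻¹ • (a - t • v)) v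
    rw [initialVelocity_eq t v a hs₀.ne', add_comm]
    linarith
  obtain ⟨s, hs, hsy⟩ := intermediate_value_Icc' hst hcont
    ⟨hend.trans_le hy, hyM.trans hstart⟩
  exact ⟨s, ⟨hs₀.trans_le hs.1, hs.2⟩, hsy⟩

lemma abs_two_mul_inner_initialVelocity_le {t M s : ℝ} (hs : s ∈ Ioc 0 t) {v a : E}
    (hv : ‖v‖ ≤ M) (hM : 0 < M) (ha : ‖a‖ ≤ t * M) (hq : ‖initialVelocity t v a s‖ ≤ M) :
    |2 * inner ℝ (initialVelocity t v a s) (-(s ^ 2)⁻¹ • (a - t • v))| ≤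
      4 * M ^ 2 * t ^ 2 * s⁻¹ ^ 3 := by
  obtain ⟨hs0, hst⟩ := hs
  have ht : 0 < t := hs0.trans_le hst
  have hb : ‖a - t • v‖ ≤ 2 * t * M := by
    have h1 := norm_sub_le a (t • v)
    rw [norm_smul, Real.norm_eq_abs, abs_of_pos ht] at h1
    nlinarith
  have hd : ‖-(s ^ 2)⁻¹ • (a - t • v)‖ ≤ s⁻¹ ^ 3 * t * (2 * t * M) := by
    rw [norm_smul, norm_neg, norm_inv, norm_pow, Real.norm_eq_abs, abs_of_pos hs0]
    have h2 : (s ^ 2)⁻¹ ≤ s⁻¹ ^ 3 * t := by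
      have : (s ^ 2)⁻¹ = s⁻¹ ^ 3 * s := by field_simp
      rw [this]
      gcongr
    gcongr
  rw [abs_mul, abs_two]
  calc 2 * |inner ℝ (initialVelocity t v a s) (-(s ^ 2)⁻¹ • (a - t • v))|
      ≤ 2 * (‖initialVelocity t v a s‖ * ‖-(s ^ 2)⁻¹ • (a - t • v)‖) := by
        gcongr
        exact abs_real_inner_le_norm _ _
    _ ≤ 2 * (M * (s⁻¹ ^ 3 * t * (2 * t * M))) := by gcongr
    _ = 4 * M ^ 2 * t ^ 2 * s⁻¹ ^ 3 := by ring

lemma volume_speeds_le_lintegral {t m M : ℝ} (ht : 0 < t) (hm : 0 < m) {v a : E} (hv : ‖v‖ ≤ M)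
    (hM : 0 < M) (hav : a ≠ t • v)
    (hmeas : MeasurableSet {s | ‖initialVelocity t v a s‖ ∈ Icc m M}) :
    ENNReal.ofReal (1 / (4 * M) / t ^ 2) * volume {ρ ∈ Icc m M | ‖a‖ ≤ ρ * t} ≤
      ∫⁻ s in Ioc 0 t ∩ {s | ‖initialVelocity t v a s‖ ∈ Icc m M}, ENNReal.ofReal (s⁻¹ ^ 3) := by
  set U := Ioc 0 t ∩ {s | ‖initialVelocity t v a s‖ ∈ Icc m M} with hU
  set k := max m (‖a‖ / t) with hk
  have hD : {ρ ∈ Icc m M | ‖a‖ ≤ ρ * t} = Icc k M := by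
    ext ρ
    simp only [mem_ofPred_eq, mem_Icc, hk, max_le_iff, div_le_iff₀ ht]
    tauto
  rw [hD, Real.volume_Icc]
  rcases lt_or_ge M k with hkM | hkM
  · simp [ENNReal.ofReal_of_nonpos (sub_nonpos.2 hkM.le)]
  have hk0 : 0 < k := hm.trans_le (le_max_left _ _)
  have ha : ‖a‖ ≤ t * M := by
    rw [mul_comm]
    exact (div_le_iff₀ ht).1 ((le_max_right _ _).trans hkM)
  have himage : Icc (k ^ 2) (M ^ 2) ⊆ (fun s => ‖initialVelocity t v a s‖ ^ 2) '' U := by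
    rintro x ⟨hx1, hx2⟩
    have hx : 0 ≤ x := (sq_nonneg k).trans hx1
    have hkx : k ≤ √x := Real.le_sqrt_of_sq_le hx1
    have hxM : √x ≤ M := Real.sqrt_le_iff.2 ⟨hM.le, hx2⟩
    obtain ⟨s, hs, hsx⟩ := exists_norm_initialVelocity_eq ht hv hM hav
      ((le_max_right _ _).trans hkx) hxM
    refine ⟨s, ⟨hs, ?_⟩, ?_⟩
    · rw [mem_ofPred_eq, hsx]
      exact ⟨(le_max_left _ _).trans hkx, hxM⟩
    · simp only [hsx, Real.sq_sqrt hx]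
  have hkey : ENNReal.ofReal (M ^ 2 - k ^ 2) ≤
      ENNReal.ofReal (4 * M ^ 2 * t ^ 2) * ∫⁻ s in U, ENNReal.ofReal (s⁻¹ ^ 3) := by
    calc ENNReal.ofReal (M ^ 2 - k ^ 2) = volume (Icc (k ^ 2) (M ^ 2)) := Real.volume_Icc.symm
      _ ≤ volume ((fun s => ‖initialVelocity t v a s‖ ^ 2) '' U) := measure_mono himage
      _ ≤ ∫⁻ s in U, ENNReal.ofReal
            |2 * inner ℝ (initialVelocity t v a s) (-(s ^ 2)⁻¹ • (a - t • v))| :=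
          volume_image_le_lintegral_abs_deriv (measurableSet_Ioc.inter hmeas) fun s hs =>
            (hasDerivAt_initialVelocity t v a hs.1.1.ne').norm_sq.hasDerivWithinAt
      _ ≤ ∫⁻ s in U, ENNReal.ofReal (4 * M ^ 2 * t ^ 2) * ENNReal.ofReal (s⁻¹ ^ 3) := by
          refine setLIntegral_mono' (measurableSet_Ioc.inter hmeas) fun s hs => ?_
          rw [← ENNReal.ofReal_mul (by positivity)]
          exact ENNReal.ofReal_le_ofReal
            (abs_two_mul_inner_initialVelocity_le hs.1 hv hM ha hs.2.2)
      _ = _ := lintegral_const_mul' _ _ ENNReal.ofReal_ne_top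
  have hc : 0 < 4 * M ^ 2 * t ^ 2 := by positivity
  calc ENNReal.ofReal (1 / (4 * M) / t ^ 2) * ENNReal.ofReal (M - k)
      = ENNReal.ofReal ((4 * M ^ 2 * t ^ 2)⁻¹) * ENNReal.ofReal (M * (M - k)) := by
        rw [← ENNReal.ofReal_mul (by positivity), ← ENNReal.ofReal_mul (by positivity)]
        congr 1
        field_simp
    _ ≤ ENNReal.ofReal ((4 * M ^ 2 * t ^ 2)⁻¹) * ENNReal.ofReal (M ^ 2 - k ^ 2) := by
        gcongr
        nlinarith
    _ ≤ ENNReal.ofReal ((4 * M ^ 2 * t ^ 2)⁻¹) *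
          (ENNReal.ofReal (4 * M ^ 2 * t ^ 2) * ∫⁻ s in U, ENNReal.ofReal (s⁻¹ ^ 3)) := by
        gcongr
    _ = ∫⁻ s in U, ENNReal.ofReal (s⁻¹ ^ 3) := by
        rw [← mul_assoc, ← ENNReal.ofReal_mul (by positivity), inv_mul_cancel₀ hc.ne',
          ENNReal.ofReal_one, one_mul]

variable [FiniteDimensional ℝ E] [MeasurableSpace E] [BorelSpace E]

lemma lintegral_comp_add_smul_s9 (b : E) {s : ℝ} (hs : 0 < s) {f : E → ℝ≥0∞} (hf : Measurable f) :
    ∫⁻ x, f (b + s • x) = ENNReal.ofReal (s⁻¹ ^ Module.finrank ℝ E) * ∫⁻ x, f x := by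
  have h : ∫⁻ x, f (b + x) ∂(Measure.map (s • ·) (volume : Measure E)) = ∫⁻ x, f (b + s • x) :=
    lintegral_map (by fun_prop) (by fun_prop)
  rw [← h, Measure.map_addHaar_smul _ hs.ne', lintegral_smul_measure, lintegral_add_left_eq_self,
    inv_pow, abs_of_pos (by positivity), smul_eq_mul]

/-- The pairs `(s, z)` for which the initial velocity leading from `r` to `z` has its norm
in `[m, M]`. -/
def admissible (t m M : ℝ) (v r : E) : Set (ℝ × E) :=
  {p | ‖initialVelocity t v (p.2 - r) p.1‖ ∈ Icc m M}

lemma measurableSet_admissible (t m M : ℝ) (v r : E) : MeasurableSet (admissible t m M v r) := by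
  have : Measurable fun p : ℝ × E => ‖initialVelocity t v (p.2 - r) p.1‖ := by
    unfold initialVelocity
    fun_prop
  exact this measurableSet_Icc

lemma lintegral_sweep_eq (t m M : ℝ) (v r : E) {h : E → ℝ≥0∞} (hh : Measurable h) :
    ∫⁻ u in {u : E | m ≤ ‖u‖ ∧ ‖u‖ ≤ M}, ∫⁻ s in Icc (0 : ℝ) t, h (r + s • u + (t - s) • v) =
      ∫⁻ z, (∫⁻ s in Ioc 0 t ∩ {s | ‖initialVelocity t v (z - r) s‖ ∈ Icc m M},
        ENNReal.ofReal (s⁻¹ ^ Module.finrank ℝ E)) * h z := by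
  have hV : MeasurableSet {u : E | m ≤ ‖u‖ ∧ ‖u‖ ≤ M} := measurable_norm measurableSet_Icc
  have hA := measurableSet_admissible t m M v r
  rw [lintegral_lintegral_swap (by fun_prop), ← restrict_Ioc_eq_restrict_Icc]
  have hinner : ∀ s ∈ Ioc 0 t, ∫⁻ u in {u : E | m ≤ ‖u‖ ∧ ‖u‖ ≤ M}, h (r + s • u + (t - s) • v) =
      ∫⁻ z, (admissible t m M v r).indicator
        (fun p => ENNReal.ofReal (p.1⁻¹ ^ Module.finrank ℝ E)) (s, z) * h z := by
    intro s hs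
    have hAs : MeasurableSet {z | (s, z) ∈ admissible t m M v r} := measurable_prodMk_left hA
    have key := lintegral_comp_add_smul_s9 (r + (t - s) • v) hs.1 (hh.indicator hAs)
    rw [← lintegral_const_mul _ (hh.indicator hAs)] at key
    rw [← lintegral_indicator hV]
    refine Eq.trans (lintegral_congr fun x => ?_) (key.trans (lintegral_congr fun z => ?_))
    · have : initialVelocity t v (r + (t - s) • v + s • x - r) s = x := by
        rw [initialVelocity, show r + (t - s) • v + s • x - r - (t - s) • v = s • x by abel,
          smul_smul, inv_mul_cancel₀ hs.1.ne', one_smul]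
      simp only [indicator, admissible, mem_ofPred_eq, this, mem_Icc]
      rw [add_right_comm]
    · simp only [indicator, mem_ofPred_eq]
      split_ifs <;> simp
  rw [setLIntegral_congr_fun measurableSet_Ioc hinner, lintegral_lintegral_swap]
  · refine lintegral_congr fun z => ?_
    have hAz : MeasurableSet {s | ‖initialVelocity t v (z - r) s‖ ∈ Icc m M} :=
      measurable_prodMk_right hA
    rw [lintegral_mul_const, inter_comm, ← Measure.restrict_restrict hAz,
      ← lintegral_indicator hAz]
    · rfl
    · exact (Measurable.indicator (by fun_prop) hA).comp measurable_prodMk_right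
  · exact ((Measurable.indicator (by fun_prop) hA).mul (hh.comp measurable_snd)).aemeasurable

lemma lintegral_closedBall_eq (t m M : ℝ) (r : E) {h : E → ℝ≥0∞} (hh : Measurable h) :
    ∫⁻ ρ in Icc m M, ∫⁻ z in Metric.closedBall r (ρ * t), h z =
      ∫⁻ z, volume {ρ ∈ Icc m M | ‖z - r‖ ≤ ρ * t} * h z := by
  have hB : MeasurableSet {p : ℝ × E | ‖p.2 - r‖ ≤ p.1 * t} :=
    measurableSet_le (by fun_prop) (by fun_prop)
  have hball : ∀ ρ, ∫⁻ z in Metric.closedBall r (ρ * t), h z =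
      ∫⁻ z, {p : ℝ × E | ‖p.2 - r‖ ≤ p.1 * t}.indicator 1 (ρ, z) * h z := by
    intro ρ
    rw [← lintegral_indicator measurableSet_closedBall]
    refine lintegral_congr fun z => ?_
    simp [indicator, dist_eq_norm]
  simp_rw [hball]
  rw [lintegral_lintegral_swap]
  · refine lintegral_congr fun z => ?_
    have hBz : MeasurableSet {ρ : ℝ | ‖z - r‖ ≤ ρ * t} := measurable_prodMk_right hB
    rw [lintegral_mul_const]
    swap
    · exact (measurable_one.indicator hB).comp measurable_prodMk_right
    congr 1
    rw [show {ρ ∈ Icc m M | ‖z - r‖ ≤ ρ * t} = {ρ : ℝ | ‖z - r‖ ≤ ρ * t} ∩ Icc m M from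
      inter_comm _ _, ← Measure.restrict_apply hBz, ← lintegral_indicator_one hBz]
    rfl
  · exact ((measurable_one.indicator hB).mul (hh.comp measurable_snd)).aemeasurable

end


/-- analytic core of the minorization Lemma 7.3 of the paper. There is a
constant `c > 0`, depending only on `vmin` and `vmax`, such that sweeping a straight-line
segment over all intermediate velocities and times covers a solid ball:
`∫_V ∫₀ᵗ h(r₀ + s υ₀ + (t−s) υ₁) ds dυ₀ ≥ (c/t²) ∫_{vmin}^{vmax} ∫_{B(r₀, ρt)} h(z) dz dρ`. -/
theorem sweep_covers_ball (vmin vmax : ℝ) (h1 : 0 < vmin) (h2 : vmin < vmax) :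
    ∃ c : ℝ, 0 < c ∧ ∀ (r₀ : EuclideanSpace ℝ (Fin 3)) (t : ℝ), 0 < t →
      ∀ υ₁ ∈ {υ : EuclideanSpace ℝ (Fin 3) | vmin ≤ ‖υ‖ ∧ ‖υ‖ ≤ vmax},
      ∀ h : EuclideanSpace ℝ (Fin 3) → ℝ≥0∞, Measurable h →
      ENNReal.ofReal (c / t ^ 2) *
          (∫⁻ ρ in Icc vmin vmax, ∫⁻ z in Metric.closedBall r₀ (ρ * t), h z) ≤
        ∫⁻ υ₀ in {υ : EuclideanSpace ℝ (Fin 3) | vmin ≤ ‖υ‖ ∧ ‖υ‖ ≤ vmax},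
          ∫⁻ s in Icc (0:ℝ) t, h (r₀ + s • υ₀ + (t - s) • υ₁) := by
  have hM : 0 < vmax := h1.trans h2
  refine ⟨1 / (4 * vmax), by positivity, fun r₀ t ht υ₁ hυ₁ h hh => ?_⟩
  rw [lintegral_sweep_eq t vmin vmax υ₁ r₀ hh, lintegral_closedBall_eq t vmin vmax r₀ hh,
    ← lintegral_const_mul' _ _ ENNReal.ofReal_ne_top, finrank_euclideanSpace_fin]
  refine lintegral_mono_ae ?_
  filter_upwards [Measure.ae_ne volume (r₀ + t • υ₁)] with z hz
  rw [← mul_assoc]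
  gcongr
  exact volume_speeds_le_lintegral ht h1 hυ₁.2 hM (fun hza => hz (by rw [← hza]; abel))
    (measurable_prodMk_right (measurableSet_admissible t vmin vmax υ₁ r₀))
end

section
/- Let 0 < v_min < v_max, let V = {υ ∈ ℝ³ : v_min ≤ ‖υ‖ ≤ v_max}, and let a > 0. Then for every x₀ ∈ ℝ³ and every measurable f : ℝ³ → [0, ∞]: ∫_V ∫₀^∞ e^{−a·j}·f(x₀ + j·υ) dj dυ ≤ v_max·(v_max − v_min)·∫_{ℝ³} e^{−a‖x‖/v_max}·‖x‖^{−2}·f(x₀ + x) dx. -/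
open MeasureTheory Set
open scoped ENNReal

/-- Integration of a nonnegative function in polar coordinates. -/
theorem lintegral_eq_lintegral_toSphere_lintegral_Ioi {E : Type*} [NormedAddCommGroup E]
    [NormedSpace ℝ E] [Nontrivial E] [FiniteDimensional ℝ E] [MeasurableSpace E] [BorelSpace E]
    (μ : Measure E) [μ.IsAddHaarMeasure] {g : E → ℝ≥0∞} (hg : Measurable g) :
    ∫⁻ x, g x ∂μ = ∫⁻ θ : Metric.sphere (0 : E) 1, (∫⁻ r in Ioi (0 : ℝ),
      ENNReal.ofReal (r ^ (Module.finrank ℝ E - 1)) * g (r • (θ : E))) ∂μ.toSphere := by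
  have hg' : Measurable fun p : Metric.sphere (0 : E) 1 × Ioi (0 : ℝ) ↦
      g ((p.2 : ℝ) • (p.1 : E)) := by fun_prop
  calc
    ∫⁻ x, g x ∂μ = ∫⁻ x : ({(0)}ᶜ : Set E), g x ∂(μ.comap (↑)) := by
      rw [lintegral_subtype_comap (measurableSet_singleton _).compl g, restrict_compl_singleton]
    _ = ∫⁻ p, g ((p.2 : ℝ) • (p.1 : E)) ∂μ.toSphere.prod
          (.volumeIoiPow (Module.finrank ℝ E - 1)) := by
      rw [← μ.measurePreserving_homeomorphUnitSphereProd.lintegral_comp hg']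
      refine lintegral_congr fun x ↦ ?_
      have hx : ‖(x : E)‖ ≠ 0 := norm_ne_zero_iff.2 x.2
      simp [smul_smul, hx]
    _ = _ := by
      rw [lintegral_prod _ hg'.aemeasurable]
      refine lintegral_congr fun θ ↦ ?_
      rw [Measure.volumeIoiPow, lintegral_withDensity_eq_lintegral_mul _ (by fun_prop)
        (by fun_prop)]
      exact lintegral_subtype_comap measurableSet_Ioi fun r : ℝ ↦
        ENNReal.ofReal (r ^ (Module.finrank ℝ E - 1)) * g (r • (θ : E))

theorem ofReal_mul_lintegral_Ioi_comp_mul_left {r : ℝ} (hr : 0 < r) (g : ℝ → ℝ≥0∞) :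
    ENNReal.ofReal r * ∫⁻ j in Ioi (0 : ℝ), g (r * j) = ∫⁻ s in Ioi (0 : ℝ), g s := by
  have himage : (fun j ↦ r * j) '' Ioi (0 : ℝ) = Ioi 0 := by
    simpa using image_mul_left_Ioi hr 0
  have h := lintegral_image_eq_lintegral_abs_deriv_mul (s := Ioi (0 : ℝ)) (f := fun j ↦ r * j)
    (f' := fun _ ↦ r) measurableSet_Ioi
    (fun j _ ↦ by simpa using ((hasDerivAt_id j).const_mul r).hasDerivWithinAt)
    (mul_right_injective₀ hr.ne').injOn g
  rw [himage] at h
  rw [h, abs_of_pos hr, lintegral_const_mul' _ _ ENNReal.ofReal_ne_top]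

/-- polar-coordinates upper bound in Lemma 7.3 of the paper. For the
velocity annulus `V = {vmin ≤ ‖υ‖ ≤ vmax}` and any `a > 0`,
`∫_V ∫₀^∞ e^{−aj} f(x₀ + jυ) dj dυ ≤ vmax (vmax − vmin) ∫_{ℝ³} e^{−a‖x‖/vmax} ‖x‖⁻² f(x₀+x) dx`. -/
theorem velocity_time_change_of_variables_upper (vmin vmax a : ℝ)
    (h1 : 0 < vmin) (h2 : vmin < vmax) (ha : 0 < a)
    (x₀ : EuclideanSpace ℝ (Fin 3))
    (f : EuclideanSpace ℝ (Fin 3) → ℝ≥0∞) (hf : Measurable f) :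
    (∫⁻ υ in {υ : EuclideanSpace ℝ (Fin 3) | vmin ≤ ‖υ‖ ∧ ‖υ‖ ≤ vmax},
        ∫⁻ j in Ioi (0:ℝ), ENNReal.ofReal (Real.exp (-(a * j))) * f (x₀ + j • υ)) ≤
      ENNReal.ofReal (vmax * (vmax - vmin)) *
        ∫⁻ x, ENNReal.ofReal (Real.exp (-(a * ‖x‖ / vmax)) / ‖x‖ ^ 2) * f (x₀ + x) := by
  have hvmax : 0 < vmax := h1.trans h2
  have hV : MeasurableSet {υ : EuclideanSpace ℝ (Fin 3) | vmin ≤ ‖υ‖ ∧ ‖υ‖ ≤ vmax} :=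
    (measurableSet_le measurable_const measurable_norm).inter
      (measurableSet_le measurable_norm measurable_const)
  have hF : Measurable fun υ : EuclideanSpace ℝ (Fin 3) ↦
      ∫⁻ j in Ioi (0:ℝ), ENNReal.ofReal (Real.exp (-(a * j))) * f (x₀ + j • υ) := by
    refine Measurable.lintegral_prod_right' (f := fun p : EuclideanSpace ℝ (Fin 3) × ℝ ↦
      ENNReal.ofReal (Real.exp (-(a * p.2))) * f (x₀ + p.2 • p.1)) ?_
    fun_prop
  have hdim : Module.finrank ℝ (EuclideanSpace ℝ (Fin 3)) - 1 = 2 := by simp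
  rw [← lintegral_indicator hV, lintegral_eq_lintegral_toSphere_lintegral_Ioi _ (hF.indicator hV),
    lintegral_eq_lintegral_toSphere_lintegral_Ioi volume (E := EuclideanSpace ℝ (Fin 3))
      (g := fun x ↦ ENNReal.ofReal (Real.exp (-(a * ‖x‖ / vmax)) / ‖x‖ ^ 2) * f (x₀ + x))
      (by fun_prop),
    ← lintegral_const_mul' _ _ ENNReal.ofReal_ne_top, hdim]
  refine lintegral_mono fun θ ↦ ?_
  have hθ : ‖(θ : EuclideanSpace ℝ (Fin 3))‖ = 1 := by simp
  set G : ℝ≥0∞ := ∫⁻ s in Ioi (0 : ℝ),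
    ENNReal.ofReal (Real.exp (-(a * s / vmax))) * f (x₀ + s • θ) with hG
  have hright : ∫⁻ r in Ioi (0 : ℝ), ENNReal.ofReal (r ^ 2) *
      (ENNReal.ofReal (Real.exp (-(a * ‖r • (θ : EuclideanSpace ℝ (Fin 3))‖ / vmax)) /
        ‖r • (θ : EuclideanSpace ℝ (Fin 3))‖ ^ 2) * f (x₀ + r • θ)) = G := by
    refine setLIntegral_congr_fun measurableSet_Ioi fun r (hr : 0 < r) ↦ ?_
    simp only [norm_smul, hθ, mul_one, Real.norm_of_nonneg hr.le]
    rw [← mul_assoc, ← ENNReal.ofReal_mul (by positivity), mul_div_cancel₀ _ (by positivity)]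
  have hradial (r : ℝ) (hr : r ∈ Icc vmin vmax) :
      ENNReal.ofReal (r ^ 2) * ∫⁻ j in Ioi (0 : ℝ), ENNReal.ofReal (Real.exp (-(a * j))) *
        f (x₀ + j • r • (θ : EuclideanSpace ℝ (Fin 3))) ≤ ENNReal.ofReal vmax * G := by
    have hr0 : 0 < r := h1.trans_le hr.1
    rw [hG, ← ofReal_mul_lintegral_Ioi_comp_mul_left hr0 fun s ↦
        ENNReal.ofReal (Real.exp (-(a * s / vmax))) * f (x₀ + s • θ),
      pow_two, ENNReal.ofReal_mul hr0.le, mul_assoc]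
    refine mul_le_mul' (ENNReal.ofReal_le_ofReal hr.2) (mul_le_mul' le_rfl
      (setLIntegral_mono' measurableSet_Ioi fun j (hj : 0 < j) ↦ ?_))
    rw [smul_smul, mul_comm j r]
    refine mul_le_mul' (ENNReal.ofReal_le_ofReal (Real.exp_le_exp.2 (neg_le_neg ?_))) le_rfl
    rw [div_le_iff₀ hvmax]
    nlinarith [mul_le_mul_of_nonneg_left hr.2 (mul_pos ha hj).le]
  rw [hright]
  calc
    _ ≤ ∫⁻ r in Ioi (0 : ℝ), (Icc vmin vmax).indicator (fun _ ↦ ENNReal.ofReal vmax * G) r := by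
      refine setLIntegral_mono' measurableSet_Ioi fun r (hr : 0 < r) ↦ ?_
      have hnorm : ‖r • (θ : EuclideanSpace ℝ (Fin 3))‖ = r := by
        rw [norm_smul, hθ, mul_one, Real.norm_of_nonneg hr.le]
      by_cases h : r ∈ Icc vmin vmax
      · rw [indicator_of_mem h, indicator_of_mem (by simpa [hnorm] using h)]
        exact hradial r h
      · rw [indicator_of_notMem (by simpa [hnorm] using h), mul_zero]
        exact zero_le
    _ ≤ ∫⁻ r, (Icc vmin vmax).indicator (fun _ ↦ ENNReal.ofReal vmax * G) r :=
      setLIntegral_le_lintegral _ _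
    _ = ENNReal.ofReal (vmax * (vmax - vmin)) * G := by
      rw [lintegral_indicator_const measurableSet_Icc, Real.volume_Icc,
        ENNReal.ofReal_mul hvmax.le, mul_right_comm]
end
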